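/- On D(P_RCCS) the following strict inclusions hold: ≈p ⊊ =□^p ⊊ =◇^p; that is, probabilistic weak bisimilarity lifted to distributions is strictly finer than the box equivalence for the testing context 𝒟 = D(P_RCCS), which in turn is strictly finer than the diamond equivalence for 𝒟 = D(P_RCCS). -/

import Mathlib

open scoped Classical

/-! ## Channels, actions, RCCS terms -/

/-- Channels, drawn from an infinite set. -/
abbrev Chan := ℕ

/-- Actions: input/output labels over channels, the silent action `τ`, and the
distinguished success action `ω` (used only by observers). -/
inductive Act where
  | inp : Chan → Act
  | out : Chan → Act
  | tau : Act
  | omega : Act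
deriving DecidableEq

/-- `α` is an external label, i.e. a member of `𝓛 = N ∪ N̄`. -/
def Act.IsLabel : Act → Prop
  | .inp _ => True
  | .out _ => True
  | _ => False

/-- Complementary labels (for communication). -/
def Act.Comp : Act → Act → Prop := fun x y =>
  ∃ a, (x = .inp a ∧ y = .out a) ∨ (x = .out a ∧ y = .inp a)

/-- `β, β̄ ∉ L`: the action is not blocked by the localization `(L)-`. -/
def Act.Allowed (L : Finset Chan) : Act → Prop
  | .inp a => a ∉ L
  | .out a => a ∉ L
  | _ => True

/-- Channels occurring in an action. -/
def Act.chans : Act → Finset Chan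
  | .inp a => {a}
  | .out a => {a}
  | _ => ∅

/-- RCCS (and RCCS^ω) terms, with de Bruijn indices for process variables.
`sum k acts conts` is the nondeterministic choice `Σ_{i∈I} α_i.T_i` over the
nonempty finite index set `I = Fin (k+1)`, and `oplus k w conts` is the
probabilistic choice `⊕_{i∈I} p_i τ.T_i`. `fix T` is `μX.T` (binding index 0). -/
inductive Tm where
  | nil : Tm
  | var : ℕ → Tm
  | sum : (k : ℕ) → (Fin (k+1) → Act) → (Fin (k+1) → Tm) → Tm
  | oplus : (k : ℕ) → (Fin (k+1) → ℝ) → (Fin (k+1) → Tm) → Tm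
  | par : Tm → Tm → Tm
  | loc : Finset Chan → Tm → Tm
  | fix : Tm → Tm

/-- Substitution `T{P/X}` of a (closed) term `P` for the de Bruijn variable `n`. -/
def Tm.subst (P : Tm) : ℕ → Tm → Tm
  | _, .nil => .nil
  | n, .var m => if m = n then P else .var m
  | n, .sum k a c => .sum k a (fun i => Tm.subst P n (c i))
  | n, .oplus k w c => .oplus k w (fun i => Tm.subst P n (c i))
  | n, .par S T => .par (Tm.subst P n S) (Tm.subst P n T)
  | n, .loc L T => .loc L (Tm.subst P n T)
  | n, .fix T => .fix (Tm.subst P (n+1) T)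

/-- `T` has all its free variables among the first `n` de Bruijn indices.
`ClosedAt 0 T` means `T` is closed; `ClosedAt 1 T` means at most one free variable. -/
def Tm.ClosedAt : ℕ → Tm → Prop
  | _, .nil => True
  | n, .var m => m < n
  | n, .sum _ _ c => ∀ i, Tm.ClosedAt n (c i)
  | n, .oplus _ _ c => ∀ i, Tm.ClosedAt n (c i)
  | n, .par S T => Tm.ClosedAt n S ∧ Tm.ClosedAt n T
  | n, .loc _ T => Tm.ClosedAt n T
  | n, .fix T => Tm.ClosedAt (n+1) T

/-- The success action `ω` does not occur in `T` (so `T` is a genuine RCCS term). -/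
def Tm.NoOmega : Tm → Prop
  | .nil => True
  | .var _ => True
  | .sum _ a c => (∀ i, a i ≠ Act.omega) ∧ (∀ i, Tm.NoOmega (c i))
  | .oplus _ _ c => ∀ i, Tm.NoOmega (c i)
  | .par S T => Tm.NoOmega S ∧ Tm.NoOmega T
  | .loc _ T => Tm.NoOmega T
  | .fix T => Tm.NoOmega T

/-- No probabilistic choice occurs in `T` (so `T` is a CCS term). -/
def Tm.NoOplus : Tm → Prop
  | .nil => True
  | .var _ => True
  | .sum _ _ c => ∀ i, Tm.NoOplus (c i)
  | .oplus _ _ _ => False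
  | .par S T => Tm.NoOplus S ∧ Tm.NoOplus T
  | .loc _ T => Tm.NoOplus T
  | .fix T => Tm.NoOplus T

/-- The channels `N(T)` occurring in a term. -/
def Tm.chans : Tm → Finset Chan
  | .nil => ∅
  | .var _ => ∅
  | .sum _ a c =>
      (Finset.univ.sup fun i => (a i).chans) ∪ (Finset.univ.sup fun i => Tm.chans (c i))
  | .oplus _ _ c => Finset.univ.sup fun i => Tm.chans (c i)
  | .par S T => S.chans ∪ T.chans
  | .loc L T => L ∪ T.chans
  | .fix T => T.chans

/-- Renaming of channels in an action. -/
def Act.rename (f : Chan → Chan) : Act → Act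
  | .inp a => .inp (f a)
  | .out a => .out (f a)
  | x => x

/-- Renaming `T[f]` of the global channels of a term (local channels are untouched). -/
def Tm.rename : (Chan → Chan) → Tm → Tm
  | _, .nil => .nil
  | _, .var m => .var m
  | f, .sum k a c => .sum k (fun i => (a i).rename f) (fun i => Tm.rename f (c i))
  | f, .oplus k w c => .oplus k w (fun i => Tm.rename f (c i))
  | f, .par S T => .par (Tm.rename f S) (Tm.rename f T)
  | f, .loc L T => .loc L (Tm.rename (fun a => if a ∈ L then a else f a) T)
  | f, .fix T => .fix (Tm.rename f T)

/-- `P` is an RCCS process: closed and without the success action. -/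
def Tm.IsProc (P : Tm) : Prop := Tm.ClosedAt 0 P ∧ Tm.NoOmega P

/-- `P` is a CCS process: a process without probabilistic choice. -/
def Tm.IsCCS (P : Tm) : Prop := P.IsProc ∧ Tm.NoOplus P

/-! ## Finitely supported distributions -/

/-- Finitely supported probability distributions on `α`. -/
structure FinDist (α : Type) where
  toFun : α → ℝ
  nonneg : ∀ a, 0 ≤ toFun a
  finite_support : (Function.support toFun).Finite
  sum_one : ∑ᶠ a, toFun a = 1

namespace FinDist

/-- The probability `μ(φ)` that a predicate (set) `φ` holds under `μ`. -/
noncomputable def mass {α : Type} (μ : FinDist α) (φ : Set α) : ℝ :=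
  ∑ᶠ a ∈ φ, μ.toFun a

/-- The Dirac distribution `δ_P`. -/
noncomputable def dirac {α : Type} (P : α) : FinDist α where
  toFun := fun Q => if Q = P then 1 else 0
  nonneg := by intro a; by_cases h : a = P <;> simp [h]
  finite_support := by
    apply Set.Finite.subset (Set.finite_singleton P)
    intro a ha
    by_contra h
    simp only [Set.mem_singleton_iff] at h
    simp [Function.mem_support, h] at ha
  sum_one := by
    rw [finsum_eq_single _ P (fun b hb => by simp [hb])]
    simp

/-- Pushforward of a finitely supported distribution along a map. -/
noncomputable def map {α β : Type} (g : α → β) (μ : FinDist α) : FinDist β where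
  toFun := fun b => ∑ᶠ a ∈ {a | g a = b}, μ.toFun a
  nonneg := by
    intro b
    exact finsum_nonneg fun a => finsum_nonneg fun _ => μ.nonneg a
  finite_support := by
    apply Set.Finite.subset (μ.finite_support.image g)
    intro b hb
    rw [Function.mem_support] at hb
    by_contra h
    apply hb
    apply finsum_mem_eq_zero_of_forall_eq_zero
    intro a ha
    by_contra ha0
    exact h ⟨a, Function.mem_support.mpr ha0, ha⟩
  sum_one := by
    classical
    set s := μ.finite_support.toFinset with hs
    have hfib : ∀ b : β, (∑ᶠ a ∈ {a | g a = b}, μ.toFun a)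
        = ∑ a ∈ s.filter (fun a => g a = b), μ.toFun a := by
      intro b
      apply finsum_mem_eq_sum_of_inter_support_eq
      ext a
      simp only [Set.mem_inter_iff, Set.mem_setOf_eq, Finset.coe_filter,
        Set.Finite.mem_toFinset, Function.mem_support, hs]
      tauto
    have hsub : Function.support (fun b : β => ∑ᶠ a ∈ {a | g a = b}, μ.toFun a) ⊆
        ↑(s.image g) := by
      intro b hb
      rw [Function.mem_support, hfib] at hb
      obtain ⟨a, ha, hne⟩ := Finset.exists_ne_zero_of_sum_ne_zero hb
      rw [Finset.mem_filter] at ha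
      simp only [Finset.coe_image, Set.mem_image, Finset.mem_coe]
      exact ⟨a, ha.1, ha.2⟩
    rw [finsum_eq_finset_sum_of_support_subset _ hsub]
    calc ∑ b ∈ s.image g, ∑ᶠ a ∈ {a | g a = b}, μ.toFun a
        = ∑ b ∈ s.image g, ∑ a ∈ s.filter (fun a => g a = b), μ.toFun a :=
          Finset.sum_congr rfl fun b _ => hfib b
      _ = ∑ a ∈ s, μ.toFun a :=
          Finset.sum_fiberwise_of_maps_to (fun a ha => Finset.mem_image_of_mem g ha)
            μ.toFun
      _ = 1 := by rw [← finsum_eq_sum μ.toFun μ.finite_support]; exact μ.sum_one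

/-- The product of two finitely supported distributions. -/
noncomputable def prod {α β : Type} (μ : FinDist α) (ν : FinDist β) :
    FinDist (α × β) where
  toFun := fun x => μ.toFun x.1 * ν.toFun x.2
  nonneg := fun x => mul_nonneg (μ.nonneg _) (ν.nonneg _)
  finite_support := by
    apply Set.Finite.subset (μ.finite_support.prod ν.finite_support)
    intro x hx
    rw [Function.mem_support] at hx
    have h := mul_ne_zero_iff.mp hx
    exact ⟨Function.mem_support.mpr h.1, Function.mem_support.mpr h.2⟩
  sum_one := by
    classical
    have hsub : Function.support (fun x : α × β => μ.toFun x.1 * ν.toFun x.2) ⊆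
        ↑(μ.finite_support.toFinset ×ˢ ν.finite_support.toFinset) := by
      intro x hx
      rw [Function.mem_support] at hx
      have h := mul_ne_zero_iff.mp hx
      simp only [Finset.coe_product, Set.mem_prod, Set.Finite.coe_toFinset]
      exact ⟨h.1, h.2⟩
    rw [finsum_eq_finset_sum_of_support_subset _ hsub, Finset.sum_product]
    have h1 : ∑ a ∈ μ.finite_support.toFinset, μ.toFun a = 1 := by
      rw [← finsum_eq_sum μ.toFun μ.finite_support]; exact μ.sum_one
    have h2 : ∑ b ∈ ν.finite_support.toFinset, ν.toFun b = 1 := by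
      rw [← finsum_eq_sum ν.toFun ν.finite_support]; exact ν.sum_one
    calc ∑ a ∈ μ.finite_support.toFinset, ∑ b ∈ ν.finite_support.toFinset,
          μ.toFun a * ν.toFun b
        = ∑ a ∈ μ.finite_support.toFinset, μ.toFun a * 1 := by
          refine Finset.sum_congr rfl fun a _ => ?_
          rw [← Finset.mul_sum, h2]
      _ = 1 := by simpa using h1

/-- Parallel composition `μ | ν` of distributions:
`(μ|ν)(A|B) = μ(A)·ν(B)`. -/
noncomputable def parD (μ ν : FinDist Tm) : FinDist Tm :=
  (μ.prod ν).map fun x => Tm.par x.1 x.2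

/-- Localization `(L)μ` of a distribution. -/
noncomputable def locD (L : Finset Chan) (μ : FinDist Tm) : FinDist Tm :=
  μ.map (Tm.loc L)

/-- Renaming `μ[f]` of a distribution. -/
noncomputable def renameD (f : Chan → Chan) (μ : FinDist Tm) : FinDist Tm :=
  μ.map (Tm.rename f)

/-- Instantiation `ϑ[P]` of a 1-ary distribution `ϑ` at the process `P`. -/
noncomputable def instD (ϑ : FinDist Tm) (P : Tm) : FinDist Tm :=
  ϑ.map (fun T => Tm.subst P 0 T)

/-- Every element of the support is a process (`μ ∈ D(P_RCCS)`). -/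
def IsProcDist (μ : FinDist Tm) : Prop := ∀ P, μ.toFun P ≠ 0 → P.IsProc

/-- All channels occurring in (the support of) `μ` lie in `L`. -/
def chansIn (μ : FinDist Tm) (L : Finset Chan) : Prop :=
  ∀ P, μ.toFun P ≠ 0 → P.chans ⊆ L

/-- The channel `a` occurs in (the support of) `μ`, i.e. `a ∈ N(μ)`. -/
def hasChan (μ : FinDist Tm) (a : Chan) : Prop := ∃ P, μ.toFun P ≠ 0 ∧ a ∈ P.chans

end FinDist

/-! ## Part I: the probabilistic labelled transition system on processes -/

/-- Part I of the pLTS for RCCS (and RCCS^ω): `P →α ρ`. -/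
inductive Step : Tm → Act → FinDist Tm → Prop where
  | choice {k : ℕ} (acts : Fin (k+1) → Act) (conts : Fin (k+1) → Tm) (i : Fin (k+1)) :
      Step (.sum k acts conts) (acts i) (FinDist.dirac (conts i))
  | oplus {k : ℕ} (w : Fin (k+1) → ℝ) (conts : Fin (k+1) → Tm) (ρ : FinDist Tm) :
      (∀ i, 0 < w i ∧ w i < 1) →
      (∀ Q, ρ.toFun Q = ∑ i, if conts i = Q then w i else 0) →
      Step (.oplus k w conts) .tau ρ
  | parL {S : Tm} {α : Act} {ρ : FinDist Tm} (T : Tm) :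
      Step S α ρ → Step (.par S T) α (ρ.parD (FinDist.dirac T))
  | parR {T : Tm} {α : Act} {ρ : FinDist Tm} (S : Tm) :
      Step T α ρ → Step (.par S T) α ((FinDist.dirac S).parD ρ)
  | comm {S T : Tm} {ℓ1 ℓ2 : Act} {ρ1 ρ2 : FinDist Tm} :
      Act.Comp ℓ1 ℓ2 → Step S ℓ1 ρ1 → Step T ℓ2 ρ2 →
      Step (.par S T) .tau (ρ1.parD ρ2)
  | loc {T : Tm} {β : Act} {ρ : FinDist Tm} (L : Finset Chan) :
      Step T β ρ → Act.Allowed L β → Step (.loc L T) β (FinDist.locD L ρ)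
  | fixp {T : Tm} {β : Act} {ρ : FinDist Tm} :
      Step (Tm.subst (.fix T) 0 T) β ρ → Step (.fix T) β ρ

/-! ## Part II: probabilistic transitions on distributions -/

/-- Part II of the pLTS: `μ →(α,p) ν` iff `0 < p ≤ 1` and there are `P ∈ supp μ`
and `ρ` with `P →α ρ` and `ν = μ + μ(P)·p·(ρ − δ_P)`. -/
def PStep (μ : FinDist Tm) (α : Act) (p : ℝ) (ν : FinDist Tm) : Prop :=
  0 < p ∧ p ≤ 1 ∧
    ∃ P ρ, 0 < μ.toFun P ∧ Step P α ρ ∧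
      ∀ Q, ν.toFun Q = μ.toFun Q + μ.toFun P * p * (ρ.toFun Q - (if Q = P then 1 else 0))

/-- Probabilistic transition sequence `μ →π ν` along a word `π`. -/
def PSeq : FinDist Tm → List (Act × ℝ) → FinDist Tm → Prop
  | μ, [], ν => ν = μ
  | μ, s :: π, ν => ∃ μ', PStep μ s.1 s.2 μ' ∧ PSeq μ' π ν

/-- Internal transition sequence `μ ⇝ ν`. -/
def Internal (μ ν : FinDist Tm) : Prop :=
  ∃ π : List (Act × ℝ), (∀ s ∈ π, s.1 = Act.tau) ∧ PSeq μ π ν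

/-! ## Observability predicates and testing characteristics -/

/-- `ψ_𝓛`: processes that can immediately perform an external action. -/
def psiL : Set Tm := {P | ∃ α ρ, Act.IsLabel α ∧ Step P α ρ}

/-- `ψ_ω`: processes that can immediately perform the success action `ω`. -/
def psiOmega : Set Tm := {P | ∃ ρ, Step P Act.omega ρ}

/-- The may characteristic `χmay_𝓛(μ) = sup { ν(ψ_𝓛) : μ ⇝ ν }`. -/
noncomputable def chiMayL (μ : FinDist Tm) : ℝ :=
  sSup {x | ∃ ν, Internal μ ν ∧ x = ν.mass psiL}

/-- The fair characteristic `χfair_𝓛(μ) = inf { χmay_𝓛(ν) : μ ⇝ ν }`. -/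
noncomputable def chiFairL (μ : FinDist Tm) : ℝ :=
  sInf {x | ∃ ν, Internal μ ν ∧ x = chiMayL ν}

/-- `χmay_ω(μ) = sup { ν(ψ_ω) : μ ⇝ ν }`. -/
noncomputable def chiMayOmega (μ : FinDist Tm) : ℝ :=
  sSup {x | ∃ ν, Internal μ ν ∧ x = ν.mass psiOmega}

/-- `χfair_ω(μ) = inf { χmay_ω(ν) : μ ⇝ ν }`. -/
noncomputable def chiFairOmega (μ : FinDist Tm) : ℝ :=
  sInf {x | ∃ ν, Internal μ ν ∧ x = chiMayOmega ν}

/-! ## Testing contexts, equipollence, extensionality, diamond/box equivalences -/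

/-- `Δ(P_CCS) ⊆ 𝒟 ⊆ D(P_RCCS)`, closed under parallel composition, localization
and (finite-domain) renaming. -/
structure IsTestingContext (D : Set (FinDist Tm)) : Prop where
  dirac_ccs : ∀ P : Tm, P.IsCCS → FinDist.dirac P ∈ D
  proc_dist : ∀ μ ∈ D, μ.IsProcDist
  closed_par : ∀ μ ∈ D, ∀ ν ∈ D, μ.parD ν ∈ D
  closed_loc : ∀ μ ∈ D, ∀ L : Finset Chan, FinDist.locD L μ ∈ D
  closed_rename : ∀ μ ∈ D, ∀ f : Chan → Chan, {a | f a ≠ a}.Finite →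
      FinDist.renameD f μ ∈ D

/-- `R` is probabilistically equipollent. -/
def Equipollent (R : FinDist Tm → FinDist Tm → Prop) : Prop :=
  ∀ μ1 μ2, R μ1 μ2 → chiMayL μ1 = chiMayL μ2

/-- `R` is probabilistically strongly equipollent. -/
def StronglyEquipollent (R : FinDist Tm → FinDist Tm → Prop) : Prop :=
  ∀ μ1 μ2, R μ1 μ2 → chiFairL μ1 = chiFairL μ2

/-- `R` is `𝒟`-extensional. -/
def DExtensional (D : Set (FinDist Tm)) (R : FinDist Tm → FinDist Tm → Prop) : Prop :=
  ∀ μ1 μ2, R μ1 μ2 →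
    (∀ ν ∈ D, R (μ1.parD ν) (μ2.parD ν)) ∧
    (∀ L : Finset Chan, R (FinDist.locD L μ1) (FinDist.locD L μ2))

/-- The `𝒟`-diamond equivalence `=◇^𝒟`, the largest probabilistically equipollent
`𝒟`-extensional relation. -/
def DiamondEq (D : Set (FinDist Tm)) (μ1 μ2 : FinDist Tm) : Prop :=
  ∃ R, Equipollent R ∧ DExtensional D R ∧ R μ1 μ2

/-- The `𝒟`-box equivalence `=□^𝒟`, the largest probabilistically strongly
equipollent `𝒟`-extensional relation. -/
def BoxEq (D : Set (FinDist Tm)) (μ1 μ2 : FinDist Tm) : Prop :=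
  ∃ R, StronglyEquipollent R ∧ DExtensional D R ∧ R μ1 μ2

/-! ## Probabilistic strong bisimulation and lifting -/

/-- Lifting of a relation on processes to distributions, matching the decomposition
`ρ1 = Σ_i p_i δ_{A_i}`, `ρ2 = Σ_i p_i δ_{B_i}` with `A_i R B_i`. -/
def RelLift (R : Tm → Tm → Prop) (ρ1 ρ2 : FinDist Tm) : Prop :=
  ∃ (k : ℕ) (p : Fin (k+1) → ℝ) (A B : Fin (k+1) → Tm),
    (∀ i, 0 ≤ p i) ∧
    (∀ Q, ρ1.toFun Q = ∑ i, if A i = Q then p i else 0) ∧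
    (∀ Q, ρ2.toFun Q = ∑ i, if B i = Q then p i else 0) ∧
    (∀ i, R (A i) (B i))

/-- `R` is a probabilistic strong bisimulation. -/
def IsStrongBisim (R : Tm → Tm → Prop) : Prop :=
  ∀ P Q, R P Q →
    (∀ α ρ, Step P α ρ → ∃ ρ', Step Q α ρ' ∧ RelLift R ρ ρ') ∧
    (∀ α ρ, Step Q α ρ → ∃ ρ', Step P α ρ' ∧ RelLift R ρ ρ')

/-- `∼p`, the largest probabilistic strong bisimulation. -/
def StrongBisim (P Q : Tm) : Prop := ∃ R, IsStrongBisim R ∧ R P Q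

/-- Lifting `E†` of an equivalence on processes to distributions: agreement on the
mass of every equivalence class. -/
def EqLift (E : Tm → Tm → Prop) (μ1 μ2 : FinDist Tm) : Prop :=
  ∀ P, μ1.mass {Q | E P Q} = μ2.mass {Q | E P Q}

/-! ## Probabilistic weak bisimilarity via schedulers and weak combined transitions -/

/-- Countably supported probability distributions on `α`. -/
structure CDist (α : Type) where
  toFun : α → ℝ
  nonneg : ∀ a, 0 ≤ toFun a
  countable_support : (Function.support toFun).Countable
  hasSum_one : HasSum toFun 1

/-- The set of transitions `Tr` of the Part I pLTS. -/
def PTrans : Type := {t : Tm × Act × FinDist Tm // Step t.1 t.2.1 t.2.2}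

/-- A finite execution fragment `A0 α0 A1 α1 ⋯ αn An`, given by its head state
and its (chronological) list of steps. -/
structure Frag where
  head : Tm
  steps : List (Act × Tm)

/-- The last state of a fragment. -/
def Frag.last (ω : Frag) : Tm := (ω.steps.getLast?).elim ω.head Prod.snd

/-- The trace of a fragment: its subsequence of external actions. -/
noncomputable def Frag.trace (ω : Frag) : List Act :=
  (ω.steps.map Prod.fst).filter (fun α => decide (α ≠ Act.tau))

/-- A scheduler: to each finite fragment it assigns a finitely supported
distribution over the available transitions together with the halting symbol `⊥`
(represented by `none`). -/
def Sched : Type := Frag → FinDist (Option PTrans)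

/-- A scheduler is valid for resolving nondeterminism if it only picks transitions
whose source is the last state of the fragment. -/
def Sched.Valid (σ : Sched) : Prop :=
  ∀ (ω : Frag) (tr : PTrans), (σ ω).toFun (some tr) ≠ 0 → tr.val.1 = ω.last

/-- The probability that, at fragment `ω`, the scheduler performs an `α`-transition
to the state `B`. -/
noncomputable def transProb (σ : Sched) (ω : Frag) (α : Act) (B : Tm) : ℝ :=
  ∑ᶠ tr : PTrans,
    if tr.val.2.1 = α then (σ ω).toFun (some tr) * (tr.val.2.2).toFun B else 0

/-- Cone probability, by recursion on the (reversed) step list. -/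
noncomputable def coneProbAux (A : Tm) (σ : Sched) (head : Tm) :
    List (Act × Tm) → ℝ
  | [] => if head = A then 1 else 0
  | s :: rest =>
      coneProbAux A σ head rest * transProb σ ⟨head, rest.reverse⟩ s.1 s.2

/-- The probability `ρ_{σ,A}(C_ω)` of the cone of the fragment `ω`. -/
noncomputable def coneProb (A : Tm) (σ : Sched) (ω : Frag) : ℝ :=
  coneProbAux A σ ω.head ω.steps.reverse

/-- The probability `ρ_{σ,A}(ω)` of stopping exactly at the fragment `ω`. -/
noncomputable def fragProb (A : Tm) (σ : Sched) (ω : Frag) : ℝ :=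
  coneProb A σ ω * (σ ω).toFun none

/-- `α̂`: the trace of a single action. -/
noncomputable def extTrace (α : Act) : List Act := if α = Act.tau then [] else [α]

/-- Weak combined transition `A ⇒α_c ρ`. -/
def WeakCombined (A : Tm) (α : Act) (ρ : CDist Tm) : Prop :=
  ∃ σ : Sched, σ.Valid ∧
    HasSum (fun ω : Frag => fragProb A σ ω) 1 ∧
    (∀ ω : Frag, fragProb A σ ω ≠ 0 → ω.trace = extTrace α) ∧
    (∀ B : Tm,
      HasSum (fun ω : Frag => if ω.last = B then fragProb A σ ω else 0) (ρ.toFun B))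

/-- Mass of a (countably supported) subprobability on a set. -/
noncomputable def cmass (f : Tm → ℝ) (s : Set Tm) : ℝ := ∑' Q : s, f Q

/-- Lifting of an equivalence to (countably supported) distributions: agreement on
the mass of every equivalence class. -/
def EqLiftC (E : Tm → Tm → Prop) (f g : Tm → ℝ) : Prop :=
  ∀ P, cmass f {Q | E P Q} = cmass g {Q | E P Q}

/-- `E` is a probabilistic weak bisimulation. -/
def IsWeakBisim (E : Tm → Tm → Prop) : Prop :=
  Equivalence E ∧
    ∀ P Q, E P Q → ∀ (α : Act) (ρP : FinDist Tm), Step P α ρP →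
      ∃ ρQ : CDist Tm, WeakCombined Q α ρQ ∧ EqLiftC E ρP.toFun ρQ.toFun

/-- `≈p`, the largest probabilistic weak bisimulation. -/
def WeakBisim (P Q : Tm) : Prop := ∃ E, IsWeakBisim E ∧ E P Q

/-- `≈p` lifted to distributions: agreement on the mass of every `≈p`-class. -/
def WeakBisimD (μ1 μ2 : FinDist Tm) : Prop := EqLift WeakBisim μ1 μ2

/-- The probabilistic testing context `𝒟 = D(P_RCCS)` of all distributions over
processes. -/
def fullCtx : Set (FinDist Tm) := {μ | μ.IsProcDist}


/-! ## Expectations -/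

section Expect

variable {α β : Type} {V W : Type} [AddCommGroup V] [Module ℝ V] [AddCommGroup W] [Module ℝ W]

/-- Expectation of a vector valued function under a finitely supported distribution. -/
noncomputable def ex (μ : FinDist α) (f : α → V) : V :=
  ∑ a ∈ μ.finite_support.toFinset, μ.toFun a • f a

theorem ex_eq_sum (μ : FinDist α) (f : α → V) (s : Finset α)
    (h : ∀ a, μ.toFun a ≠ 0 → a ∈ s) : ex μ f = ∑ a ∈ s, μ.toFun a • f a := by
  unfold ex
  apply Finset.sum_subset
  · intro a ha
    apply h
    simpa using ha
  · intro a _ ha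
    have : μ.toFun a = 0 := by simpa using ha
    simp [this]

theorem sum_toFun (μ : FinDist α) (s : Finset α)
    (h : ∀ a, μ.toFun a ≠ 0 → a ∈ s) : ∑ a ∈ s, μ.toFun a = 1 := by
  rw [← μ.sum_one]
  symm
  apply finsum_eq_sum_of_support_subset
  intro a ha
  exact h a ha

theorem ex_congr {μ : FinDist α} {f g : α → V} (h : ∀ a, μ.toFun a ≠ 0 → f a = g a) :
    ex μ f = ex μ g := by
  unfold ex
  apply Finset.sum_congr rfl
  intro a ha
  rw [h a (by simpa using ha)]

theorem ex_const (μ : FinDist α) (c : V) : ex μ (fun _ => c) = c := by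
  unfold ex
  rw [← Finset.sum_smul, sum_toFun μ _ (fun a ha => by simpa using ha), one_smul]

theorem ex_add (μ : FinDist α) (f g : α → V) :
    ex μ (fun a => f a + g a) = ex μ f + ex μ g := by
  simp [ex, Finset.sum_add_distrib]

theorem ex_sub (μ : FinDist α) (f g : α → V) :
    ex μ (fun a => f a - g a) = ex μ f - ex μ g := by
  simp [ex, smul_sub, Finset.sum_sub_distrib]

theorem ex_smul (μ : FinDist α) (c : ℝ) (f : α → V) :
    ex μ (fun a => c • f a) = c • ex μ f := by
  simp only [ex, Finset.smul_sum]
  apply Finset.sum_congr rfl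
  intro a _
  rw [smul_comm]

theorem ex_one_sub (μ : FinDist α) (f : α → ℝ) :
    ex μ (fun a => 1 - f a) = 1 - ex μ f := by
  rw [ex_sub, ex_const]

theorem ex_linear (L : V →ₗ[ℝ] W) (μ : FinDist α) (f : α → V) :
    L (ex μ f) = ex μ (fun a => L (f a)) := by
  simp [ex, map_sum]

theorem ex_mk (μ : FinDist α) (f : α → V) (g : α → W) :
    ex μ (fun a => (f a, g a)) = (ex μ f, ex μ g) := by
  simp [ex, Prod.ext_iff, Prod.fst_sum, Prod.snd_sum]

theorem ex_fst (μ : FinDist α) (f : α → V × W) : (ex μ f).1 = ex μ (fun a => (f a).1) := by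
  simp [ex, Prod.fst_sum]

theorem ex_snd (μ : FinDist α) (f : α → V × W) : (ex μ f).2 = ex μ (fun a => (f a).2) := by
  simp [ex, Prod.snd_sum]

theorem ex_mono {μ : FinDist α} {f g : α → ℝ} (h : ∀ a, μ.toFun a ≠ 0 → f a ≤ g a) :
    ex μ f ≤ ex μ g := by
  unfold ex
  apply Finset.sum_le_sum
  intro a ha
  exact mul_le_mul_of_nonneg_left (h a (by simpa using ha)) (μ.nonneg a)

theorem ex_nonneg {μ : FinDist α} {f : α → ℝ} (h : ∀ a, μ.toFun a ≠ 0 → 0 ≤ f a) :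
    0 ≤ ex μ f := by
  have := ex_mono (μ := μ) (f := fun _ => 0) (g := f) h
  rwa [ex_const] at this

theorem ex_le_one {μ : FinDist α} {f : α → ℝ} (h : ∀ a, μ.toFun a ≠ 0 → f a ≤ 1) :
    ex μ f ≤ 1 := by
  have := ex_mono (μ := μ) (f := f) (g := fun _ => 1) h
  rwa [ex_const] at this

theorem toFun_le_one (μ : FinDist α) (a : α) : μ.toFun a ≤ 1 := by
  have h := sum_toFun μ (insert a μ.finite_support.toFinset)
    (fun b hb => Finset.mem_insert_of_mem (by simpa using hb))
  rw [← h]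
  exact Finset.single_le_sum (f := μ.toFun) (fun b _ => μ.nonneg b) (Finset.mem_insert_self _ _)

theorem toFun_pos {μ : FinDist α} {a : α} (h : μ.toFun a ≠ 0) : 0 < μ.toFun a :=
  lt_of_le_of_ne (μ.nonneg a) (Ne.symm h)

theorem ex_dirac (P : α) (f : α → V) : ex (FinDist.dirac P) f = f P := by
  rw [ex_eq_sum _ _ {P}]
  · simp [FinDist.dirac]
  · intro a ha
    by_contra h
    simp only [Finset.mem_singleton] at h
    simp [FinDist.dirac, h] at ha

theorem FinDist.ext' {μ ν : FinDist α} (h : ∀ a, μ.toFun a = ν.toFun a) : μ = ν := by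
  cases μ; cases ν
  congr
  exact funext h

theorem toFun_eq_ex (μ : FinDist α) (a : α) :
    μ.toFun a = ex μ (fun b => if b = a then (1 : ℝ) else 0) := by
  rw [ex_eq_sum _ _ (insert a μ.finite_support.toFinset)]
  · simp
  · intro b hb
    exact Finset.mem_insert_of_mem (by simpa using hb)

theorem ext_ex {μ ν : FinDist α} (h : ∀ f : α → ℝ, ex μ f = ex ν f) : μ = ν := by
  apply FinDist.ext'
  intro a
  rw [toFun_eq_ex, toFun_eq_ex, h]

theorem map_toFun (g : α → β) (μ : FinDist α) (b : β) :
    (μ.map g).toFun b = ∑ a ∈ μ.finite_support.toFinset, if g a = b then μ.toFun a else 0 := by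
  show (∑ᶠ a ∈ {a | g a = b}, μ.toFun a) = _
  rw [← Finset.sum_filter]
  apply finsum_mem_eq_sum_of_inter_support_eq
  ext a
  simp
  tauto

theorem ex_map (g : α → β) (μ : FinDist α) (f : β → V) :
    ex (μ.map g) f = ex μ (fun a => f (g a)) := by
  rw [ex_eq_sum _ _ (μ.finite_support.toFinset.image g)]
  · simp only [map_toFun, Finset.sum_smul]
    rw [Finset.sum_comm]
    unfold ex
    apply Finset.sum_congr rfl
    intro a ha
    rw [Finset.sum_eq_single (g a)]
    · simp
    · intro b _ hb
      simp [Ne.symm hb]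
    · intro h
      exact absurd (Finset.mem_image_of_mem g ha) h
  · intro b hb
    rw [map_toFun] at hb
    obtain ⟨a, ha, hne⟩ := Finset.exists_ne_zero_of_sum_ne_zero hb
    have : g a = b := by
      by_contra h
      simp [h] at hne
    rw [← this]
    exact Finset.mem_image_of_mem g ha

theorem map_toFun_ne {g : α → β} {μ : FinDist α} {b : β} (h : (μ.map g).toFun b ≠ 0) :
    ∃ a, μ.toFun a ≠ 0 ∧ g a = b := by
  rw [map_toFun] at h
  obtain ⟨a, ha, hne⟩ := Finset.exists_ne_zero_of_sum_ne_zero h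
  refine ⟨a, by simpa using ha, ?_⟩
  by_contra h
  simp [h] at hne

theorem ex_prod (μ : FinDist α) (ν : FinDist β) (f : α × β → V) :
    ex (μ.prod ν) f = ex μ (fun a => ex ν (fun b => f (a, b))) := by
  rw [ex_eq_sum _ _ (μ.finite_support.toFinset ×ˢ ν.finite_support.toFinset)]
  · rw [Finset.sum_product]
    unfold ex
    apply Finset.sum_congr rfl
    intro a _
    rw [Finset.smul_sum]
    apply Finset.sum_congr rfl
    intro b _
    rw [smul_smul]
    rfl
  · intro x hx
    have h : μ.toFun x.1 * ν.toFun x.2 ≠ 0 := hx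
    have := mul_ne_zero_iff.mp h
    simpa using this

theorem ex_comm (μ : FinDist α) (ν : FinDist β) (f : α → β → V) :
    ex μ (fun a => ex ν (fun b => f a b)) = ex ν (fun b => ex μ (fun a => f a b)) := by
  unfold ex
  simp only [Finset.smul_sum]
  rw [Finset.sum_comm]
  refine Finset.sum_congr rfl fun b _ => Finset.sum_congr rfl fun a _ => ?_
  rw [smul_comm]

theorem ex_parD (μ ν : FinDist Tm) (f : Tm → V) :
    ex (μ.parD ν) f = ex μ (fun P => ex ν (fun Q => f (Tm.par P Q))) := by
  unfold FinDist.parD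
  rw [ex_map, ex_prod]

theorem ex_locD (L : Finset Chan) (μ : FinDist Tm) (f : Tm → V) :
    ex (FinDist.locD L μ) f = ex μ (fun P => f (Tm.loc L P)) := by
  unfold FinDist.locD
  rw [ex_map]

theorem dirac_parD (P Q : Tm) :
    (FinDist.dirac P).parD (FinDist.dirac Q) = FinDist.dirac (Tm.par P Q) := by
  apply ext_ex
  intro f
  simp [ex_parD, ex_dirac]

theorem dirac_locD (L : Finset Chan) (P : Tm) :
    FinDist.locD L (FinDist.dirac P) = FinDist.dirac (Tm.loc L P) := by
  apply ext_ex
  intro f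
  simp [ex_locD, ex_dirac]

theorem mass_eq_ex (μ : FinDist α) (s : Set α) :
    μ.mass s = ex μ (fun a => if a ∈ s then (1 : ℝ) else 0) := by
  unfold FinDist.mass ex
  simp only [smul_eq_mul, mul_ite, mul_one, mul_zero]
  rw [← Finset.sum_filter]
  apply finsum_mem_eq_sum_of_inter_support_eq
  ext a
  simp
  tauto

/-- Binding. -/
noncomputable def bindD (μ : FinDist α) (k : α → FinDist β) : FinDist β where
  toFun := fun b => ex μ (fun a => (k a).toFun b)
  nonneg := fun b => ex_nonneg fun a _ => (k a).nonneg b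
  finite_support := by
    apply Set.Finite.subset (μ.finite_support.biUnion (fun a _ => (k a).finite_support))
    intro b hb
    obtain ⟨a, ha, hne⟩ := Finset.exists_ne_zero_of_sum_ne_zero hb
    simp only [Set.mem_iUnion]
    exact ⟨a, by simpa using ha, by
      intro h
      apply hne
      simp [h]⟩
  sum_one := by
    have hsub : Function.support (fun b => ex μ (fun a => (k a).toFun b)) ⊆
        ↑(μ.finite_support.toFinset.biUnion (fun a => (k a).finite_support.toFinset)) := by
      intro b hb
      obtain ⟨a, ha, hne⟩ := Finset.exists_ne_zero_of_sum_ne_zero hb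
      simp only [Finset.coe_biUnion, Set.mem_iUnion]
      refine ⟨a, by simpa using ha, ?_⟩
      simp only [Set.Finite.coe_toFinset, Function.mem_support]
      intro h
      apply hne
      simp [h]
    rw [finsum_eq_sum_of_support_subset _ hsub]
    unfold ex
    rw [Finset.sum_comm]
    have : ∀ a ∈ μ.finite_support.toFinset,
        (∑ b ∈ μ.finite_support.toFinset.biUnion (fun a => (k a).finite_support.toFinset),
          μ.toFun a • (k a).toFun b) = μ.toFun a := by
      intro a ha
      rw [← Finset.smul_sum, sum_toFun, smul_eq_mul, mul_one]
      intro b hb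
      rw [Finset.mem_biUnion]
      exact ⟨a, ha, by simpa using hb⟩
    rw [Finset.sum_congr rfl this]
    exact sum_toFun μ _ (fun a ha => by simpa using ha)

theorem bindD_toFun (μ : FinDist α) (k : α → FinDist β) (b : β) :
    (bindD μ k).toFun b = ex μ (fun a => (k a).toFun b) := rfl

theorem ex_bindD (μ : FinDist α) (k : α → FinDist β) (f : β → V) :
    ex (bindD μ k) f = ex μ (fun a => ex (k a) f) := by
  set T := μ.finite_support.toFinset.biUnion (fun a => (k a).finite_support.toFinset) with hT
  rw [ex_eq_sum _ _ T]
  · simp only [bindD_toFun]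
    unfold ex
    simp only [Finset.sum_smul]
    rw [Finset.sum_comm]
    apply Finset.sum_congr rfl
    intro a ha
    have := ex_eq_sum (k a) f T (fun b hb => by
      rw [hT, Finset.mem_biUnion]
      exact ⟨a, ha, by simpa using hb⟩)
    unfold ex at this
    rw [this, Finset.smul_sum]
    apply Finset.sum_congr rfl
    intro b _
    simp [smul_smul]
  · intro b hb
    obtain ⟨a, ha, hne⟩ := Finset.exists_ne_zero_of_sum_ne_zero hb
    rw [hT, Finset.mem_biUnion]
    refine ⟨a, ha, ?_⟩
    simp only [Set.Finite.mem_toFinset, Function.mem_support]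
    intro h
    apply hne
    simp [h]

end Expect

theorem norm_ex_le {α : Type} {V : Type} [NormedAddCommGroup V] [NormedSpace ℝ V]
    (μ : FinDist α) (f : α → V) : ‖ex μ f‖ ≤ ex μ (fun a => ‖f a‖) := by
  unfold ex
  refine (norm_sum_le _ _).trans (Finset.sum_le_sum fun a _ => ?_)
  rw [norm_smul, Real.norm_of_nonneg (μ.nonneg a)]
  rfl

theorem tendsto_ex {α : Type} {V : Type} [NormedAddCommGroup V] [NormedSpace ℝ V]
    (μ : FinDist α) (f : ℕ → α → V) (g : α → V)
    (h : ∀ a, μ.toFun a ≠ 0 → Filter.Tendsto (fun n => f n a) Filter.atTop (nhds (g a))) :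
    Filter.Tendsto (fun n => ex μ (f n)) Filter.atTop (nhds (ex μ g)) := by
  unfold ex
  apply tendsto_finsetSum
  intro a ha
  exact (h a (by simpa using ha)).const_smul _

/-! ## Value functions -/

/-- One internal step on distributions. -/
def IStep (μ ν : FinDist Tm) : Prop := ∃ p, PStep μ Act.tau p ν

theorem internal_iff (μ ν : FinDist Tm) :
    Internal μ ν ↔ Relation.ReflTransGen IStep μ ν := by
  constructor
  · rintro ⟨π, hπ, h⟩
    induction π generalizing μ with
    | nil => rw [show ν = μ from h]
    | cons s π ih =>
      obtain ⟨μ', h1, h2⟩ := h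
      refine Relation.ReflTransGen.head ⟨s.2, ?_⟩ (ih μ' (fun t ht => hπ t (by simp [ht])) h2)
      rw [← hπ s (by simp)]
      exact h1
  · intro h
    induction h using Relation.ReflTransGen.head_induction_on with
    | refl => exact ⟨[], by simp, rfl⟩
    | head h1 _ ih =>
      obtain ⟨p, hp⟩ := h1
      obtain ⟨π, hπ, h⟩ := ih
      exact ⟨(Act.tau, p) :: π, by simpa using hπ, _, hp, h⟩

theorem ex_point {α : Type} (μ : FinDist α) (P : α) (c : ℝ) :
    ex μ (fun a => if a = P then c else 0) = μ.toFun P * c := by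
  rw [toFun_eq_ex μ P, mul_comm, ← smul_eq_mul, ← ex_smul]
  apply ex_congr
  intro a _
  split_ifs <;> simp

theorem pstep_ex_aux {μ ν ρ : FinDist Tm} {P : Tm} {c : ℝ}
    (h : ∀ Q, ν.toFun Q = μ.toFun Q + c * (ρ.toFun Q - (if Q = P then 1 else 0)))
    (f : Tm → ℝ) : ex ν f = ex μ f + c * (ex ρ f - f P) := by
  set s := ν.finite_support.toFinset ∪ μ.finite_support.toFinset ∪ ρ.finite_support.toFinset
    ∪ {P} with hs
  rw [ex_eq_sum ν f s (by intro a ha; simp [hs, ha]),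
    ex_eq_sum μ f s (by intro a ha; simp [hs, ha]),
    ex_eq_sum ρ f s (by intro a ha; simp [hs, ha])]
  have h3 : f P = ∑ a ∈ s, (if a = P then (1:ℝ) else 0) * f a := by
    simp [hs]
  conv_rhs => rw [h3]
  rw [← Finset.sum_sub_distrib, Finset.mul_sum, ← Finset.sum_add_distrib]
  apply Finset.sum_congr rfl
  intro a _
  rw [h a]
  simp only [smul_eq_mul]
  ring

/-- Mixture of two distributions. -/
noncomputable def mixD {α : Type} (p : ℝ) (h0 : 0 ≤ p) (h1 : p ≤ 1) (μ ν : FinDist α) :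
    FinDist α where
  toFun := fun a => p * μ.toFun a + (1 - p) * ν.toFun a
  nonneg := fun a => add_nonneg (mul_nonneg h0 (μ.nonneg a))
    (mul_nonneg (by linarith) (ν.nonneg a))
  finite_support := by
    apply Set.Finite.subset (μ.finite_support.union ν.finite_support)
    intro a ha
    by_contra hc
    simp only [Set.mem_union, Function.mem_support, not_or, not_not] at hc
    simp [hc.1, hc.2] at ha
  sum_one := by
    rw [finsum_add_distrib, ← mul_finsum, ← mul_finsum, μ.sum_one, ν.sum_one]
    · ring
    · exact μ.finite_support.subset (by intro a ha h; simp [h] at ha)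
    · exact ν.finite_support.subset (by intro a ha h; simp [h] at ha)

theorem ex_mixD {α V : Type} [AddCommGroup V] [Module ℝ V] (p : ℝ) (h0 : 0 ≤ p) (h1 : p ≤ 1)
    (μ ν : FinDist α) (f : α → V) :
    ex (mixD p h0 h1 μ ν) f = p • ex μ f + (1 - p) • ex ν f := by
  set s := (mixD p h0 h1 μ ν).finite_support.toFinset ∪ μ.finite_support.toFinset
    ∪ ν.finite_support.toFinset with hs
  rw [ex_eq_sum _ f s (by intro a ha; simp [hs, ha]),
    ex_eq_sum μ f s (by intro a ha; simp [hs, ha]),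
    ex_eq_sum ν f s (by intro a ha; simp [hs, ha]), Finset.smul_sum, Finset.smul_sum,
    ← Finset.sum_add_distrib]
  apply Finset.sum_congr rfl
  intro a _
  simp only [mixD, add_smul, smul_smul]

/-- The result of a probabilistic step. -/
noncomputable def stepD (μ : FinDist Tm) (P : Tm) (ρ : FinDist Tm) (p : ℝ) (h0 : 0 ≤ p)
    (h1 : p ≤ 1) : FinDist Tm :=
  bindD μ (fun Q => if Q = P then mixD p h0 h1 ρ (FinDist.dirac P) else FinDist.dirac Q)

theorem bind_dirac {α : Type} (μ : FinDist α) : bindD μ FinDist.dirac = μ := by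
  apply ext_ex
  intro f
  rw [ex_bindD]
  simp [ex_dirac]

theorem stepD_toFun (μ : FinDist Tm) (P : Tm) (ρ : FinDist Tm) (p : ℝ) (h0 : 0 ≤ p)
    (h1 : p ≤ 1) (Q : Tm) : (stepD μ P ρ p h0 h1).toFun Q =
      μ.toFun Q + μ.toFun P * p * (ρ.toFun Q - (if Q = P then 1 else 0)) := by
  have e : μ.toFun Q = ex μ (fun a => (FinDist.dirac a).toFun Q) := by
    rw [← bindD_toFun, bind_dirac]
  rw [stepD, bindD_toFun, ← sub_eq_iff_eq_add', e, ← ex_sub, mul_assoc, ← ex_point]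
  apply ex_congr
  intro a _
  by_cases h : a = P
  · subst h
    simp [mixD, FinDist.dirac]
    split_ifs <;> ring
  · simp [h]

theorem stepD_pstep {μ : FinDist Tm} {P : Tm} {ρ : FinDist Tm} {p : ℝ} (h0 : 0 < p)
    (h1 : p ≤ 1) {α : Act} (hP : 0 < μ.toFun P) (hs : Step P α ρ) :
    PStep μ α p (stepD μ P ρ p h0.le h1) :=
  ⟨h0, h1, P, ρ, hP, hs, stepD_toFun _ _ _ _ _ _⟩

/-- Bounded by `0` and `1`. -/
def B01 (f : Tm → ℝ) : Prop := ∀ P, 0 ≤ f P ∧ f P ≤ 1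

/-- Excessive functions. -/
def Exc (g : Tm → ℝ) : Prop := ∀ X ρ, Step X Act.tau ρ → ex ρ g ≤ g X

theorem exc_internal {g : Tm → ℝ} (hg : Exc g) {μ ν : FinDist Tm} (h : Internal μ ν) :
    ex ν g ≤ ex μ g := by
  rw [internal_iff] at h
  induction h with
  | refl => exact le_rfl
  | tail _ h2 ih =>
    obtain ⟨p, h0, h1, P, ρ, hP, hs, he⟩ := h2
    rw [pstep_ex_aux he g]
    have := hg P ρ hs
    nlinarith [mul_pos hP h0]

theorem internal_refl (μ : FinDist Tm) : Internal μ μ := by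
  rw [internal_iff]

theorem internal_trans {μ ν ξ : FinDist Tm} (h : Internal μ ν) (h' : Internal ν ξ) :
    Internal μ ξ := by
  rw [internal_iff] at *
  exact h.trans h'

theorem internal_step {P : Tm} {ρ : FinDist Tm} (h : Step P Act.tau ρ) :
    Internal (FinDist.dirac P) ρ := by
  rw [internal_iff]
  apply Relation.ReflTransGen.single
  refine ⟨1, one_pos, le_rfl, P, ρ, by simp [FinDist.dirac], h, ?_⟩
  intro Q
  simp [FinDist.dirac]

theorem internal_conv {ν ν' : FinDist Tm} (h : Internal ν ν') (c : ℝ) (hc : 0 < c)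
    (ξ : Tm → ℝ) (hξ : ∀ Q, 0 ≤ ξ Q) (ω ω' : FinDist Tm)
    (h1 : ∀ Q, ω.toFun Q = ξ Q + c * ν.toFun Q)
    (h2 : ∀ Q, ω'.toFun Q = ξ Q + c * ν'.toFun Q) : Internal ω ω' := by
  rw [internal_iff] at *
  induction h using Relation.ReflTransGen.head_induction_on generalizing ω with
  | refl =>
    have : ω = ω' := FinDist.ext' fun a => by rw [h1, h2]
    rw [this]
  | @head ν ν1 hs _ ih =>
    obtain ⟨p, h0, hp1, P, ρ, hP, hst, he⟩ := hs
    have hωP : 0 < ω.toFun P := by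
      rw [h1]
      have := mul_pos hc hP
      linarith [hξ P]
    have hp'0 : 0 < c * ν.toFun P * p / ω.toFun P := by positivity
    have hp'1 : c * ν.toFun P * p / ω.toFun P ≤ 1 := by
      rw [div_le_one hωP, h1]
      have := mul_pos hc hP
      nlinarith [hξ P]
    refine Relation.ReflTransGen.head ⟨_, stepD_pstep hp'0 hp'1 hωP hst⟩ (ih _ ?_)
    intro Q
    rw [stepD_toFun, h1 Q, he Q]
    field_simp
    ring

theorem internal_bind (μ : FinDist Tm) (k : Tm → FinDist Tm)
    (hk : ∀ P, Internal (FinDist.dirac P) (k P)) : Internal μ (bindD μ k) := by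
  have key : ∀ s : Finset Tm,
      Internal μ (bindD μ (fun P => if P ∈ s then k P else FinDist.dirac P)) := by
    intro s
    induction s using Finset.induction_on with
    | empty =>
      simp only [Finset.notMem_empty, if_false]
      rw [bind_dirac]
      exact internal_refl _
    | insert P s hPs ih =>
      refine internal_trans ih ?_
      have hdiff : ∀ Q, (bindD μ (fun P' => if P' ∈ insert P s then k P'
          else FinDist.dirac P')).toFun Q =
          (bindD μ (fun P => if P ∈ s then k P else FinDist.dirac P)).toFun Q +
            μ.toFun P * ((k P).toFun Q - (FinDist.dirac P).toFun Q) := by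
        intro Q
        rw [bindD_toFun, bindD_toFun, ← sub_eq_iff_eq_add', ← ex_sub, ← ex_point]
        apply ex_congr
        intro a _
        by_cases h : a = P
        · subst h
          simp [hPs]
        · simp [h]
      by_cases h0 : μ.toFun P = 0
      · have : bindD μ (fun P' => if P' ∈ insert P s then k P' else FinDist.dirac P') =
          bindD μ (fun P => if P ∈ s then k P else FinDist.dirac P) :=
          FinDist.ext' fun Q => by rw [hdiff, h0]; ring
        rw [this]
        exact internal_refl _
      · refine internal_conv (hk P) (μ.toFun P) (toFun_pos h0)
          (fun Q => (bindD μ (fun P => if P ∈ s then k P else FinDist.dirac P)).toFun Q -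
            μ.toFun P * (FinDist.dirac P).toFun Q) ?_ _ _ ?_ ?_
        · intro Q
          rw [bindD_toFun, ← ex_point, ← ex_sub]
          apply ex_nonneg
          intro a _
          by_cases h : a = P
          · subst h
            simp [hPs]
          · simp only [h, if_false, sub_zero]
            exact FinDist.nonneg _ _
        · intro Q
          ring
        · intro Q
          rw [hdiff]
          ring
  have := key μ.finite_support.toFinset
  have e : bindD μ (fun P => if P ∈ μ.finite_support.toFinset then k P else FinDist.dirac P) =
      bindD μ k := by
    apply ext_ex
    intro f
    rw [ex_bindD, ex_bindD]
    apply ex_congr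
    intro a ha
    simp [ha]
  rwa [e] at this

/-- The optimal value of the payoff `h`. -/
noncomputable def UD (h : Tm → ℝ) (μ : FinDist Tm) : ℝ :=
  sSup {x | ∃ ν, Internal μ ν ∧ x = ex ν h}

/-- The optimal value of the payoff `h` from a process. -/
noncomputable def uh (h : Tm → ℝ) (P : Tm) : ℝ := UD h (FinDist.dirac P)

theorem UD_bdd {h : Tm → ℝ} (hh : B01 h) (μ : FinDist Tm) :
    BddAbove {x | ∃ ν, Internal μ ν ∧ x = ex ν h} :=
  ⟨1, by rintro x ⟨ν, _, rfl⟩; exact ex_le_one fun a _ => (hh a).2⟩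

theorem le_UD {h : Tm → ℝ} (hh : B01 h) {μ ν : FinDist Tm} (hi : Internal μ ν) :
    ex ν h ≤ UD h μ := le_csSup (UD_bdd hh μ) ⟨ν, hi, rfl⟩

theorem UD_le {h : Tm → ℝ} {μ : FinDist Tm} {c : ℝ}
    (hc : ∀ ν, Internal μ ν → ex ν h ≤ c) : UD h μ ≤ c :=
  csSup_le ⟨_, μ, internal_refl μ, rfl⟩ (by rintro x ⟨ν, hi, rfl⟩; exact hc ν hi)

theorem le_uh {h : Tm → ℝ} (hh : B01 h) (P : Tm) : h P ≤ uh h P := by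
  have := le_UD hh (internal_refl (FinDist.dirac P))
  rwa [ex_dirac] at this

theorem uh_b01 {h : Tm → ℝ} (hh : B01 h) : B01 (uh h) := fun P =>
  ⟨(hh P).1.trans (le_uh hh P), UD_le fun _ _ => ex_le_one fun a _ => (hh a).2⟩

theorem ex_uh_le {h : Tm → ℝ} (hh : B01 h) (μ : FinDist Tm) : ex μ (uh h) ≤ UD h μ := by
  apply le_of_forall_pos_le_add
  intro ε hε
  have : ∀ P, ∃ ν, Internal (FinDist.dirac P) ν ∧ uh h P - ε ≤ ex ν h := by
    intro P
    obtain ⟨x, ⟨ν, hi, rfl⟩, hx⟩ := exists_lt_of_lt_csSup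
      (⟨_, _, internal_refl (FinDist.dirac P), rfl⟩ :
        {x | ∃ ν, Internal (FinDist.dirac P) ν ∧ x = ex ν h}.Nonempty)
      (show uh h P - ε < sSup _ from sub_lt_self _ hε)
    exact ⟨ν, hi, hx.le⟩
  choose k hk hk2 using this
  have h1 := le_UD hh (internal_bind μ k hk)
  rw [ex_bindD] at h1
  have h2 : ex μ (fun P => uh h P - ε) ≤ ex μ (fun P => ex (k P) h) :=
    ex_mono fun a _ => hk2 a
  rw [ex_sub, ex_const] at h2
  linarith

theorem uh_exc {h : Tm → ℝ} (hh : B01 h) : Exc (uh h) := by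
  intro X ρ hs
  refine (ex_uh_le hh ρ).trans (UD_le fun ν hi => ?_)
  exact le_UD hh (internal_trans (internal_step hs) hi)

theorem UD_eq {h : Tm → ℝ} (hh : B01 h) (μ : FinDist Tm) : UD h μ = ex μ (uh h) := by
  apply le_antisymm _ (ex_uh_le hh μ)
  apply UD_le
  intro ν hi
  exact (ex_mono fun a _ => le_uh hh a).trans (exc_internal (uh_exc hh) hi)

theorem uh_le {h g : Tm → ℝ} (hg : Exc g) (hle : ∀ P, h P ≤ g P) (P : Tm) : uh h P ≤ g P := by
  apply UD_le
  intro ν hi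
  have := (ex_mono fun a _ => hle a : ex ν h ≤ ex ν g).trans (exc_internal hg hi)
  rwa [ex_dirac] at this

/-- Indicator of observability. -/
noncomputable def psi1 (P : Tm) : ℝ := if P ∈ psiL then 1 else 0

theorem psi1_b01 : B01 psi1 := by
  intro P
  unfold psi1
  split_ifs <;> simp

/-- The may value. -/
noncomputable def mayV : Tm → ℝ := uh psi1

theorem mayV_b01 : B01 mayV := uh_b01 psi1_b01

theorem chiMay_eq (μ : FinDist Tm) : chiMayL μ = ex μ mayV := by
  rw [mayV, ← UD_eq psi1_b01]
  unfold chiMayL UD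
  simp only [mass_eq_ex]
  rfl

theorem omay_b01 : B01 (fun P => 1 - mayV P) := fun P =>
  ⟨by linarith [(mayV_b01 P).2], by linarith [(mayV_b01 P).1]⟩

/-- The complementary fair value. -/
noncomputable def fairG : Tm → ℝ := uh (fun P => 1 - mayV P)

theorem fairG_b01 : B01 fairG := uh_b01 omay_b01

theorem chiFair_eq (μ : FinDist Tm) : chiFairL μ = 1 - ex μ fairG := by
  rw [fairG, ← UD_eq omay_b01]
  apply le_antisymm
  · have : UD (fun P => 1 - mayV P) μ ≤ 1 - chiFairL μ := by
      apply UD_le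
      intro ν hi
      rw [ex_one_sub, ← chiMay_eq]
      have : chiFairL μ ≤ chiMayL ν := by
        refine csInf_le ?_ (by exact ⟨ν, hi, rfl⟩)
        refine ⟨0, ?_⟩
        rintro x ⟨ν, _, rfl⟩
        rw [chiMay_eq]
        exact ex_nonneg fun a _ => (mayV_b01 a).1
      linarith
    linarith
  · refine le_csInf ⟨chiMayL μ, μ, internal_refl μ, rfl⟩ ?_
    rintro x ⟨ν, hi, rfl⟩
    have := le_UD omay_b01 hi
    rw [ex_one_sub, ← chiMay_eq] at this
    linarith

/-! ## Distribution-valued simulations and their duals -/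

section Gam

/-- Compatible pairs of test functions. -/
def Compat (Γ : Tm → FinDist Tm → Prop) (f g : Tm → ℝ) : Prop :=
  ∀ Y θ, Γ Y θ → f Y ≤ ex θ g

/-- Dual formulation of a (state to distribution) weak simulation. -/
structure DG (Γ : Tm → FinDist Tm → Prop) : Prop where
  diag : ∀ Y, Γ Y (FinDist.dirac Y)
  tau : ∀ Y θ ρ f g, Γ Y θ → Step Y Act.tau ρ → B01 f → B01 g → Compat Γ f g → Exc g →
    ex ρ f ≤ ex θ g
  lab : ∀ α Y θ ρ f h g, α ≠ Act.tau → Γ Y θ → Step Y α ρ → B01 f → B01 h → B01 g →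
    Compat Γ f h → Exc h → Exc g → (∀ X ρ', Step X α ρ' → ex ρ' h ≤ g X) →
    ex ρ f ≤ ex θ g

theorem ex_b01 {f : Tm → Tm → ℝ} (h : ∀ P, B01 (f P)) (μ : FinDist Tm) :
    B01 (fun X => ex μ (fun S => f S X)) := fun X =>
  ⟨ex_nonneg fun S _ => (h S X).1, ex_le_one fun S _ => (h S X).2⟩

theorem sec_b01 {f : Tm → ℝ} (h : B01 f) (S : Tm) : B01 (fun X => f (Tm.par X S)) :=
  fun X => h _

theorem sec_exc {g : Tm → ℝ} (h : Exc g) (S : Tm) : Exc (fun X => g (Tm.par X S)) := by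
  intro X ρ hs
  have := h _ _ (Step.parL S hs)
  simpa [ex_parD, ex_dirac] using this

theorem secL_exc {g : Tm → ℝ} (h : Exc g) (L : Finset Chan) : Exc (fun X => g (Tm.loc L X)) := by
  intro X ρ hs
  have := h _ _ (Step.loc L hs trivial)
  simpa [ex_locD] using this

/-- Parallel closure. -/
def ParG (Γ : Tm → FinDist Tm → Prop) (Z : Tm) (η : FinDist Tm) : Prop :=
  (∃ Y θ S, Γ Y θ ∧ Z = Tm.par Y S ∧ η = θ.parD (FinDist.dirac S)) ∨ η = FinDist.dirac Z

/-- Localization closure. -/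
def LocG (L : Finset Chan) (Γ : Tm → FinDist Tm → Prop) (Z : Tm) (η : FinDist Tm) : Prop :=
  (∃ Y θ, Γ Y θ ∧ Z = Tm.loc L Y ∧ η = FinDist.locD L θ) ∨ η = FinDist.dirac Z

theorem compat_par {Γ : Tm → FinDist Tm → Prop} {f g : Tm → ℝ} (h : Compat (ParG Γ) f g)
    (S : Tm) : Compat Γ (fun X => f (Tm.par X S)) (fun X => g (Tm.par X S)) := by
  intro Y θ hY
  have := h _ _ (Or.inl ⟨Y, θ, S, hY, rfl, rfl⟩)
  simpa [ex_parD, ex_dirac] using this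

theorem compat_loc {Γ : Tm → FinDist Tm → Prop} {f g : Tm → ℝ} {L : Finset Chan}
    (h : Compat (LocG L Γ) f g) :
    Compat Γ (fun X => f (Tm.loc L X)) (fun X => g (Tm.loc L X)) := by
  intro Y θ hY
  have := h _ _ (Or.inl ⟨Y, θ, hY, rfl, rfl⟩)
  simpa [ex_locD] using this

theorem compat_diag {Γ : Tm → FinDist Tm → Prop} (hd : ∀ Y, Γ Y (FinDist.dirac Y))
    {f g : Tm → ℝ} (h : Compat Γ f g) (X : Tm) : f X ≤ g X := by
  have := h _ _ (hd X)
  rwa [ex_dirac] at this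

theorem DG.par {Γ : Tm → FinDist Tm → Prop} (hΓ : DG Γ) : DG (ParG Γ) where
  diag := fun Y => Or.inr rfl
  tau := by
    intro Z η ρ f g hZ hs hf hg hc he
    have hd := compat_diag (fun Y => (Or.inr rfl : ParG Γ Y (FinDist.dirac Y))) hc
    rcases hZ with ⟨Y, θ, S, hY, rfl, rfl⟩ | rfl
    · rw [ex_parD]
      simp only [ex_dirac]
      generalize hA : Act.tau = A at hs
      cases hs with
      | parL _ hs =>
        subst hA
        rw [ex_parD]
        simp only [ex_dirac]
        exact hΓ.tau Y θ _ _ _ hY hs (sec_b01 hf S) (sec_b01 hg S) (compat_par hc S) (sec_exc he S)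
      | parR _ hs =>
        subst hA
        rename_i ρS
        rw [ex_parD, ex_dirac]
        calc ex ρS (fun Q => f (Y.par Q)) ≤ ex ρS (fun Q => ex θ (fun X => g (X.par Q))) :=
              ex_mono fun Q _ => compat_par hc Q Y θ hY
          _ = ex θ (fun X => ex ρS (fun Q => g (X.par Q))) := ex_comm _ _ _
          _ ≤ _ := ex_mono fun X _ => by
              have := he _ _ (Step.parR X hs)
              simpa [ex_parD, ex_dirac] using this
      | comm hcomp h1 h2 =>
        rename_i ℓ1 ℓ2 ρ1 ρ2
        rw [ex_parD]
        refine hΓ.lab ℓ1 Y θ ρ1 (fun P => ex ρ2 fun Q => f (P.par Q))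
          (fun P => ex ρ2 fun Q => g (P.par Q)) (fun P => g (P.par S)) ?_ hY h1
          (ex_b01 (fun S => sec_b01 hf S) _) (ex_b01 (fun S => sec_b01 hg S) _) (sec_b01 hg S)
          ?_ ?_ (sec_exc he S) ?_
        · rintro rfl
          obtain ⟨a, h | h⟩ := hcomp <;> simp at h
        · intro Y' θ' hY'
          rw [← ex_comm]
          exact ex_mono fun Q _ => compat_par hc Q Y' θ' hY'
        · intro X ρ' hX
          rw [← ex_comm]
          exact ex_mono fun Q _ => sec_exc he Q X ρ' hX
        · intro X ρ' hX
          have := he _ _ (Step.comm hcomp hX h2)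
          rwa [ex_parD] at this
    · rw [ex_dirac]
      exact (ex_mono fun X _ => hd X).trans (he _ _ hs)
  lab := by
    intro α Z η ρ f h g hα hZ hs hf hh hg hc heh heg hst
    have hd := compat_diag (fun Y => (Or.inr rfl : ParG Γ Y (FinDist.dirac Y))) hc
    rcases hZ with ⟨Y, θ, S, hY, rfl, rfl⟩ | rfl
    · rw [ex_parD]
      simp only [ex_dirac]
      cases hs with
      | parL _ hs =>
        rw [ex_parD]
        simp only [ex_dirac]
        refine hΓ.lab α Y θ _ _ _ _ hα hY hs (sec_b01 hf S) (sec_b01 hh S) (sec_b01 hg S)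
          (compat_par hc S) (sec_exc heh S) (sec_exc heg S) ?_
        intro X ρ' hX
        have := hst _ _ (Step.parL S hX)
        simpa [ex_parD, ex_dirac] using this
      | parR _ hs =>
        rename_i ρS
        rw [ex_parD, ex_dirac]
        calc ex ρS (fun Q => f (Y.par Q)) ≤ ex ρS (fun Q => ex θ (fun X => h (X.par Q))) :=
              ex_mono fun Q _ => compat_par hc Q Y θ hY
          _ = ex θ (fun X => ex ρS (fun Q => h (X.par Q))) := ex_comm _ _ _
          _ ≤ _ := ex_mono fun X _ => by
              have := hst _ _ (Step.parR X hs)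
              simpa [ex_parD, ex_dirac] using this
      | comm hcomp h1 h2 => exact absurd rfl hα
    · rw [ex_dirac]
      exact (ex_mono fun X _ => hd X).trans (hst _ _ hs)

theorem DG.loc {Γ : Tm → FinDist Tm → Prop} (hΓ : DG Γ) (L : Finset Chan) : DG (LocG L Γ) where
  diag := fun Y => Or.inr rfl
  tau := by
    intro Z η ρ f g hZ hs hf hg hc he
    have hd := compat_diag (fun Y => (Or.inr rfl : LocG L Γ Y (FinDist.dirac Y))) hc
    rcases hZ with ⟨Y, θ, hY, rfl, rfl⟩ | rfl
    · rw [ex_locD]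
      cases hs with
      | loc _ hs hal =>
        rw [ex_locD]
        exact hΓ.tau Y θ _ _ _ hY hs (fun X => hf _) (fun X => hg _) (compat_loc hc)
          (secL_exc he L)
    · rw [ex_dirac]
      exact (ex_mono fun X _ => hd X).trans (he _ _ hs)
  lab := by
    intro α Z η ρ f h g hα hZ hs hf hh hg hc heh heg hst
    have hd := compat_diag (fun Y => (Or.inr rfl : LocG L Γ Y (FinDist.dirac Y))) hc
    rcases hZ with ⟨Y, θ, hY, rfl, rfl⟩ | rfl
    · rw [ex_locD]
      cases hs with
      | loc _ hs hal =>
        rw [ex_locD]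
        refine hΓ.lab α Y θ _ _ _ _ hα hY hs (fun X => hf _) (fun X => hh _) (fun X => hg _)
          (compat_loc hc) (secL_exc heh L) (secL_exc heg L) ?_
        intro X ρ' hX
        have := hst _ _ (Step.loc L hX hal)
        simpa [ex_locD] using this
    · rw [ex_dirac]
      exact (ex_mono fun X _ => hd X).trans (hst _ _ hs)

theorem DG.uh_compat {Γ : Tm → FinDist Tm → Prop} (hΓ : DG Γ) {h : Tm → ℝ} (hh : B01 h)
    (H : ∀ Y θ, Γ Y θ → h Y ≤ ex θ (uh h)) : Compat Γ (uh h) (uh h) := by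
  set k : Tm → ℝ := fun Y => sInf {x | ∃ θ, Γ Y θ ∧ x = ex θ (uh h)} with hk
  have hne : ∀ Y, {x | ∃ θ, Γ Y θ ∧ x = ex θ (uh h)}.Nonempty :=
    fun Y => ⟨_, _, hΓ.diag Y, rfl⟩
  have hbd : ∀ Y, BddBelow {x | ∃ θ, Γ Y θ ∧ x = ex θ (uh h)} := by
    intro Y
    refine ⟨0, ?_⟩
    rintro x ⟨θ, _, rfl⟩
    exact ex_nonneg fun a _ => (uh_b01 hh a).1
  have hkc : Compat Γ k (uh h) := fun Y θ hY => csInf_le (hbd Y) ⟨θ, hY, rfl⟩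
  have hk1 : B01 k := by
    intro Y
    constructor
    · apply le_csInf (hne Y)
      rintro x ⟨θ, _, rfl⟩
      exact ex_nonneg fun a _ => (uh_b01 hh a).1
    · exact (hkc Y _ (hΓ.diag Y)).trans (ex_le_one fun a _ => (uh_b01 hh a).2)
  have hke : Exc k := by
    intro Y ρ hs
    apply le_csInf (hne Y)
    rintro x ⟨θ, hY, rfl⟩
    exact hΓ.tau Y θ ρ k (uh h) hY hs hk1 (uh_b01 hh) hkc (uh_exc hh)
  have hhk : ∀ Y, h Y ≤ k Y := by
    intro Y
    apply le_csInf (hne Y)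
    rintro x ⟨θ, hY, rfl⟩
    exact H Y θ hY
  intro Y θ hY
  exact (uh_le hke hhk Y).trans (hkc Y θ hY)

theorem DG.mayV_compat {Γ : Tm → FinDist Tm → Prop} (hΓ : DG Γ) : Compat Γ mayV mayV := by
  apply hΓ.uh_compat psi1_b01
  intro Y θ hY
  by_cases hp : Y ∈ psiL
  · have e : psi1 Y = 1 := if_pos hp
    obtain ⟨α, ρ, hα, hs⟩ := hp
    have := hΓ.lab α Y θ ρ (fun _ => 1) (fun _ => 1) mayV (by rintro rfl; exact hα) hY hs
      (fun _ => by simp) (fun _ => by simp) mayV_b01 (fun Y θ _ => by rw [ex_const])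
      (fun X ρ _ => by rw [ex_const]) (uh_exc psi1_b01) (by
        intro X ρ' hX
        rw [ex_const]
        have h1 : psi1 X = 1 := if_pos ⟨α, ρ', hα, hX⟩
        rw [← h1]
        exact le_uh psi1_b01 X)
    rw [ex_const] at this
    rwa [e]
  · have e : psi1 Y = 0 := if_neg hp
    rw [e]
    exact ex_nonneg fun a _ => (mayV_b01 a).1

/-- The preorder induced by `Γ` on distributions. -/
def LeG (Γ : Tm → FinDist Tm → Prop) (μ1 μ2 : FinDist Tm) : Prop :=
  ∀ f g, B01 f → B01 g → Compat Γ f g → ex μ1 f ≤ ex μ2 g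

theorem LeG.par {Γ : Tm → FinDist Tm → Prop} {μ1 μ2 : FinDist Tm} (h : LeG Γ μ1 μ2)
    (ν : FinDist Tm) : LeG (ParG Γ) (μ1.parD ν) (μ2.parD ν) := by
  intro f g hf hg hc
  rw [ex_parD, ex_parD, ex_comm μ1, ex_comm μ2]
  exact ex_mono fun S _ => h _ _ (sec_b01 hf S) (sec_b01 hg S) (compat_par hc S)

theorem LeG.loc {Γ : Tm → FinDist Tm → Prop} {μ1 μ2 : FinDist Tm} (h : LeG Γ μ1 μ2)
    (L : Finset Chan) : LeG (LocG L Γ) (FinDist.locD L μ1) (FinDist.locD L μ2) := by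
  intro f g hf hg hc
  rw [ex_locD, ex_locD]
  exact h _ _ (fun X => hf _) (fun X => hg _) (compat_loc hc)

theorem LeG.may {Γ : Tm → FinDist Tm → Prop} {μ1 μ2 : FinDist Tm} (hΓ : DG Γ)
    (h : LeG Γ μ1 μ2) : chiMayL μ1 ≤ chiMayL μ2 := by
  rw [chiMay_eq, chiMay_eq]
  exact h _ _ mayV_b01 mayV_b01 hΓ.mayV_compat

theorem diamond_of {Γ Γ' : Tm → FinDist Tm → Prop} (hΓ : DG Γ) (hΓ' : DG Γ')
    {μ1 μ2 : FinDist Tm} (h : LeG Γ μ1 μ2) (h' : LeG Γ' μ2 μ1) (D : Set (FinDist Tm)) :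
    DiamondEq D μ1 μ2 := by
  refine ⟨fun μ1 μ2 => ∃ Γ Γ', DG Γ ∧ DG Γ' ∧ LeG Γ μ1 μ2 ∧ LeG Γ' μ2 μ1, ?_, ?_,
    Γ, Γ', hΓ, hΓ', h, h'⟩
  · rintro μ1 μ2 ⟨Γ, Γ', hΓ, hΓ', h, h'⟩
    exact le_antisymm (h.may hΓ) (h'.may hΓ')
  · rintro μ1 μ2 ⟨Γ, Γ', hΓ, hΓ', h, h'⟩
    exact ⟨fun ν _ => ⟨_, _, hΓ.par, hΓ'.par, h.par ν, h'.par ν⟩,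
      fun L => ⟨_, _, hΓ.loc L, hΓ'.loc L, h.loc L, h'.loc L⟩⟩

/-- Symmetric or internally reachable. -/
def GoodG (Γ : Tm → FinDist Tm → Prop) : Prop :=
  (∀ Y θ, Γ Y θ → ∃ Q, θ = FinDist.dirac Q ∧ Γ Q (FinDist.dirac Y)) ∨
  (∀ Y θ, Γ Y θ → ∀ g, B01 g → Exc g → ex θ g ≤ g Y)

theorem GoodG.par {Γ : Tm → FinDist Tm → Prop} (h : GoodG Γ) : GoodG (ParG Γ) := by
  rcases h with h | h
  · left
    rintro Z η (⟨Y, θ, S, hY, rfl, rfl⟩ | rfl)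
    · obtain ⟨Q, rfl, hQ⟩ := h Y θ hY
      exact ⟨_, dirac_parD _ _, Or.inl ⟨Q, _, S, hQ, rfl, (dirac_parD _ _).symm⟩⟩
    · exact ⟨Z, rfl, Or.inr rfl⟩
  · right
    rintro Z η (⟨Y, θ, S, hY, rfl, rfl⟩ | rfl) g hg he
    · simp only [ex_parD, ex_dirac]
      exact h Y θ hY _ (sec_b01 hg S) (sec_exc he S)
    · rw [ex_dirac]

theorem GoodG.loc {Γ : Tm → FinDist Tm → Prop} (h : GoodG Γ) (L : Finset Chan) :
    GoodG (LocG L Γ) := by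
  rcases h with h | h
  · left
    rintro Z η (⟨Y, θ, hY, rfl, rfl⟩ | rfl)
    · obtain ⟨Q, rfl, hQ⟩ := h Y θ hY
      exact ⟨_, dirac_locD _ _, Or.inl ⟨Q, _, hQ, rfl, (dirac_locD _ _).symm⟩⟩
    · exact ⟨Z, rfl, Or.inr rfl⟩
  · right
    rintro Z η (⟨Y, θ, hY, rfl, rfl⟩ | rfl) g hg he
    · simp only [ex_locD]
      exact h Y θ hY _ (fun X => hg _) (secL_exc he L)
    · rw [ex_dirac]

/-- Exact test functions. -/
def Exact (Γ : Tm → FinDist Tm → Prop) (f : Tm → ℝ) : Prop := ∀ Y θ, Γ Y θ → f Y = ex θ f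

theorem GoodG.exact {Γ : Tm → FinDist Tm → Prop} (h : GoodG Γ) {f : Tm → ℝ} (hf : B01 f)
    (he : Exc f) (hc : Compat Γ f f) : Exact Γ f := by
  intro Y θ hY
  apply le_antisymm (hc Y θ hY)
  rcases h with h | h
  · obtain ⟨Q, rfl, hQ⟩ := h Y θ hY
    have := hc _ _ hQ
    rwa [ex_dirac] at this ⊢
  · exact h Y θ hY f hf he

theorem DG.exact_may {Γ : Tm → FinDist Tm → Prop} (hΓ : DG Γ) (h : GoodG Γ) : Exact Γ mayV :=
  h.exact mayV_b01 (uh_exc psi1_b01) hΓ.mayV_compat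

theorem DG.exact_fair {Γ : Tm → FinDist Tm → Prop} (hΓ : DG Γ) (h : GoodG Γ) :
    Exact Γ fairG := by
  apply h.exact fairG_b01 (uh_exc omay_b01)
  apply hΓ.uh_compat omay_b01
  intro Y θ hY
  rw [hΓ.exact_may h Y θ hY, ← ex_one_sub]
  exact ex_mono fun a _ => le_uh omay_b01 a

/-- Equivalence induced by exact test functions. -/
def EqG (Γ : Tm → FinDist Tm → Prop) (μ1 μ2 : FinDist Tm) : Prop :=
  ∀ f, B01 f → Exact Γ f → ex μ1 f = ex μ2 f

theorem box_of {Γ : Tm → FinDist Tm → Prop} (hΓ : DG Γ) (hg : GoodG Γ)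
    {μ1 μ2 : FinDist Tm} (h : EqG Γ μ1 μ2) (D : Set (FinDist Tm)) :
    BoxEq D μ1 μ2 := by
  refine ⟨fun μ1 μ2 => ∃ Γ, DG Γ ∧ GoodG Γ ∧ EqG Γ μ1 μ2, ?_, ?_, Γ, hΓ, hg, h⟩
  · rintro μ1 μ2 ⟨Γ, hΓ, hg, h⟩
    rw [chiFair_eq, chiFair_eq, h _ fairG_b01 (hΓ.exact_fair hg)]
  · rintro μ1 μ2 ⟨Γ, hΓ, hg, h⟩
    refine ⟨fun ν _ => ⟨_, hΓ.par, hg.par, ?_⟩, fun L => ⟨_, hΓ.loc L, hg.loc L, ?_⟩⟩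
    · intro f hf he
      rw [ex_parD, ex_parD, ex_comm μ1, ex_comm μ2]
      apply ex_congr
      intro S _
      refine h _ (sec_b01 hf S) ?_
      intro Y θ hY
      have := he _ _ (Or.inl ⟨Y, θ, S, hY, rfl, rfl⟩)
      simpa [ex_parD, ex_dirac] using this
    · intro f hf he
      rw [ex_locD, ex_locD]
      refine h _ (fun X => hf _) ?_
      intro Y θ hY
      have := he _ _ (Or.inl ⟨Y, θ, hY, rfl, rfl⟩)
      simpa [ex_locD] using this

end Gam

/-! ## Concrete processes and the separating tests -/

section Wit

theorem step_sum {k : ℕ} {acts : Fin (k+1) → Act} {conts : Fin (k+1) → Tm} {α : Act}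
    {ρ : FinDist Tm} (h : Step (.sum k acts conts) α ρ) :
    ∃ i, α = acts i ∧ ρ = FinDist.dirac (conts i) := by
  cases h with
  | choice _ _ i => exact ⟨i, rfl, rfl⟩

theorem step_nil {α : Act} {ρ : FinDist Tm} (h : Step .nil α ρ) : False := by
  cases h

/-- `a.0` -/
def tmA : Tm := .sum 0 (fun _ => .inp 0) (fun _ => .nil)

/-- `a.0 + τ.0` -/
def tmM : Tm := .sum 1 (fun i => if i = 0 then .inp 0 else .tau) (fun _ => .nil)

/-- `½τ.0 ⊕ ½τ.a.0` -/
noncomputable def tmO : Tm := .oplus 1 (fun _ => 1/2) (fun i => if i = 0 then .nil else tmA)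

/-- `½ 0 + ½ a.0` -/
noncomputable def thO : FinDist Tm :=
  mixD (1/2) (by norm_num) (by norm_num) (FinDist.dirac .nil) (FinDist.dirac tmA)

theorem tmA_proc : tmA.IsProc := by
  simp [tmA, Tm.IsProc, Tm.ClosedAt, Tm.NoOmega]

theorem tmM_proc : tmM.IsProc := by
  simp only [tmM, Tm.IsProc, Tm.ClosedAt, Tm.NoOmega]
  refine ⟨fun _ => trivial, fun i => ?_, fun _ => trivial⟩
  split_ifs <;> simp

theorem tmO_proc : tmO.IsProc := by
  simp only [tmO, Tm.IsProc, Tm.ClosedAt, Tm.NoOmega]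
  refine ⟨fun i => ?_, fun i => ?_⟩
  · split_ifs
    · trivial
    · exact tmA_proc.1
  · split_ifs
    · trivial
    · exact tmA_proc.2

theorem dirac_proc {P : Tm} (h : P.IsProc) : (FinDist.dirac P).IsProcDist := by
  intro Q hQ
  have : Q = P := by
    by_contra h
    simp [FinDist.dirac, h] at hQ
  rwa [this]

theorem thO_proc : thO.IsProcDist := by
  intro Q hQ
  by_cases h1 : Q = .nil
  · subst h1
    exact ⟨trivial, trivial⟩
  · by_cases h2 : Q = tmA
    · subst h2
      exact tmA_proc
    · simp [thO, mixD, FinDist.dirac, h1, h2] at hQ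

theorem step_tmA {α : Act} {ρ : FinDist Tm} (h : Step tmA α ρ) :
    α = .inp 0 ∧ ρ = FinDist.dirac .nil := by
  obtain ⟨i, h1, h2⟩ := step_sum h
  exact ⟨h1, h2⟩

theorem tmA_step : Step tmA (.inp 0) (FinDist.dirac .nil) := Step.choice (k := 0) _ _ 0

theorem step_tmM {α : Act} {ρ : FinDist Tm} (h : Step tmM α ρ) :
    (α = .inp 0 ∨ α = .tau) ∧ ρ = FinDist.dirac .nil := by
  obtain ⟨i, h1, h2⟩ := step_sum h
  refine ⟨?_, h2⟩
  rw [h1]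
  split_ifs <;> simp

theorem tmM_step : Step tmM (.inp 0) (FinDist.dirac .nil) :=
  Step.choice (k := 1) (fun i => if i = 0 then .inp 0 else .tau) (fun _ => .nil) 0

theorem tmM_step' : Step tmM .tau (FinDist.dirac .nil) :=
  Step.choice (k := 1) (fun i => if i = 0 then .inp 0 else .tau) (fun _ => .nil) 1

theorem diamond_MA : DiamondEq fullCtx (FinDist.dirac tmM) (FinDist.dirac tmA) := by
  have h1 : DG (fun Y θ => θ = FinDist.dirac Y ∨
      (θ = FinDist.dirac tmA ∧ (Y = tmM ∨ Y = .nil))) := by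
    refine ⟨fun Y => Or.inl rfl, ?_, ?_⟩
    · rintro Y θ ρ f g (rfl | ⟨rfl, rfl | rfl⟩) hs hf hg hc he
      · rw [ex_dirac]
        exact (ex_mono fun X _ => compat_diag (fun Y => Or.inl rfl) hc X).trans (he _ _ hs)
      · rw [(step_tmM hs).2, ex_dirac]
        exact hc _ _ (Or.inr ⟨rfl, Or.inr rfl⟩)
      · exact (step_nil hs).elim
    · rintro α Y θ ρ f h g hα (rfl | ⟨rfl, rfl | rfl⟩) hs hf hh hg hc heh heg hst
      · rw [ex_dirac]
        exact (ex_mono fun X _ => compat_diag (fun Y => Or.inl rfl) hc X).trans (hst _ _ hs)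
      · obtain ⟨hα' | hα', rfl⟩ := step_tmM hs
        · subst hα'
          have h1 := hst _ _ tmA_step
          have h2 := compat_diag (fun Y => Or.inl rfl) hc .nil
          rw [ex_dirac] at h1 ⊢
          rw [ex_dirac]
          exact h2.trans h1
        · exact absurd hα' hα
      · exact (step_nil hs).elim
  have h2 : DG (fun Y θ => θ = FinDist.dirac Y ∨
      (θ = FinDist.dirac tmM ∧ Y = tmA)) := by
    refine ⟨fun Y => Or.inl rfl, ?_, ?_⟩
    · rintro Y θ ρ f g (rfl | ⟨rfl, rfl⟩) hs hf hg hc he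
      · rw [ex_dirac]
        exact (ex_mono fun X _ => compat_diag (fun Y => Or.inl rfl) hc X).trans (he _ _ hs)
      · exact absurd (step_tmA hs).1 (by simp)
    · rintro α Y θ ρ f h g hα (rfl | ⟨rfl, rfl⟩) hs hf hh hg hc heh heg hst
      · rw [ex_dirac]
        exact (ex_mono fun X _ => compat_diag (fun Y => Or.inl rfl) hc X).trans (hst _ _ hs)
      · obtain ⟨rfl, rfl⟩ := step_tmA hs
        have h1 := hst _ _ tmM_step
        have h2 := compat_diag (fun Y => Or.inl rfl) hc .nil
        rw [ex_dirac] at h1 ⊢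
        rw [ex_dirac]
        exact h2.trans h1
  refine diamond_of h1 h2 ?_ ?_ _
  · intro f g _ _ hc
    rw [ex_dirac]
    exact hc _ _ (Or.inr ⟨rfl, Or.inl rfl⟩)
  · intro f g _ _ hc
    rw [ex_dirac]
    exact hc _ _ (Or.inr ⟨rfl, rfl⟩)

theorem mayV_nil : mayV .nil = 0 := by
  apply le_antisymm _ (mayV_b01 _).1
  have := uh_le (h := psi1) (g := fun X => if X = .nil then 0 else 1) (by
    intro X ρ hs
    by_cases h : X = .nil
    · subst h
      exact (step_nil hs).elim
    · simp only [h, if_false]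
      apply ex_le_one
      intro a _
      split_ifs <;> simp) (by
    intro P
    by_cases h : P = .nil
    · subst h
      simp only [if_true]
      apply le_of_eq
      apply if_neg
      rintro ⟨α, ρ, _, hs⟩
      exact step_nil hs
    · simp only [h, if_false]
      exact (psi1_b01 P).2) .nil
  simpa [mayV] using this

theorem mayV_of_step {P : Tm} {α : Act} {ρ : FinDist Tm} (hα : α.IsLabel) (h : Step P α ρ) :
    mayV P = 1 := by
  apply le_antisymm (mayV_b01 _).2
  have h1 : psi1 P = 1 := if_pos ⟨α, ρ, hα, h⟩
  rw [← h1]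
  exact le_uh psi1_b01 P

theorem not_box_MA : ¬ BoxEq fullCtx (FinDist.dirac tmM) (FinDist.dirac tmA) := by
  rintro ⟨R, hs, _, hR⟩
  have := hs _ _ hR
  rw [chiFair_eq, chiFair_eq, ex_dirac, ex_dirac] at this
  have hA : fairG tmA ≤ 0 := by
    have := uh_le (h := fun P => 1 - mayV P) (g := fun X => if X = tmA then 0 else 1) (by
      intro X ρ hs
      by_cases h : X = tmA
      · subst h
        exact absurd (step_tmA hs).1 (by simp)
      · simp only [h, if_false]
        apply ex_le_one
        intro a _
        split_ifs <;> simp) (by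
      intro P
      by_cases h : P = tmA
      · subst h
        simp [mayV_of_step (α := .inp 0) trivial tmA_step]
      · simp only [h, if_false]
        exact (omay_b01 P).2) tmA
    simpa [fairG] using this
  have hM : 1 ≤ fairG tmM := by
    have h1 := uh_exc omay_b01 _ _ tmM_step'
    rw [ex_dirac] at h1
    have h2 := le_uh omay_b01 .nil
    rw [mayV_nil] at h2
    have h3 : fairG tmM = uh (fun P => 1 - mayV P) tmM := rfl
    linarith
  linarith

theorem step_tmO {α : Act} {ρ : FinDist Tm} (h : Step tmO α ρ) : α = .tau ∧ ρ = thO := by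
  cases h with
  | oplus _ _ _ _ h2 =>
    refine ⟨rfl, FinDist.ext' fun Q => ?_⟩
    rw [h2 Q]
    erw [Fin.sum_univ_two]
    simp only [thO, mixD, FinDist.dirac]
    simp only [if_true, one_ne_zero, if_false, eq_comm (a := Q)]
    norm_num

theorem tmO_step : Step tmO .tau thO := by
  apply Step.oplus
  · intro i
    norm_num
  · intro Q
    erw [Fin.sum_univ_two]
    simp only [thO, mixD, FinDist.dirac]
    simp only [if_true, one_ne_zero, if_false, eq_comm (a := Q)]
    norm_num

theorem box_O : BoxEq fullCtx (FinDist.dirac tmO) thO := by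
  have h1 : DG (fun Y θ => θ = FinDist.dirac Y ∨ (θ = thO ∧ Y = tmO)) := by
    refine ⟨fun Y => Or.inl rfl, ?_, ?_⟩
    · rintro Y θ ρ f g (rfl | ⟨rfl, rfl⟩) hs hf hg hc he
      · rw [ex_dirac]
        exact (ex_mono fun X _ => compat_diag (fun Y => Or.inl rfl) hc X).trans (he _ _ hs)
      · rw [(step_tmO hs).2]
        exact ex_mono fun X _ => compat_diag (fun Y => Or.inl rfl) hc X
    · rintro α Y θ ρ f h g hα (rfl | ⟨rfl, rfl⟩) hs hf hh hg hc heh heg hst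
      · rw [ex_dirac]
        exact (ex_mono fun X _ => compat_diag (fun Y => Or.inl rfl) hc X).trans (hst _ _ hs)
      · exact absurd (step_tmO hs).1 hα
  refine box_of h1 (Or.inr ?_) ?_ _
  · rintro Y θ (rfl | ⟨rfl, rfl⟩) g hg he
    · rw [ex_dirac]
    · exact he _ _ tmO_step
  · intro f _ he
    rw [ex_dirac]
    exact he _ _ (Or.inr ⟨rfl, rfl⟩)

theorem not_weak_nil : ¬ WeakBisim .nil tmA := by
  rintro ⟨E, ⟨hE, hb⟩, h⟩
  obtain ⟨ρ, ⟨σ, hv, h1, h2, _⟩, _⟩ := hb _ _ (hE.symm h) _ _ tmA_step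
  have hc : ∀ hd l, coneProbAux .nil σ hd l ≠ 0 → l = [] ∧ hd = .nil := by
    intro hd l
    induction l with
    | nil =>
      intro h
      refine ⟨rfl, ?_⟩
      by_contra hne
      simp [coneProbAux, hne] at h
    | cons s rest ih =>
      intro h
      exfalso
      rw [coneProbAux] at h
      obtain ⟨rfl, rfl⟩ := ih (left_ne_zero_of_mul h)
      have h3 := right_ne_zero_of_mul h
      unfold transProb at h3
      obtain ⟨tr, htr⟩ : ∃ tr : PTrans, (if tr.val.2.1 = s.1 then
          (σ ⟨.nil, [].reverse⟩).toFun (some tr) * (tr.val.2.2).toFun s.2 else 0) ≠ 0 := (by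
        by_contra hcon
        push Not at hcon
        exact h3 (finsum_eq_zero_of_forall_eq_zero hcon))
      have h4 : (σ ⟨.nil, [].reverse⟩).toFun (some tr) ≠ 0 := by
        intro h0
        apply htr
        rw [h0]
        simp
      have h5 := hv _ _ h4
      have h6 := tr.property
      rw [h5] at h6
      exact step_nil h6
  have h0 : ∀ ω, fragProb .nil σ ω = 0 := by
    intro ω
    by_contra hne
    have h3 := h2 ω hne
    have h4 := (hc _ _ (left_ne_zero_of_mul hne)).1
    have h5 : ω.steps = [] := by simpa using h4
    simp [Frag.trace, h5, extTrace] at h3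
  have : (fun ω => fragProb .nil σ ω) = fun _ => 0 := funext h0
  rw [this] at h1
  have := h1.unique hasSum_zero
  norm_num at this

theorem not_weak_O (hrefl : ∀ P, WeakBisim P P) : ¬ WeakBisimD (FinDist.dirac tmO) thO := by
  intro h
  have := h .nil
  rw [mass_eq_ex, mass_eq_ex, ex_dirac, thO, ex_mixD, ex_dirac, ex_dirac] at this
  have h1 : Tm.nil ∈ {Q | WeakBisim .nil Q} := hrefl _
  have h2 : tmA ∉ {Q | WeakBisim .nil Q} := not_weak_nil
  rw [if_pos h1, if_neg h2] at this
  split_ifs at this <;> norm_num at this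

theorem subst_chans (P : Tm) (T : Tm) : ∀ n, (Tm.subst P n T).chans ⊆ P.chans ∪ T.chans := by
  induction T with
  | nil => intro n; simp [Tm.subst, Tm.chans]
  | var m =>
    intro n
    simp only [Tm.subst]
    split_ifs
    · exact Finset.subset_union_left
    · simp [Tm.chans]
  | sum k a c ih =>
    intro n
    simp only [Tm.subst, Tm.chans]
    apply Finset.union_subset
    · intro x hx
      simp only [Finset.mem_union]
      exact Or.inr (Or.inl hx)
    · refine Finset.sup_le fun i hi => (ih i n).trans ?_
      apply Finset.union_subset Finset.subset_union_left
      intro x hx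
      simp only [Finset.mem_union]
      exact Or.inr (Or.inr (Finset.le_sup (f := fun i => (c i).chans) hi hx))
  | oplus k w c ih =>
    intro n
    simp only [Tm.subst, Tm.chans]
    refine Finset.sup_le fun i hi => (ih i n).trans ?_
    apply Finset.union_subset Finset.subset_union_left
    intro x hx
    simp only [Finset.mem_union]
    exact Or.inr (Finset.le_sup (f := fun i => (c i).chans) hi hx)
  | par S T ihS ihT =>
    intro n
    simp only [Tm.subst, Tm.chans]
    have h1 := ihS n
    have h2 := ihT n
    intro x hx
    have := @h1 x
    have := @h2 x
    simp only [Finset.mem_union] at *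
    tauto
  | loc L T ih =>
    intro n
    simp only [Tm.subst, Tm.chans]
    have h1 := ih n
    intro x hx
    have := @h1 x
    simp only [Finset.mem_union] at *
    tauto
  | fix T ih =>
    intro n
    exact ih (n+1)

theorem dirac_ne {α : Type} {P Q : α} (h : (FinDist.dirac P).toFun Q ≠ 0) : Q = P := by
  by_contra hne
  simp [FinDist.dirac, hne] at h

theorem parD_ne {μ ν : FinDist Tm} {Z : Tm} (h : (μ.parD ν).toFun Z ≠ 0) :
    ∃ X Y, μ.toFun X ≠ 0 ∧ ν.toFun Y ≠ 0 ∧ Z = Tm.par X Y := by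
  obtain ⟨⟨X, Y⟩, h1, h2⟩ := map_toFun_ne h
  have h3 : μ.toFun X * ν.toFun Y ≠ 0 := h1
  exact ⟨X, Y, left_ne_zero_of_mul h3, right_ne_zero_of_mul h3, h2.symm⟩

theorem locD_ne {L : Finset Chan} {μ : FinDist Tm} {Z : Tm} (h : (FinDist.locD L μ).toFun Z ≠ 0) :
    ∃ X, μ.toFun X ≠ 0 ∧ Z = Tm.loc L X := by
  obtain ⟨X, h1, h2⟩ := map_toFun_ne h
  exact ⟨X, h1, h2.symm⟩

theorem step_chans {P : Tm} {α : Act} {ρ : FinDist Tm} (h : Step P α ρ) :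
    α.chans ⊆ P.chans ∧ ∀ Q, ρ.toFun Q ≠ 0 → Q.chans ⊆ P.chans := by
  induction h with
  | choice acts conts i =>
    simp only [Tm.chans]
    constructor
    · intro x hx
      exact Finset.mem_union_left _
        (Finset.le_sup (f := fun i => (acts i).chans) (Finset.mem_univ i) hx)
    · intro Q hQ
      rw [dirac_ne hQ]
      intro x hx
      exact Finset.mem_union_right _
        (Finset.le_sup (f := fun i => (conts i).chans) (Finset.mem_univ i) hx)
  | oplus w conts ρ _ h2 =>
    refine ⟨by simp [Act.chans], fun Q hQ => ?_⟩
    rw [h2] at hQ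
    obtain ⟨i, _, hi⟩ := Finset.exists_ne_zero_of_sum_ne_zero hQ
    have : conts i = Q := by
      by_contra hne
      simp [hne] at hi
    rw [← this]
    intro x hx
    exact Finset.le_sup (f := fun i => (conts i).chans) (Finset.mem_univ i) hx
  | parL T _ ih =>
    simp only [Tm.chans]
    refine ⟨ih.1.trans Finset.subset_union_left, fun Q hQ => ?_⟩
    obtain ⟨X, Y, h1, h2, rfl⟩ := parD_ne hQ
    rw [dirac_ne h2]
    exact Finset.union_subset_union (ih.2 X h1) subset_rfl
  | parR S _ ih =>
    simp only [Tm.chans]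
    refine ⟨ih.1.trans Finset.subset_union_right, fun Q hQ => ?_⟩
    obtain ⟨X, Y, h1, h2, rfl⟩ := parD_ne hQ
    rw [dirac_ne h1]
    exact Finset.union_subset_union subset_rfl (ih.2 Y h2)
  | comm _ _ _ ih1 ih2 =>
    refine ⟨by simp [Act.chans], fun Q hQ => ?_⟩
    obtain ⟨X, Y, h1, h2, rfl⟩ := parD_ne hQ
    exact Finset.union_subset_union (ih1.2 X h1) (ih2.2 Y h2)
  | loc L _ _ ih =>
    simp only [Tm.chans]
    refine ⟨ih.1.trans Finset.subset_union_right, fun Q hQ => ?_⟩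
    obtain ⟨X, h1, rfl⟩ := locD_ne hQ
    exact Finset.union_subset_union subset_rfl (ih.2 X h1)
  | @fixp T β ρ _ ih =>
    have h := subst_chans (.fix T) T 0
    have h' : (Tm.subst (.fix T) 0 T).chans ⊆ (Tm.fix T).chans := by
      refine h.trans ?_
      simp [Tm.chans]
    exact ⟨ih.1.trans h', fun Q hQ => (ih.2 Q hQ).trans h'⟩

/-- Actions of the universal probe. -/
def probeAct (N : ℕ) (i : Fin (2*N+1)) : Act :=
  if i.val < N then .inp i.val else if i.val < 2*N then .out (i.val - N) else .inp N

/-- The universal probe. -/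
def probe (N : ℕ) : Tm := .sum (2*N) (probeAct N) (fun _ => .nil)

theorem probe_proc (N : ℕ) : (probe N).IsProc := by
  simp only [probe, Tm.IsProc, Tm.ClosedAt, Tm.NoOmega]
  refine ⟨fun _ => trivial, fun i => ?_, fun _ => trivial⟩
  unfold probeAct
  split_ifs <;> simp

theorem step_probe {N : ℕ} {α : Act} {ρ : FinDist Tm} (h : Step (probe N) α ρ) :
    α ≠ .tau ∧ ρ = FinDist.dirac .nil := by
  obtain ⟨i, rfl, rfl⟩ := step_sum h
  refine ⟨?_, rfl⟩
  unfold probeAct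
  split_ifs <;> simp

theorem probe_inp {N a : ℕ} (h : a ≤ N) : Step (probe N) (.inp a) (FinDist.dirac .nil) := by
  rcases h.lt_or_eq with h | rfl
  · have := Step.choice (probeAct N) (fun _ => .nil) ⟨a, by omega⟩
    have e : probeAct N ⟨a, by omega⟩ = .inp a := by simp [probeAct, h]
    rwa [e] at this
  · have := Step.choice (probeAct a) (fun _ => .nil) ⟨2*a, by omega⟩
    have e : probeAct a ⟨2*a, by omega⟩ = .inp a := by
      simp only [probeAct]
      rw [if_neg (by omega), if_neg (by omega)]
    rwa [e] at this

theorem probe_out {N a : ℕ} (h : a < N) : Step (probe N) (.out a) (FinDist.dirac .nil) := by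
  have := Step.choice (probeAct N) (fun _ => .nil) ⟨N+a, by omega⟩
  have e : probeAct N ⟨N+a, by omega⟩ = .out a := by
    simp only [probeAct]
    rw [if_neg (by omega), if_pos (by omega)]
    rw [Nat.add_sub_cancel_left]
  rwa [e] at this

/-- Localized composition. -/
def lpr (N : ℕ) (X S : Tm) : Tm := .loc (Finset.range N) (.par X S)

theorem mayV_lp_nil {N : ℕ} {P : Tm} (hP : P.chans ⊆ Finset.range N) :
    mayV (lpr N P .nil) = 0 := by
  apply le_antisymm _ (mayV_b01 _).1
  have := uh_le (h := psi1)
    (g := fun Z => if ∃ X : Tm, X.chans ⊆ Finset.range N ∧ Z = lpr N X .nil then 0 else 1) (by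
    intro Z ρ hs
    beta_reduce
    split_ifs with h
    · obtain ⟨X, hX, rfl⟩ := h
      apply le_of_eq
      refine Eq.trans ?_ (ex_const ρ (0:ℝ))
      apply ex_congr
      intro Z hZ
      apply if_pos
      unfold lpr at hs
      cases hs with
      | loc _ hs hal =>
        obtain ⟨Z', hZ', rfl⟩ := locD_ne hZ
        generalize hA : Act.tau = A at hs
        cases hs with
        | parL _ hs =>
          obtain ⟨X', Y', h1, h2, rfl⟩ := parD_ne hZ'
          rw [dirac_ne h2]
          exact ⟨X', ((step_chans hs).2 X' h1).trans hX, rfl⟩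
        | parR _ hs => exact (step_nil hs).elim
        | comm _ _ hs => exact (step_nil hs).elim
    · apply ex_le_one
      intro a _
      split_ifs <;> simp) (by
    intro Z
    beta_reduce
    split_ifs with h
    · obtain ⟨X, hX, rfl⟩ := h
      apply le_of_eq
      apply if_neg
      rintro ⟨α, ρ, hα, hs⟩
      unfold lpr at hs
      cases hs with
      | loc _ hs hal =>
        cases hs with
        | parL _ hs =>
          have := (step_chans hs).1.trans hX
          cases α with
          | inp a => exact hal (this (by simp [Act.chans]))
          | out a => exact hal (this (by simp [Act.chans]))
          | tau => exact hα
          | omega => exact hα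
        | parR _ hs => exact step_nil hs
        | comm _ _ hs => exact step_nil hs
    · exact (psi1_b01 Z).2) (lpr N P .nil)
  rwa [if_pos ⟨P, hP, rfl⟩] at this

theorem mayV_lp_probe (N : ℕ) (P : Tm) : mayV (lpr N P (probe N)) = 1 := by
  have hs : Step (lpr N P (probe N)) (.inp N) _ :=
    Step.loc (Finset.range N) (Step.parR P (probe_inp le_rfl)) (by simp [Act.Allowed])
  exact mayV_of_step (α := .inp N) trivial hs

/-- Bounding function for the fair value of the probed process. -/
noncomputable def gLp (N : ℕ) (Z : Tm) : ℝ :=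
  if h : ∃ X : Tm, X.chans ⊆ Finset.range N ∧ Z = lpr N X (probe N) then mayV h.choose else 1

theorem gLp_eq {N : ℕ} {X : Tm} (hX : X.chans ⊆ Finset.range N) :
    gLp N (lpr N X (probe N)) = mayV X := by
  have h : ∃ X' : Tm, X'.chans ⊆ Finset.range N ∧ lpr N X (probe N) = lpr N X' (probe N) :=
    ⟨X, hX, rfl⟩
  unfold gLp
  rw [dif_pos h]
  have := h.choose_spec.2
  unfold lpr at this
  injection this with _ h2
  injection h2 with h3 _
  exact (congrArg mayV h3).symm

theorem gLp_le_one (N : ℕ) (Z : Tm) : gLp N Z ≤ 1 := by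
  unfold gLp
  split_ifs
  · exact (mayV_b01 _).2
  · exact le_rfl

theorem fairG_lp {N : ℕ} {P : Tm} (hP : P.chans ⊆ Finset.range N) :
    fairG (lpr N P (probe N)) = mayV P := by
  apply le_antisymm
  · have := uh_le (h := fun P => 1 - mayV P) (g := gLp N) (by
      intro Z ρ hs
      by_cases h : ∃ X : Tm, X.chans ⊆ Finset.range N ∧ Z = lpr N X (probe N)
      · obtain ⟨X, hX, rfl⟩ := h
        rw [gLp_eq hX]
        unfold lpr at hs
        cases hs with
        | loc _ hs hal =>
          rw [ex_locD]
          generalize hA : Act.tau = A at hs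
          cases hs with
          | parL _ hs =>
            subst hA
            rw [ex_parD]
            simp only [ex_dirac]
            refine le_trans (le_of_eq ?_) (uh_exc psi1_b01 _ _ hs)
            apply ex_congr
            intro X' hX'
            exact gLp_eq (((step_chans hs).2 X' hX').trans hX)
          | parR _ hs => exact absurd hA.symm (step_probe hs).1
          | comm hc h1 h2 =>
            rename_i ℓ1 ℓ2 ρ1 ρ2
            rw [mayV_of_step (α := ℓ1) ?_ h1]
            · exact ex_le_one fun a _ => gLp_le_one _ _
            · obtain ⟨a, ⟨rfl, _⟩ | ⟨rfl, _⟩⟩ := hc <;> trivial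
      · have : gLp N Z = 1 := dif_neg h
        rw [this]
        exact ex_le_one fun a _ => gLp_le_one _ _) (by
      intro Z
      by_cases h : ∃ X : Tm, X.chans ⊆ Finset.range N ∧ Z = lpr N X (probe N)
      · obtain ⟨X, hX, rfl⟩ := h
        rw [gLp_eq hX, mayV_lp_probe, sub_self]
        exact (mayV_b01 X).1
      · have : gLp N Z = 1 := dif_neg h
        rw [this]
        exact (omay_b01 Z).2) (lpr N P (probe N))
    rwa [gLp_eq hP] at this
  · have := uh_le (h := psi1)
      (g := fun X => if X.chans ⊆ Finset.range N then fairG (lpr N X (probe N)) else 1) (by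
      intro X ρ hs
      beta_reduce
      by_cases h : X.chans ⊆ Finset.range N
      · rw [if_pos h]
        have h1 := uh_exc omay_b01 _ _ (Step.loc (Finset.range N) (Step.parL (probe N) hs) trivial)
        rw [ex_locD, ex_parD] at h1
        simp only [ex_dirac] at h1
        refine le_trans (le_of_eq ?_) h1
        apply ex_congr
        intro X' hX'
        exact if_pos (((step_chans hs).2 X' hX').trans h)
      · rw [if_neg h]
        apply ex_le_one
        intro a _
        split_ifs
        · exact (fairG_b01 _).2
        · exact le_rfl) (by
      intro X
      beta_reduce
      by_cases h : X.chans ⊆ Finset.range N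
      · rw [if_pos h]
        by_cases hp : X ∈ psiL
        · refine (psi1_b01 X).2.trans ?_
          obtain ⟨α, ρ, hα, hs⟩ := hp
          have hch := step_chans hs
          obtain ⟨β, hcomp, hβ⟩ : ∃ β, Act.Comp α β ∧ Step (probe N) β (FinDist.dirac .nil) := by
            cases α with
            | inp a =>
              have : a ∈ Finset.range N := h (hch.1 (by simp [Act.chans]))
              exact ⟨.out a, ⟨a, Or.inl ⟨rfl, rfl⟩⟩, probe_out (Finset.mem_range.mp this)⟩
            | out a =>
              have : a ∈ Finset.range N := h (hch.1 (by simp [Act.chans]))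
              exact ⟨.inp a, ⟨a, Or.inr ⟨rfl, rfl⟩⟩, probe_inp (Finset.mem_range.mp this).le⟩
            | tau => exact hα.elim
            | omega => exact hα.elim
          have h1 := uh_exc omay_b01 _ _
            (Step.loc (Finset.range N) (Step.comm hcomp hs hβ) trivial)
          rw [ex_locD, ex_parD] at h1
          simp only [ex_dirac] at h1
          refine le_trans ?_ h1
          conv_lhs => rw [← ex_const ρ (1:ℝ)]
          apply ex_mono
          intro Q hQ
          have h2 := le_uh omay_b01 (lpr N Q .nil)
          rw [mayV_lp_nil ((hch.2 Q hQ).trans h), sub_zero] at h2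
          exact h2
        · have : psi1 X = 0 := if_neg hp
          rw [this]
          exact (fairG_b01 _).1
      · rw [if_neg h]
        exact (psi1_b01 X).2) P
    simp only [if_pos hP] at this
    exact this

theorem exists_range (μ : FinDist Tm) : ∃ N, ∀ P, μ.toFun P ≠ 0 → P.chans ⊆ Finset.range N := by
  obtain ⟨N, hN⟩ := (μ.finite_support.toFinset.sup Tm.chans).exists_nat_subset_range
  exact ⟨N, fun P hP => (Finset.le_sup (f := Tm.chans) (by simpa using hP)).trans hN⟩

theorem box_diamond (μ1 μ2 : FinDist Tm) (h : BoxEq fullCtx μ1 μ2) :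
    DiamondEq fullCtx μ1 μ2 := by
  have hext : DExtensional fullCtx (BoxEq fullCtx) := by
    rintro μ1 μ2 ⟨R, hs, he, hR⟩
    exact ⟨fun ν hν => ⟨R, hs, he, (he _ _ hR).1 ν hν⟩, fun L => ⟨R, hs, he, (he _ _ hR).2 L⟩⟩
  refine ⟨BoxEq fullCtx, ?_, hext, h⟩
  intro μ1 μ2 hb
  obtain ⟨N1, h1⟩ := exists_range μ1
  obtain ⟨N2, h2⟩ := exists_range μ2
  set N := max N1 N2
  have key : ∀ μ : FinDist Tm, (∀ P, μ.toFun P ≠ 0 → P.chans ⊆ Finset.range N) →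
      chiFairL (FinDist.locD (Finset.range N) (μ.parD (FinDist.dirac (probe N)))) =
        1 - chiMayL μ := by
    intro μ hμ
    rw [chiFair_eq, chiMay_eq, ex_locD, ex_parD]
    simp only [ex_dirac]
    congr 1
    apply ex_congr
    intro P hP
    exact fairG_lp (hμ P hP)
  obtain ⟨R, hs, _, hR⟩ := (hext _ _ ((hext _ _ hb).1 _ (dirac_proc (probe_proc N)))).2
    (Finset.range N)
  have := hs _ _ hR
  rw [key μ1 fun P hP => (h1 P hP).trans (Finset.range_subset_range.mpr (le_max_left _ _)),
    key μ2 fun P hP => (h2 P hP).trans (Finset.range_subset_range.mpr (le_max_right _ _))] at this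
  linarith

end Wit

/-! ## Achievable values -/

section AchSec

/-- Nodes: a state together with the trace that remains to be produced. -/
abbrev Node := Tm × List Act

/-- Finite strategy trees with leaf values in `Λ`. -/
inductive Tr {V : Type} [AddCommGroup V] [Module ℝ V] (Λ : Node → V → Prop) : Node → V → Prop
  | leaf {y : Node} {v : V} : Λ y v → Tr Λ y v
  | move {Y : Tm} {β : Act} {ρ : FinDist Tm} {r r' : List Act} (f : Tm → V) :
      Step Y β ρ → r = extTrace β ++ r' → (∀ B, ρ.toFun B ≠ 0 → Tr Λ (B, r') (f B)) →
      Tr Λ (Y, r) (ex ρ f)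
  | mix {y : Node} {ι : Type} (D : FinDist ι) (f : ι → V) :
      (∀ i, D.toFun i ≠ 0 → Tr Λ y (f i)) → Tr Λ y (ex D f)

theorem Tr.rel {V W : Type} [AddCommGroup V] [Module ℝ V] [AddCommGroup W] [Module ℝ W]
    {Λ : Node → V → Prop} {Λ' : Node → W → Prop} (R : V → W → Prop)
    (hR : ∀ (ι : Type) (D : FinDist ι) (f : ι → V) (f' : ι → W),
      (∀ i, D.toFun i ≠ 0 → R (f i) (f' i)) → R (ex D f) (ex D f'))
    (hΛ : ∀ y v, Λ y v → ∃ w, R v w ∧ Tr Λ' y w) {y : Node} {v : V} (h : Tr Λ y v) :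
    ∃ w, R v w ∧ Tr Λ' y w := by
  induction h with
  | leaf h => exact hΛ _ _ h
  | @move Y β ρ r r' f hs hr _ ih =>
    have : ∀ B, ∃ w, ρ.toFun B ≠ 0 → R (f B) w ∧ Tr Λ' (B, r') w := by
      intro B
      by_cases hB : ρ.toFun B ≠ 0
      · obtain ⟨w, hw⟩ := ih B hB
        exact ⟨w, fun _ => hw⟩
      · exact ⟨0, fun h => absurd h hB⟩
    choose f' hf' using this
    exact ⟨ex ρ f', hR _ _ _ _ (fun B hB => (hf' B hB).1),
      Tr.move f' hs hr (fun B hB => (hf' B hB).2)⟩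
  | @mix y ι D f _ ih =>
    have : ∀ B, ∃ w, D.toFun B ≠ 0 → R (f B) w ∧ Tr Λ' y w := by
      intro B
      by_cases hB : D.toFun B ≠ 0
      · obtain ⟨w, hw⟩ := ih B hB
        exact ⟨w, fun _ => hw⟩
      · exact ⟨0, fun h => absurd h hB⟩
    choose f' hf' using this
    exact ⟨ex D f', hR _ _ _ _ (fun B hB => (hf' B hB).1),
      Tr.mix D f' (fun B hB => (hf' B hB).2)⟩

theorem Tr.inv {V : Type} [AddCommGroup V] [Module ℝ V] {Λ : Node → V → Prop} (C : V → Prop)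
    (hC : ∀ (ι : Type) (D : FinDist ι) (f : ι → V), (∀ i, D.toFun i ≠ 0 → C (f i)) → C (ex D f))
    (hΛ : ∀ y v, Λ y v → C v) {y : Node} {v : V} (h : Tr Λ y v) : C v := by
  induction h with
  | leaf h => exact hΛ _ _ h
  | move f hs hr _ ih => exact hC _ _ _ ih
  | mix D f _ ih => exact hC _ _ _ ih

/-- Leaves of an accounted tree: stops (`p = 1`) and promises (`p = 0`). -/
def Lam {V : Type} (Φ K : Node → V → Prop) (y : Node) (x : V × ℝ) : Prop :=
  (Φ y x.1 ∧ x.2 = 1) ∨ (K y x.1 ∧ x.2 = 0)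

/-- Relations between accounted values, keeping the value and bounding the account. -/
theorem rel_aux {V W : Type} [AddCommGroup V] [Module ℝ V] [AddCommGroup W] [Module ℝ W]
    (T : V →ₗ[ℝ] W) (φ : V × ℝ →ₗ[ℝ] ℝ) (b : ℝ) :
    ∀ (ι : Type) (D : FinDist ι) (f : ι → V × ℝ) (f' : ι → W × ℝ),
      (∀ i, D.toFun i ≠ 0 → (f' i).1 = T (f i).1 ∧ φ (f i) + b ≤ (f' i).2) →
      ((ex D f').1 = T (ex D f).1 ∧ φ (ex D f) + b ≤ (ex D f').2) := by
  intro ι D f f' h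
  constructor
  · rw [ex_fst, ex_fst, ex_linear]
    exact ex_congr fun i hi => (h i hi).1
  · rw [ex_linear, ex_snd]
    calc ex D (fun a => φ (f a)) + b = ex D (fun a => φ (f a) + b) := by
          rw [ex_add, ex_const]
      _ ≤ _ := ex_mono fun i hi => (h i hi).2

/-- Reaccounting a tree leafwise. -/
theorem Tr.acct {V W : Type} [AddCommGroup V] [Module ℝ V] [AddCommGroup W] [Module ℝ W]
    {Λ : Node → V × ℝ → Prop} {Λ' : Node → W × ℝ → Prop}
    (T : V →ₗ[ℝ] W) (φ : V × ℝ →ₗ[ℝ] ℝ) (b : ℝ)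
    (h : ∀ y v p, Λ y (v, p) → ∃ p', φ (v, p) + b ≤ p' ∧ Tr Λ' y (T v, p'))
    {y : Node} {v : V} {p : ℝ} (ht : Tr Λ y (v, p)) :
    ∃ p', φ (v, p) + b ≤ p' ∧ Tr Λ' y (T v, p') := by
  obtain ⟨⟨w, p'⟩, ⟨h1, h2⟩, h3⟩ := Tr.rel (Λ' := Λ')
    (fun x x' => x'.1 = T x.1 ∧ φ x + b ≤ x'.2) (rel_aux T φ b)
    (by
      rintro y ⟨v, p⟩ hl
      obtain ⟨p', h1, h2⟩ := h y v p hl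
      exact ⟨(T v, p'), ⟨rfl, h1⟩, h2⟩) ht
  simp only at h1 h2
  subst h1
  exact ⟨p', h2, h3⟩

/-- Every promise is kept with probability at least one half, up to new promises. -/
def Prog {V : Type} [AddCommGroup V] [Module ℝ V] (Φ K : Node → V → Prop) : Prop :=
  ∀ y v, K y v → ∃ p, 1/2 ≤ p ∧ Tr (Lam Φ K) y (v, p)

/-- Boundedness. -/
def Bd {V : Type} [NormedAddCommGroup V] (Φ : Node → V → Prop) : Prop := ∀ y v, Φ y v → ‖v‖ ≤ 1

/-- Achievable values. -/
def Ach {V : Type} [NormedAddCommGroup V] [NormedSpace ℝ V] (Φ : Node → V → Prop) (y : Node)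
    (v : V) : Prop := ∃ K, Bd K ∧ Prog Φ K ∧ K y v

variable {V W : Type} [NormedAddCommGroup V] [NormedSpace ℝ V] [NormedAddCommGroup W]
  [NormedSpace ℝ W]

theorem Lam.mono {V : Type} {Φ K Φ' K' : Node → V → Prop} (h1 : ∀ y v, Φ y v → Φ' y v)
    (h2 : ∀ y v, K y v → K' y v) {y : Node} {x : V × ℝ} (h : Lam Φ K y x) : Lam Φ' K' y x := by
  rcases h with h | h
  · exact Or.inl ⟨h1 _ _ h.1, h.2⟩
  · exact Or.inr ⟨h2 _ _ h.1, h.2⟩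

theorem Tr.mono {V : Type} [AddCommGroup V] [Module ℝ V] {Λ Λ' : Node → V → Prop}
    (h : ∀ y v, Λ y v → Λ' y v) {y : Node} {v : V} (ht : Tr Λ y v) : Tr Λ' y v := by
  induction ht with
  | leaf h' => exact Tr.leaf (h _ _ h')
  | move f hs hr _ ih => exact Tr.move f hs hr ih
  | mix D f _ ih => exact Tr.mix D f ih

theorem Ach.bd (Φ : Node → V → Prop) : Bd (Ach Φ) := by
  rintro y v ⟨K, hb, _, hv⟩
  exact hb y v hv

theorem Ach.prog (Φ : Node → V → Prop) : Prog Φ (Ach Φ) := by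
  rintro y v ⟨K, hb, hp, hv⟩
  obtain ⟨p, h1, h2⟩ := hp y v hv
  exact ⟨p, h1, h2.mono fun y x hx => hx.mono (fun _ _ h => h) fun y v h => ⟨K, hb, hp, h⟩⟩

theorem ex_norm_le {ι : Type} (D : FinDist ι) (f : ι → V)
    (h : ∀ i, D.toFun i ≠ 0 → ‖f i‖ ≤ 1) : ‖ex D f‖ ≤ 1 :=
  (norm_ex_le D f).trans (ex_le_one h)

theorem Tr.bounds {Φ K : Node → V → Prop} (h1 : Bd Φ) (h2 : Bd K) {y : Node} {v : V} {p : ℝ}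
    (h : Tr (Lam Φ K) y (v, p)) : ‖v‖ ≤ 1 ∧ 0 ≤ p ∧ p ≤ 1 := by
  refine Tr.inv (fun x : V × ℝ => ‖x.1‖ ≤ 1 ∧ 0 ≤ x.2 ∧ x.2 ≤ 1) ?_ ?_ h
  · intro ι D f hf
    rw [ex_fst, ex_snd]
    exact ⟨ex_norm_le _ _ fun i hi => (hf i hi).1, ex_nonneg fun i hi => (hf i hi).2.1,
      ex_le_one fun i hi => (hf i hi).2.2⟩
  · rintro y ⟨v, p⟩ (⟨h, rfl⟩ | ⟨h, rfl⟩)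
    · exact ⟨h1 _ _ h, by simp, by simp⟩
    · exact ⟨h2 _ _ h, by simp, by simp⟩

/-- Projection to the account. -/
def accL (V : Type) [AddCommGroup V] [Module ℝ V] : V × ℝ →ₗ[ℝ] ℝ := LinearMap.snd ℝ V ℝ

theorem Ach.improve {Φ : Node → V → Prop} {y : Node} {v : V} {p : ℝ}
    (h : Tr (Lam Φ (Ach Φ)) y (v, p)) :
    ∃ p', (1 + p) / 2 ≤ p' ∧ Tr (Lam Φ (Ach Φ)) y (v, p') := by
  obtain ⟨p', h1, h2⟩ := Tr.acct (Λ' := Lam Φ (Ach Φ)) LinearMap.id ((1/2 : ℝ) • accL V) (1/2) (by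
    rintro y v p (⟨h, hp⟩ | ⟨h, hp⟩)
    · simp only at h hp
      subst hp
      exact ⟨1, by simp [accL]; norm_num, Tr.leaf (Or.inl ⟨h, rfl⟩)⟩
    · simp only at h hp
      subst hp
      obtain ⟨p', h1, h2⟩ := Ach.prog Φ y v h
      exact ⟨p', by simpa [accL] using h1, h2⟩) h
  refine ⟨p', ?_, h2⟩
  simp [accL] at h1
  linarith

theorem Ach.of_tr {Φ : Node → V → Prop} (hΦ : Bd Φ) {y : Node} {v : V} {p : ℝ}
    (h : Tr (Lam Φ (Ach Φ)) y (v, p)) : Ach Φ y v := by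
  refine ⟨fun y v => ∃ p, Tr (Lam Φ (Ach Φ)) y (v, p), ?_, ?_, p, h⟩
  · rintro y v ⟨p, h⟩
    exact (h.bounds hΦ (Ach.bd Φ)).1
  · rintro y v ⟨p, h⟩
    obtain ⟨p', h1, h2⟩ := Ach.improve h
    have := (h.bounds hΦ (Ach.bd Φ)).2.1
    refine ⟨p', by linarith, h2.mono fun y x hx => hx.mono (fun _ _ h => h) fun y v h => ?_⟩
    exact ⟨0, Tr.leaf (Or.inr ⟨h, rfl⟩)⟩

theorem Ach.halt {Φ : Node → V → Prop} (hΦ : Bd Φ) {y : Node} {v : V} (h : Φ y v) : Ach Φ y v :=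
  Ach.of_tr hΦ (Tr.leaf (Or.inl ⟨h, rfl⟩) : Tr _ y (v, (1:ℝ)))

theorem Ach.mix {Φ : Node → V → Prop} (hΦ : Bd Φ) {y : Node} {ι : Type} (D : FinDist ι)
    (f : ι → V) (h : ∀ i, D.toFun i ≠ 0 → Ach Φ y (f i)) : Ach Φ y (ex D f) := by
  have := Tr.mix (Λ := Lam Φ (Ach Φ)) (y := y) D (fun i => (f i, (0:ℝ)))
    (fun i hi => Tr.leaf (Or.inr ⟨h i hi, rfl⟩))
  rw [ex_mk] at this
  exact Ach.of_tr hΦ this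

theorem Ach.move {Φ : Node → V → Prop} (hΦ : Bd Φ) {Y : Tm} {β : Act} {ρ : FinDist Tm}
    {r r' : List Act} (f : Tm → V) (hs : Step Y β ρ) (hr : r = extTrace β ++ r')
    (h : ∀ B, ρ.toFun B ≠ 0 → Ach Φ (B, r') (f B)) : Ach Φ (Y, r) (ex ρ f) := by
  have := Tr.move (Λ := Lam Φ (Ach Φ)) (fun i => (f i, (0:ℝ))) hs hr
    (fun i hi => Tr.leaf (Or.inr ⟨h i hi, rfl⟩))
  rw [ex_mk] at this
  exact Ach.of_tr hΦ this

theorem Ach.high {Φ : Node → V → Prop} {y : Node} {v : V} (h : Ach Φ y v) (δ : ℝ) (hδ : 0 < δ) :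
    ∃ p, 1 - δ ≤ p ∧ Tr (Lam Φ (Ach Φ)) y (v, p) := by
  have key : ∀ k : ℕ, ∃ p, 1 - (1/2 : ℝ)^k ≤ p ∧ Tr (Lam Φ (Ach Φ)) y (v, p) := by
    intro k
    induction k with
    | zero => exact ⟨0, by simp, Tr.leaf (Or.inr ⟨h, rfl⟩)⟩
    | succ k ih =>
      obtain ⟨p, h1, h2⟩ := ih
      obtain ⟨p', h3, h4⟩ := Ach.improve h2
      refine ⟨p', ?_, h4⟩
      rw [pow_succ]
      linarith
  obtain ⟨k, hk⟩ := exists_pow_lt_of_lt_one hδ (show (1/2 : ℝ) < 1 by norm_num)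
  obtain ⟨p, h1, h2⟩ := key k
  exact ⟨p, by linarith, h2⟩

/-- Replacing leaves: a useful criterion for achievability. -/
theorem Ach.of_sub {Φ : Node → V → Prop} {Ψ : Node → V → Prop}
    (h : ∀ y v, Ψ y v → ∃ p, 3/4 ≤ p ∧ Tr (Lam Φ (Ach Ψ)) y (v, p)) {y : Node} {v : V}
    (hv : Ach Ψ y v) : Ach Φ y v := by
  refine ⟨Ach Ψ, Ach.bd Ψ, ?_, hv⟩
  intro y v hv
  obtain ⟨p, h1, h2⟩ := Ach.high hv (1/4) (by norm_num)
  obtain ⟨p', h3, h4⟩ := Tr.acct (Λ' := Lam Φ (Ach Ψ)) LinearMap.id ((3/4 : ℝ) • accL V) 0 (by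
    rintro y v p (⟨h', hp⟩ | ⟨h', hp⟩)
    · simp only at h' hp
      subst hp
      obtain ⟨p', h1, h2⟩ := h y v h'
      exact ⟨p', by simpa [accL] using h1, h2⟩
    · simp only at h' hp
      subst hp
      exact ⟨0, by simp [accL], Tr.leaf (Or.inr ⟨h', rfl⟩)⟩) h2
  refine ⟨p', ?_, h4⟩
  simp [accL] at h3
  linarith

theorem Ach.idem {Φ : Node → V → Prop} {Ψ : Node → V → Prop}
    (h : ∀ y v, Ψ y v → Ach Φ y v) {y : Node} {v : V} (hv : Ach Ψ y v) : Ach Φ y v := by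
  have hb : Bd (Ach Φ) := Ach.bd Φ
  have hv' : Ach (Ach Φ) y v := by
    obtain ⟨K, h1, h2, h3⟩ := hv
    refine ⟨K, h1, ?_, h3⟩
    intro y v hk
    obtain ⟨p, h4, h5⟩ := h2 y v hk
    exact ⟨p, h4, h5.mono fun y x hx => hx.mono h fun _ _ h => h⟩
  refine Ach.of_sub ?_ hv'
  intro y v hv
  obtain ⟨p, h1, h2⟩ := Ach.high hv (1/4) (by norm_num)
  refine ⟨p, by linarith, h2.mono fun y x hx => hx.mono (fun _ _ h => h) fun y v h => ?_⟩
  exact Ach.halt hb h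

theorem Ach.map {Φ : Node → V → Prop} {Ψ : Node → W → Prop} (T : V →ₗ[ℝ] W)
    (hT : ∀ v, ‖T v‖ ≤ ‖v‖) (h : ∀ y v, Φ y v → Ψ y (T v)) {y : Node} {v : V}
    (hv : Ach Φ y v) : Ach Ψ y (T v) := by
  refine ⟨fun y w => ∃ v, Ach Φ y v ∧ w = T v, ?_, ?_, v, hv, rfl⟩
  · rintro y w ⟨v, hv, rfl⟩
    exact (hT v).trans (Ach.bd Φ y v hv)
  · rintro y w ⟨v, hv, rfl⟩
    obtain ⟨p, h1, h2⟩ := Ach.prog Φ y v hv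
    obtain ⟨p', h3, h4⟩ := Tr.acct (Λ' := Lam Ψ (fun y w => ∃ v, Ach Φ y v ∧ w = T v)) T
      (accL V) 0 (by
      rintro y v p (⟨h', hp⟩ | ⟨h', hp⟩)
      · simp only at h' hp
        subst hp
        exact ⟨1, by simp [accL], Tr.leaf (Or.inl ⟨h y v h', rfl⟩)⟩
      · simp only at h' hp
        subst hp
        exact ⟨0, by simp [accL], Tr.leaf (Or.inr ⟨⟨v, h', rfl⟩, rfl⟩)⟩) h2
    refine ⟨p', ?_, h4⟩
    simp [accL] at h3
    linarith

/-- Upper bounds on achievable real values. -/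
theorem Ach.le {Φ : Node → ℝ → Prop} (hΦ : Bd Φ) {G : Node → ℝ} (hG0 : ∀ y, 0 ≤ G y)
    (hΦG : ∀ y v, Φ y v → v ≤ G y)
    (hG : ∀ Y β ρ r', Step Y β ρ → ex ρ (fun B => G (B, r')) ≤ G (Y, extTrace β ++ r'))
    {y : Node} {v : ℝ} (hv : Ach Φ y v) : v ≤ G y := by
  have key : ∀ k : ℕ, ∀ y v, Ach Φ y v → v ≤ G y + (1/2 : ℝ)^k := by
    intro k
    induction k with
    | zero =>
      intro y v hv
      have h1 := Ach.bd Φ y v hv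
      have h2 := hG0 y
      have h3 := le_abs_self v
      rw [Real.norm_eq_abs] at h1
      simp
      linarith
    | succ k ih =>
      intro y v hv
      obtain ⟨p, hp, ht⟩ := Ach.prog Φ y v hv
      have : ∀ y (x : ℝ × ℝ), Tr (Lam Φ (Ach Φ)) y x → x.1 ≤ G y + (1 - x.2) * (1/2 : ℝ)^k := by
        intro y x ht
        induction ht with
        | leaf h =>
          rename_i y x
          obtain ⟨v, p⟩ := x
          rcases h with ⟨h, hp⟩ | ⟨h, hp⟩
          · simp only at h hp
            subst hp
            simpa using hΦG _ _ h
          · simp only at h hp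
            subst hp
            simpa using ih _ _ h
        | @move Y β ρ r r' f hs hr _ ih' =>
          subst hr
          refine le_trans ?_ (add_le_add_left (hG Y β ρ r' hs) _)
          rw [ex_fst, ex_snd, ← ex_one_sub, mul_comm, ← smul_eq_mul, ← ex_smul, ← ex_add]
          exact ex_mono fun B hB => by
            have := ih' B hB
            rw [smul_eq_mul]
            linarith
        | @mix y ι D f _ ih' =>
          have h0 : G y = ex D (fun _ => G y) := (ex_const _ _).symm
          rw [h0, ex_fst, ex_snd, ← ex_one_sub, mul_comm, ← smul_eq_mul, ← ex_smul, ← ex_add]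
          exact ex_mono fun B hB => by
            have := ih' B hB
            rw [smul_eq_mul]
            linarith
      have h1 := this y (v, p) ht
      have h2 : (0:ℝ) ≤ (1/2)^k := by positivity
      simp only at h1
      rw [pow_succ]
      nlinarith
  apply le_of_forall_pos_le_add
  intro ε hε
  obtain ⟨k, hk⟩ := exists_pow_lt_of_lt_one hε (show (1/2 : ℝ) < 1 by norm_num)
  have := key k y v hv
  linarith

end AchSec

/-! ## Scheduler operators -/

section SchedSec

theorem ex_pt {α : Type} (μ : FinDist α) (P : α) (c : ℝ) [inst : ∀ a, Decidable (a = P)] :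
    ex μ (fun a => if a = P then c else 0) = μ.toFun P * c := by
  rw [ex_eq_sum _ _ (insert P μ.finite_support.toFinset)
    (fun a ha => Finset.mem_insert_of_mem (by simpa using ha)), Finset.sum_eq_single P]
  · simp
  · intro b _ hb
    simp [hb]
  · intro h
    exact absurd (Finset.mem_insert_self _ _) h

/-- Extending a fragment by a step. -/
def Frag.snoc (ω : Frag) (s : Act × Tm) : Frag := ⟨ω.head, ω.steps ++ [s]⟩

theorem Frag.snoc_last (ω : Frag) (s : Act × Tm) : (ω.snoc s).last = s.2 := by
  simp [Frag.snoc, Frag.last]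

theorem Frag.snoc_trace (ω : Frag) (s : Act × Tm) :
    (ω.snoc s).trace = ω.trace ++ extTrace s.1 := by
  unfold Frag.snoc Frag.trace extTrace
  by_cases h : s.1 = Act.tau <;> simp [h]

theorem Frag.snoc_inj {ω ω' : Frag} {s s' : Act × Tm} (h : ω.snoc s = ω'.snoc s') :
    ω = ω' ∧ s = s' := by
  unfold Frag.snoc at h
  injection h with h1 h2
  have h3 := List.append_inj' h2 rfl
  refine ⟨?_, by simpa using h3.2⟩
  cases ω; cases ω'
  simp only at h1 h3
  rw [h1, h3.1]

/-- The empty fragment. -/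
def rootF (A : Tm) : Frag := ⟨A, []⟩

theorem Frag.cases' (ω : Frag) : ω = rootF ω.head ∨ ∃ ω' s, ω = Frag.snoc ω' s := by
  obtain ⟨h, l⟩ := ω
  rcases List.eq_nil_or_concat l with rfl | ⟨l', s, rfl⟩
  · exact Or.inl rfl
  · refine Or.inr ⟨⟨h, l'⟩, s, ?_⟩
    simp [Frag.snoc]

theorem transProb_eq (σ : Sched) (ω : Frag) (α : Act) (B : Tm) :
    transProb σ ω α B = ex (σ ω) (fun o => o.elim (0:ℝ)
      (fun tr => if tr.val.2.1 = α then (tr.val.2.2).toFun B else 0)) := by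
  unfold transProb
  set F := (σ ω).finite_support.toFinset with hF
  have hinj : Set.InjOn (some : PTrans → Option PTrans) (some ⁻¹' (F : Set (Option PTrans))) :=
    fun a _ b _ h => Option.some.inj h
  rw [finsum_eq_sum_of_support_subset (s := F.preimage some hinj)]
  · rw [ex_eq_sum _ _ (insert none F) (fun a ha => Finset.mem_insert_of_mem (by simpa [hF] using ha))]
    symm
    rw [← Finset.sum_subset (s₁ := (F.preimage some hinj).map Function.Embedding.some)]
    · rw [Finset.sum_map]
      apply Finset.sum_congr rfl
      intro tr _
      simp
    · intro o ho
      simp only [Finset.mem_map, Finset.mem_preimage] at ho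
      obtain ⟨a, ha, rfl⟩ := ho
      exact Finset.mem_insert_of_mem ha
    · intro o ho hno
      rcases o with _ | tr
      · simp
      · exfalso
        apply hno
        simp only [Finset.mem_map, Finset.mem_preimage]
        refine ⟨tr, ?_, rfl⟩
        simpa using ho
  · intro tr htr
    simp only [Function.mem_support, ne_eq, ite_eq_right_iff, mul_eq_zero, not_forall, not_or] at htr
    simp [hF, htr.2.1]

theorem coneProb_root (A B : Tm) (σ : Sched) : coneProb A σ (rootF B) = if B = A then 1 else 0 := by
  simp [coneProb, rootF, coneProbAux]

theorem coneProb_snoc (A : Tm) (σ : Sched) (ω : Frag) (s : Act × Tm) :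
    coneProb A σ (ω.snoc s) = coneProb A σ ω * transProb σ ω s.1 s.2 := by
  simp [coneProb, Frag.snoc, coneProbAux]

variable {V : Type} [NormedAddCommGroup V] [NormedSpace ℝ V]

/-- Expected payoff of `h` when stopping within `n` decisions. -/
noncomputable def Wn (σ : Sched) (h : Frag → V) : ℕ → Frag → V
  | 0, _ => 0
  | n+1, ω => ex (σ ω) (fun o => o.elim (h ω)
      (fun tr => ex tr.val.2.2 (fun B => Wn σ h n (ω.snoc (tr.val.2.1, B)))))

/-- One step of the run process. -/
noncomputable def kap (σ : Sched) (x : Frag × Bool) : FinDist (Frag × Bool) :=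
  if x.2 then FinDist.dirac x else
    bindD (σ x.1) (fun o => o.elim (FinDist.dirac (x.1, true))
      (fun tr => tr.val.2.2.map (fun B => (x.1.snoc (tr.val.2.1, B), false))))

/-- The run process. -/
noncomputable def runD (A : Tm) (σ : Sched) : ℕ → FinDist (Frag × Bool)
  | 0 => FinDist.dirac (rootF A, false)
  | n+1 => bindD (runD A σ n) (kap σ)

theorem kap_true (σ : Sched) (x : Frag × Bool) (ω : Frag) : (kap σ x).toFun (ω, true) =
    (if x = (ω, true) then 1 else 0) + (if x = (ω, false) then (σ ω).toFun none else 0) := by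
  obtain ⟨ω', b⟩ := x
  unfold kap
  cases b
  · simp only [Bool.false_eq_true, if_false, bindD_toFun, Prod.mk.injEq, and_false, and_true,
      zero_add]
    have : ∀ o, (Option.elim o (FinDist.dirac (ω', true)) (fun tr : PTrans => tr.val.2.2.map
        (fun B => (ω'.snoc (tr.val.2.1, B), false)))).toFun (ω, true) =
        if o = none then (if ω' = ω then 1 else 0) else 0 := by
      intro o
      rcases o with _ | tr
      · simp [FinDist.dirac, eq_comm]
      · simp [map_toFun]
    simp only [this]
    rw [ex_pt]
    by_cases h : ω' = ω <;> simp [h]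
  · simp [FinDist.dirac, eq_comm]

theorem kap_false_root (σ : Sched) (x : Frag × Bool) (A : Tm) :
    (kap σ x).toFun (rootF A, false) = 0 := by
  obtain ⟨ω', b⟩ := x
  unfold kap
  cases b
  · simp only [Bool.false_eq_true, if_false, bindD_toFun]
    have : ∀ o, (Option.elim o (FinDist.dirac (ω', true)) (fun tr : PTrans => tr.val.2.2.map
        (fun B => (ω'.snoc (tr.val.2.1, B), false)))).toFun (rootF A, false) = 0 := by
      intro o
      rcases o with _ | tr
      · simp [FinDist.dirac]
      · simp [map_toFun, Frag.snoc, rootF]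
    simp only [this]
    rw [ex_const]
  · simp [FinDist.dirac]

theorem kap_false_snoc (σ : Sched) (x : Frag × Bool) (ω : Frag) (s : Act × Tm) :
    (kap σ x).toFun (ω.snoc s, false) =
      if x = (ω, false) then transProb σ ω s.1 s.2 else 0 := by
  obtain ⟨ω', b⟩ := x
  unfold kap
  cases b
  · simp only [Bool.false_eq_true, if_false, bindD_toFun]
    by_cases h : ω' = ω
    · subst h
      simp only [if_true]
      rw [transProb_eq]
      apply ex_congr
      intro o _
      rcases o with _ | tr
      · simp [FinDist.dirac]
      · simp only [Option.elim_some]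
        by_cases hs : tr.val.2.1 = s.1
        · rw [if_pos hs, toFun_eq_ex, ex_map, toFun_eq_ex]
          apply ex_congr
          intro B _
          congr 1
          apply propext
          constructor
          · intro h
            have := (Frag.snoc_inj (Prod.mk.inj h).1).2
            rw [← this]
          · rintro rfl
            rw [hs]
        · rw [if_neg hs]
          by_contra hne
          obtain ⟨B, _, h⟩ := map_toFun_ne hne
          have := (Frag.snoc_inj (Prod.mk.inj h).1).2
          exact hs (by rw [← this])
    · rw [if_neg (by simpa using h)]
      rw [← ex_const (σ ω') (0:ℝ)]
      apply ex_congr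
      intro o _
      rcases o with _ | tr
      · simp [FinDist.dirac]
      · by_contra hne
        obtain ⟨B, _, h'⟩ := map_toFun_ne hne
        exact h (Frag.snoc_inj (Prod.mk.inj h').1).1
  · simp [FinDist.dirac]

theorem runD_false (A : Tm) (σ : Sched) (n : ℕ) : ∀ ω, (runD A σ n).toFun (ω, false) =
    if ω.steps.length = n then coneProb A σ ω else 0 := by
  induction n with
  | zero =>
    intro ω
    rcases ω.cases' with h | ⟨ω', s, rfl⟩
    · rw [h, coneProb_root]
      simp [runD, FinDist.dirac, rootF]
    · simp [runD, FinDist.dirac, rootF, Frag.snoc]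
  | succ n ih =>
    intro ω
    show ex _ _ = _
    rcases ω.cases' with h | ⟨ω', s, rfl⟩
    · rw [h]
      simp only [kap_false_root, ex_const]
      simp [rootF]
    · simp only [kap_false_snoc]
      rw [ex_pt, ih, coneProb_snoc]
      by_cases h : ω'.steps.length = n <;> simp [Frag.snoc, h]

theorem runD_true (A : Tm) (σ : Sched) (n : ℕ) : ∀ ω, (runD A σ n).toFun (ω, true) =
    if ω.steps.length < n then fragProb A σ ω else 0 := by
  induction n with
  | zero =>
    intro ω
    simp [runD, FinDist.dirac]
  | succ n ih =>
    intro ω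
    show ex _ _ = _
    simp only [kap_true]
    rw [ex_add, ex_pt, ex_pt, ih, runD_false]
    rcases lt_trichotomy ω.steps.length n with h | h | h
    · simp [h, h.ne, Nat.lt_succ_of_lt h]
    · simp [h, fragProb]
    · have h1 : ¬ ω.steps.length < n := by omega
      have h2 : ¬ ω.steps.length = n := by omega
      have h3 : ¬ ω.steps.length < n + 1 := by omega
      simp [h1, h2, h3]

theorem ex_runD (A : Tm) (σ : Sched) (h : Frag → V) (n : ℕ) : ∀ k,
    ex (runD A σ n) (fun x => if x.2 then h x.1 else Wn σ h k x.1) = Wn σ h (n + k) (rootF A) := by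
  induction n with
  | zero => intro k; simp [runD, ex_dirac]
  | succ n ih =>
    intro k
    show ex (bindD _ _) _ = _
    rw [ex_bindD, show n + 1 + k = n + (k + 1) by omega, ← ih]
    apply ex_congr
    rintro ⟨ω, b⟩ _
    cases b
    · simp only [kap, Bool.false_eq_true, if_false, ex_bindD, Wn]
      apply ex_congr
      intro o _
      rcases o with _ | tr
      · simp [ex_dirac]
      · simp [ex_map]
    · simp [kap, ex_dirac]

theorem coneProb_nonneg (A : Tm) (σ : Sched) (ω : Frag) : 0 ≤ coneProb A σ ω := by
  have := runD_false A σ ω.steps.length ω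
  rw [if_pos rfl] at this
  rw [← this]
  exact FinDist.nonneg _ _

theorem fragProb_nonneg (A : Tm) (σ : Sched) (ω : Frag) : 0 ≤ fragProb A σ ω :=
  mul_nonneg (coneProb_nonneg A σ ω) (FinDist.nonneg _ _)

theorem sum_le_one {α : Type} (μ : FinDist α) (s : Finset α) : ∑ a ∈ s, μ.toFun a ≤ 1 := by
  rw [← sum_toFun μ (s ∪ μ.finite_support.toFinset)
    (fun a ha => Finset.mem_union_right _ (by simpa using ha))]
  exact Finset.sum_le_sum_of_subset_of_nonneg Finset.subset_union_left fun a _ _ => μ.nonneg a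

theorem fragProb_sum_le (A : Tm) (σ : Sched) (s : Finset Frag) :
    ∑ ω ∈ s, fragProb A σ ω ≤ 1 := by
  set n := s.sup (fun ω => ω.steps.length) + 1
  have : ∑ ω ∈ s, fragProb A σ ω = ∑ x ∈ s.map ⟨fun ω => (ω, true), fun a b h => (Prod.mk.inj h).1⟩,
      (runD A σ n).toFun x := by
    rw [Finset.sum_map]
    apply Finset.sum_congr rfl
    intro ω hω
    show _ = (runD A σ n).toFun (ω, true)
    rw [runD_true, if_pos]
    exact Nat.lt_succ_of_le (Finset.le_sup (f := fun ω : Frag => ω.steps.length) hω)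
  rw [this]
  exact sum_le_one _ _

theorem fragProb_summable (A : Tm) (σ : Sched) : Summable (fragProb A σ) :=
  summable_of_sum_le (fragProb_nonneg A σ) (fragProb_sum_le A σ)

theorem Wn_root (A : Tm) (σ : Sched) (h : Frag → V) (n : ℕ) :
    Wn σ h n (rootF A) = ∑' ω, (if ω.steps.length < n then fragProb A σ ω else 0) • h ω := by
  have := ex_runD A σ h n 0
  rw [add_zero] at this
  rw [← this]
  simp only [Wn]
  set F := (runD A σ n).finite_support.toFinset with hF
  have hinj : Set.InjOn (fun ω : Frag => (ω, true)) ((fun ω : Frag => (ω, true)) ⁻¹' (F : Set (Frag × Bool))) :=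
    fun a _ b _ h => (Prod.mk.inj h).1
  rw [tsum_eq_sum (s := F.preimage (fun ω : Frag => (ω, true)) hinj)]
  · symm
    unfold ex
    rw [← Finset.sum_subset (s₁ := (F.preimage _ hinj).map
      ⟨fun ω => (ω, true), fun a b h => (Prod.mk.inj h).1⟩)]
    · rw [Finset.sum_map]
      apply Finset.sum_congr rfl
      intro ω _
      show _ = (runD A σ n).toFun (ω, true) • (if true = true then h ω else 0)
      simp only [runD_true, if_true]
    · intro x hx
      simp only [Finset.mem_map, Finset.mem_preimage] at hx
      obtain ⟨a, ha, rfl⟩ := hx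
      exact ha
    · rintro ⟨ω, b⟩ ho hno
      cases b
      · simp
      · exfalso
        apply hno
        simp only [Finset.mem_map, Finset.mem_preimage]
        exact ⟨ω, ho, rfl⟩
  · intro ω hω
    rw [← runD_true]
    simp only [Finset.mem_preimage, hF, Set.Finite.mem_toFinset, Function.mem_support, not_not] at hω
    rw [hω, zero_smul]

theorem Wn_tendsto_root [CompleteSpace V] (A : Tm) (σ : Sched) (h : Frag → V)
    (hh : ∀ ω, ‖h ω‖ ≤ 1) :
    Filter.Tendsto (fun n => Wn σ h n (rootF A)) Filter.atTop
      (nhds (∑' ω, fragProb A σ ω • h ω)) := by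
  simp only [Wn_root]
  apply tendsto_tsum_of_dominated_convergence (fragProb_summable A σ)
  · intro ω
    apply tendsto_const_nhds.congr'
    filter_upwards [Filter.eventually_gt_atTop ω.steps.length] with n hn
    rw [if_pos hn]
  · filter_upwards with n ω
    rw [norm_smul]
    have h0 := fragProb_nonneg A σ ω
    calc _ ≤ ‖(if ω.steps.length < n then fragProb A σ ω else 0)‖ * 1 := by
          gcongr
          exact hh ω
      _ ≤ _ := by
          rw [mul_one]
          split_ifs
          · rw [Real.norm_of_nonneg h0]
          · simpa using h0

/-- Termination probability within `n` decisions. -/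
noncomputable def an (σ : Sched) (n : ℕ) (ω : Frag) : ℝ := Wn σ (fun _ => (1:ℝ)) n ω

theorem an_succ (σ : Sched) (n : ℕ) (ω : Frag) : an σ (n+1) ω = ex (σ ω) (fun o => o.elim (1:ℝ)
      (fun tr => ex tr.val.2.2 (fun B => an σ n (ω.snoc (tr.val.2.1, B))))) := rfl

theorem an_bounds (σ : Sched) (n : ℕ) : ∀ ω, 0 ≤ an σ n ω ∧ an σ n ω ≤ 1 := by
  induction n with
  | zero => intro ω; simp [an, Wn]
  | succ n ih =>
    intro ω
    rw [an_succ]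
    constructor
    · apply ex_nonneg
      rintro (_ | tr) _
      · simp
      · exact ex_nonneg fun B _ => (ih _).1
    · apply ex_le_one
      rintro (_ | tr) _
      · simp
      · exact ex_le_one fun B _ => (ih _).2

theorem norm_ex_le' {α : Type} (μ : FinDist α) (f : α → V) (g : α → ℝ)
    (h : ∀ a, μ.toFun a ≠ 0 → ‖f a‖ ≤ g a) : ‖ex μ f‖ ≤ ex μ g :=
  (norm_ex_le μ f).trans (ex_mono h)

theorem Wn_diff (σ : Sched) (h : Frag → V) (hh : ∀ ω, ‖h ω‖ ≤ 1) (n : ℕ) :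
    ∀ m ω, n ≤ m → ‖Wn σ h m ω - Wn σ h n ω‖ ≤ an σ m ω - an σ n ω := by
  have h0 : ∀ m ω, ‖Wn σ h m ω‖ ≤ an σ m ω := by
    intro m
    induction m with
    | zero => intro ω; simp [an, Wn]
    | succ n ih =>
      intro ω
      rw [an_succ]
      apply norm_ex_le'
      rintro (_ | tr) _
      · exact hh ω
      · exact norm_ex_le' _ _ _ fun B _ => ih _
  induction n with
  | zero =>
    intro m ω _
    simpa [Wn, an] using h0 m ω
  | succ n ih =>
    intro m ω hm
    obtain ⟨m, rfl⟩ : ∃ m', m = m' + 1 := ⟨m - 1, by omega⟩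
    rw [an_succ, an_succ, Wn, Wn, ← ex_sub, ← ex_sub]
    apply norm_ex_le'
    rintro (_ | tr) _
    · simp
    · simp only [Option.elim_some]
      rw [← ex_sub, ← ex_sub]
      exact norm_ex_le' _ _ _ fun B _ => ih _ _ (by omega)

theorem an_mono (σ : Sched) (ω : Frag) : Monotone (fun n => an σ n ω) := by
  intro n m h
  have := Wn_diff σ (fun _ => (1:ℝ)) (by simp) n m ω h
  have h2 := norm_nonneg (Wn σ (fun _ => (1:ℝ)) m ω - Wn σ (fun _ => (1:ℝ)) n ω)
  simp only
  linarith

theorem an_tendsto (σ : Sched) (ω : Frag) : ∃ a, Filter.Tendsto (fun n => an σ n ω) Filter.atTop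
    (nhds a) ∧ a ≤ 1 ∧ ∀ n, an σ n ω ≤ a := by
  have hb : BddAbove (Set.range (fun n => an σ n ω)) :=
    ⟨1, by rintro _ ⟨n, rfl⟩; exact (an_bounds σ n ω).2⟩
  exact ⟨_, tendsto_atTop_ciSup (an_mono σ ω) hb, ciSup_le fun n => (an_bounds σ n ω).2,
    fun n => le_ciSup hb n⟩

theorem Wn_lim [CompleteSpace V] (σ : Sched) (h : Frag → V) (hh : ∀ ω, ‖h ω‖ ≤ 1) (ω : Frag) :
    ∃ w, Filter.Tendsto (fun n => Wn σ h n ω) Filter.atTop (nhds w) := by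
  obtain ⟨a, ha, _, hle⟩ := an_tendsto σ ω
  apply cauchySeq_tendsto_of_complete
  apply cauchySeq_of_le_tendsto_0' (fun n => a - an σ n ω)
  · intro n m hnm
    rw [dist_comm, dist_eq_norm]
    have := Wn_diff σ h hh n m ω hnm
    have := hle m
    linarith
  · simpa using ha.const_sub a

end SchedSec

/-! ## From weak combined transitions to achievable values -/

section WeakToAch

theorem ex_eq_one {α : Type} {μ : FinDist α} {f : α → ℝ} (h : ∀ a, μ.toFun a ≠ 0 → f a ≤ 1)
    (h1 : ex μ f = 1) : ∀ a, μ.toFun a ≠ 0 → f a = 1 := by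
  intro a ha
  have h0 : ex μ (fun a => 1 - f a) = 0 := by rw [ex_one_sub, h1, sub_self]
  unfold ex at h0
  rw [Finset.sum_eq_zero_iff_of_nonneg] at h0
  · have := h0 a (by simpa using ha)
    rw [smul_eq_mul, mul_eq_zero] at this
    rcases this with h | h
    · exact absurd h ha
    · linarith
  · intro b hb
    have hb' : μ.toFun b ≠ 0 := by simpa using hb
    have := h b hb'
    rw [smul_eq_mul]
    exact mul_nonneg (μ.nonneg b) (by linarith)

theorem exists_supp {α : Type} (μ : FinDist α) : ∃ a, μ.toFun a ≠ 0 := by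
  by_contra h
  push Not at h
  have := sum_toFun μ ∅ (fun a ha => absurd (h a) ha)
  simp at this

theorem ex_ne_zero {α : Type} {μ : FinDist α} {f : α → ℝ} (h : ex μ f ≠ 0) :
    ∃ a, μ.toFun a ≠ 0 ∧ f a ≠ 0 := by
  by_contra hc
  push Not at hc
  apply h
  rw [← ex_const μ (0:ℝ)]
  exact ex_congr hc

theorem ex_pos_of {α : Type} {μ : FinDist α} {f : α → ℝ} (h : ∀ a, 0 ≤ f a) {a : α}
    (ha : μ.toFun a ≠ 0) (hf : 0 < f a) : 0 < ex μ f := by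
  unfold ex
  apply Finset.sum_pos'
  · intro b _
    exact mul_nonneg (μ.nonneg b) (h b)
  · exact ⟨a, by simpa using ha, mul_pos (toFun_pos ha) hf⟩

/-- Reachable fragments. -/
inductive Reach (A : Tm) (σ : Sched) : Frag → Prop
  | root : Reach A σ (rootF A)
  | step {ω : Frag} {tr : PTrans} {B : Tm} : Reach A σ ω → (σ ω).toFun (some tr) ≠ 0 →
      (tr.val.2.2).toFun B ≠ 0 → Reach A σ (ω.snoc (tr.val.2.1, B))

theorem Reach.cone {A : Tm} {σ : Sched} {ω : Frag} (h : Reach A σ ω) : 0 < coneProb A σ ω := by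
  induction h with
  | root => simp [coneProb_root]
  | @step ω tr B _ h1 h2 ih =>
    rw [coneProb_snoc]
    apply mul_pos ih
    rw [transProb_eq]
    refine ex_pos_of ?_ h1 ?_
    · rintro (_ | tr)
      · simp
      · simp only [Option.elim_some]
        split_ifs
        · exact FinDist.nonneg _ _
        · exact le_refl _
    · simpa using toFun_pos h2

theorem Reach.of_cone {A : Tm} {σ : Sched} (n : ℕ) : ∀ ω : Frag, ω.steps.length = n →
    coneProb A σ ω ≠ 0 → Reach A σ ω := by
  induction n with
  | zero =>
    intro ω hn h
    rcases ω.cases' with h' | ⟨ω', s, rfl⟩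
    · rw [h', coneProb_root] at h
      have : ω.head = A := by
        by_contra hne
        simp [hne] at h
      rw [h', this]
      exact Reach.root
    · simp [Frag.snoc] at hn
  | succ n ih =>
    intro ω hn h
    rcases ω.cases' with h' | ⟨ω', s, rfl⟩
    · rw [h'] at hn
      simp [rootF] at hn
    · rw [coneProb_snoc] at h
      have h1 := left_ne_zero_of_mul h
      have h2 := right_ne_zero_of_mul h
      rw [transProb_eq] at h2
      obtain ⟨o, ho, hf⟩ := ex_ne_zero h2
      rcases o with _ | tr
      · simp at hf
      · simp only [Option.elim_some, ne_eq, ite_eq_right_iff, not_forall] at hf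
        obtain ⟨hs, hf⟩ := hf
        have := Reach.step (ih ω' (by simpa [Frag.snoc] using hn) h1) ho hf
        rwa [hs] at this

theorem Reach.of_frag {A : Tm} {σ : Sched} {ω : Frag} (h : fragProb A σ ω ≠ 0) :
    Reach A σ ω ∧ (σ ω).toFun none ≠ 0 :=
  ⟨Reach.of_cone _ ω rfl (left_ne_zero_of_mul h), right_ne_zero_of_mul h⟩

variable {V : Type} [NormedAddCommGroup V] [NormedSpace ℝ V]

theorem Wlim_fix {σ : Sched} {h : Frag → V} {Wl : Frag → V}
    (hW : ∀ ω, Filter.Tendsto (fun n => Wn σ h n ω) Filter.atTop (nhds (Wl ω))) (ω : Frag) :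
    Wl ω = ex (σ ω) (fun o => o.elim (h ω)
      (fun tr => ex tr.val.2.2 (fun B => Wl (ω.snoc (tr.val.2.1, B))))) := by
  refine tendsto_nhds_unique ((Filter.tendsto_add_atTop_iff_nat 1).mpr (hW ω)) ?_
  simp only [Wn]
  apply tendsto_ex
  rintro (_ | tr) _
  · exact tendsto_const_nhds
  · exact tendsto_ex _ _ _ fun B _ => hW _

theorem Reach.term {A : Tm} {σ : Sched} (h1 : HasSum (fun ω => fragProb A σ ω) 1) {ω : Frag}
    (h : Reach A σ ω) : Filter.Tendsto (fun n => an σ n ω) Filter.atTop (nhds 1) := by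
  have hl := fun ω => an_tendsto σ ω
  choose a ha hle _ using hl
  suffices a ω = 1 by
    rw [← this]
    exact ha ω
  induction h with
  | root =>
    refine tendsto_nhds_unique (ha _) ?_
    have := Wn_tendsto_root A σ (fun _ => (1:ℝ)) (by simp)
    simp only [smul_eq_mul, mul_one, h1.tsum_eq] at this
    exact this
  | @step ω tr B _ hs hB ih =>
    have hfix := Wlim_fix (σ := σ) (h := fun _ => (1:ℝ)) ha ω
    rw [ih] at hfix
    have h2 := ex_eq_one (by
      rintro (_ | tr) _
      · simp
      · exact ex_le_one fun B _ => hle _) hfix.symm (some tr) hs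
    exact ex_eq_one (fun B _ => hle _) h2 B hB

theorem remaining {A : Tm} {σ : Sched} {t : List Act}
    (ht : ∀ ω : Frag, fragProb A σ ω ≠ 0 → ω.trace = t) (n : ℕ) : ∀ ω, Reach A σ ω →
    an σ n ω ≠ 0 → ∃ s, ω.trace ++ s = t := by
  induction n with
  | zero => intro ω _ h; simp [an, Wn] at h
  | succ n ih =>
    intro ω hω h
    rw [an_succ] at h
    obtain ⟨o, ho, hf⟩ := ex_ne_zero h
    rcases o with _ | tr
    · exact ⟨[], by
        rw [List.append_nil]
        exact ht ω (mul_ne_zero hω.cone.ne' ho)⟩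
    · obtain ⟨B, hB, hf⟩ := ex_ne_zero hf
      obtain ⟨s, hs⟩ := ih _ (Reach.step hω ho hB) hf
      rw [Frag.snoc_trace, List.append_assoc] at hs
      exact ⟨_, hs⟩

/-- Regrouping by last states. -/
theorem last_regroup [CompleteSpace V] {A : Tm} {σ : Sched} {ρ : Tm → ℝ}
    (hρ : ∀ B : Tm, HasSum (fun ω : Frag => if ω.last = B then fragProb A σ ω else 0) (ρ B))
    (φ : Tm → V) (hφ : ∀ Z, ‖φ Z‖ ≤ 1) :
    HasSum (fun B => ρ B • φ B) (∑' ω, fragProb A σ ω • φ ω.last) := by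
  have hs : Summable (fun ω => fragProb A σ ω • φ ω.last) := by
    apply Summable.of_norm_bounded (fragProb_summable A σ)
    intro ω
    rw [norm_smul, Real.norm_of_nonneg (fragProb_nonneg A σ ω)]
    exact mul_le_of_le_one_right (fragProb_nonneg A σ ω) (hφ _)
  have := hs.hasSum.tsum_fiberwise (fun ω : Frag => ω.last)
  convert this using 2 with B
  rw [← (hρ B).tsum_eq, tsum_subtype (f := fun ω => fragProb A σ ω • φ ω.last),
    ← Summable.tsum_smul_const (hρ B).summable]
  apply tsum_congr
  intro ω
  by_cases h : ω.last = B
  · simp [Set.indicator, h]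
  · simp [Set.indicator, h]

theorem weak_ach [CompleteSpace V] {Y : Tm} {β : Act} {ρ : CDist Tm} (hw : WeakCombined Y β ρ)
    {Φ : Node → V → Prop} (hΦ : Bd Φ) {r' : List Act} (φ : Tm → V) (hφ1 : ∀ Z, ‖φ Z‖ ≤ 1)
    (hφ : ∀ Z, ρ.toFun Z ≠ 0 → Φ (Z, r') (φ Z)) :
    Ach Φ (Y, extTrace β ++ r') (∑' Z, ρ.toFun Z • φ Z) := by
  obtain ⟨σ, hv, h1, ht, hl⟩ := hw
  have hW := fun ω => Wn_lim σ (fun ω : Frag => φ ω.last) (fun ω => hφ1 _) ω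
  choose Wl hWl using hW
  have hroot : (∑' Z, ρ.toFun Z • φ Z) = Wl (rootF Y) := by
    rw [(last_regroup hl φ hφ1).tsum_eq]
    exact tendsto_nhds_unique (Wn_tendsto_root Y σ (fun ω : Frag => φ ω.last) (fun ω => hφ1 _))
      (hWl _)
  have hhalt : ∀ ω, Reach Y σ ω → (σ ω).toFun none ≠ 0 →
      ω.trace = extTrace β ∧ Φ (ω.last, r') (φ ω.last) := by
    intro ω hω hn
    have hf : fragProb Y σ ω ≠ 0 := mul_ne_zero hω.cone.ne' hn
    refine ⟨ht ω hf, hφ _ ?_⟩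
    have hle := le_hasSum (hl ω.last) ω (by
      intro j _
      split_ifs
      · exact fragProb_nonneg _ _ _
      · exact le_refl _)
    rw [if_pos rfl] at hle
    have := lt_of_le_of_ne (fragProb_nonneg Y σ ω) hf.symm
    linarith
  have hrem : ∀ ω, Reach Y σ ω → ∃ s, ω.trace ++ s = extTrace β := by
    intro ω hω
    have := (hω.term h1).eventually (lt_mem_nhds (show (0:ℝ) < 1 by norm_num))
    obtain ⟨n, hn⟩ := this.exists
    exact remaining ht n ω hω hn.ne'
  set K : Node → V → Prop := fun y v => ∃ ω s, Reach Y σ ω ∧ ω.trace ++ s = extTrace β ∧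
    y = (ω.last, s ++ r') ∧ v = Wl ω with hK
  have hTr : ∀ n ω s, Reach Y σ ω → ω.trace ++ s = extTrace β →
      Tr (Lam Φ K) (ω.last, s ++ r') (Wl ω, an σ n ω) := by
    intro n
    induction n with
    | zero =>
      intro ω s hω hs
      exact Tr.leaf (Or.inr ⟨⟨ω, s, hω, hs, rfl, rfl⟩, by simp [an, Wn]⟩)
    | succ n ih =>
      intro ω s hω hs
      rw [Wlim_fix hWl ω, an_succ, ← ex_mk]
      apply Tr.mix
      rintro (_ | tr) ho
      · obtain ⟨h2, h3⟩ := hhalt ω hω ho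
        have : s = [] := by simpa [h2] using hs
        subst this
        exact Tr.leaf (Or.inl ⟨h3, rfl⟩)
      · simp only [Option.elim_some]
        rw [← ex_mk]
        have hlast := hv ω tr ho
        obtain ⟨⟨T, β', ρ'⟩, hst⟩ := tr
        simp only at hlast hst
        subst hlast
        simp only
        obtain ⟨B0, hB0⟩ := exists_supp ρ'
        obtain ⟨s', hs'⟩ := hrem _ (Reach.step (B := B0) hω ho hB0)
        rw [Frag.snoc_trace, ← hs, List.append_assoc] at hs'
        simp only [List.append_cancel_left_eq] at hs'
        refine Tr.move (r' := s' ++ r') _ hst (by rw [← hs', List.append_assoc]) ?_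
        intro B hB
        have := ih _ s' (Reach.step (B := B) hω ho hB) (by
          rw [Frag.snoc_trace, ← hs, List.append_assoc, ← hs'])
        rwa [Frag.snoc_last] at this
  refine ⟨K, ?_, ?_, rootF Y, extTrace β, Reach.root, by simp [Frag.trace, rootF],
    by simp [Frag.last, rootF], hroot⟩
  · rintro y v ⟨ω, s, hω, _, _, rfl⟩
    refine le_of_tendsto (hWl ω).norm (Filter.Eventually.of_forall fun n => ?_)
    have := Wn_diff σ (fun ω : Frag => φ ω.last) (fun ω => hφ1 _) 0 n ω (Nat.zero_le _)
    have h2 := (an_bounds σ n ω).2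
    simp only [Wn, an, sub_zero] at this h2
    linarith
  · rintro y v ⟨ω, s, hω, hs, rfl, rfl⟩
    have := (hω.term h1).eventually (lt_mem_nhds (show (1/2:ℝ) < 1 by norm_num))
    obtain ⟨n, hn⟩ := this.exists
    exact ⟨_, hn.le, hTr n ω s hω hs⟩

end WeakToAch

/-! ## Class averaging and transfer along weak bisimulations -/

section Transfer

variable {V : Type} [NormedAddCommGroup V] [NormedSpace ℝ V]

theorem cmass_eq_ex (ρ : FinDist Tm) (s : Set Tm) :
    cmass ρ.toFun s = ex ρ (fun B => if B ∈ s then (1:ℝ) else 0) := by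
  unfold cmass ex
  rw [tsum_subtype, tsum_eq_sum (s := ρ.finite_support.toFinset)]
  · apply Finset.sum_congr rfl
    intro B _
    simp [Set.indicator]
  · intro B hB
    have : ρ.toFun B = 0 := by simpa using hB
    simp [Set.indicator, this]

theorem cmass_hasSum (ρ : CDist Tm) (s : Set Tm) :
    HasSum (fun B => if B ∈ s then ρ.toFun B else 0) (cmass ρ.toFun s) := by
  unfold cmass
  rw [tsum_subtype]
  have := (ρ.hasSum_one.summable.indicator s).hasSum
  have e : (fun B => if B ∈ s then ρ.toFun B else 0) = s.indicator ρ.toFun := by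
    funext B
    simp [Set.indicator]
  rw [e]
  exact this

/-- Conditioning on a set of positive mass. -/
noncomputable def condD (ρ : FinDist Tm) (s : Set Tm)
    (h : 0 < ex ρ (fun B => if B ∈ s then (1:ℝ) else 0)) : FinDist Tm where
  toFun := fun B => if B ∈ s then ρ.toFun B / ex ρ (fun B => if B ∈ s then (1:ℝ) else 0) else 0
  nonneg := by
    intro B
    split_ifs
    · exact div_nonneg (ρ.nonneg B) h.le
    · exact le_refl _
  finite_support := by
    apply ρ.finite_support.subset
    intro B hB
    rw [Function.mem_support] at hB ⊢
    intro h0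
    simp [h0] at hB
  sum_one := by
    rw [finsum_eq_sum_of_support_subset (s := ρ.finite_support.toFinset)]
    · have : ∀ B, (if B ∈ s then ρ.toFun B / ex ρ (fun B => if B ∈ s then (1:ℝ) else 0) else 0)
          = (ρ.toFun B • (if B ∈ s then (1:ℝ) else 0)) /
            ex ρ (fun B => if B ∈ s then (1:ℝ) else 0) := by
        intro B
        split_ifs <;> simp
      simp only [this]
      rw [← Finset.sum_div]
      exact div_self h.ne'
    · intro B hB
      rw [Function.mem_support] at hB
      simp only [Set.Finite.coe_toFinset, Function.mem_support]
      intro h0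
      simp [h0] at hB

theorem avg_exists {E : Tm → Tm → Prop} (hE : Equivalence E) {ρ : FinDist Tm} {ρ' : CDist Tm}
    (h : EqLiftC E ρ.toFun ρ'.toFun) : ∃ κ : Tm → FinDist Tm,
      (∀ Z B, ρ'.toFun Z ≠ 0 → (κ Z).toFun B ≠ 0 → ρ.toFun B ≠ 0 ∧ E B Z) ∧
      (∀ f : Tm → V, HasSum (fun Z => ρ'.toFun Z • ex (κ Z) f) (ex ρ f)) := by
  set m : Tm → ℝ := fun P => ex ρ (fun B => if B ∈ {Q | E P Q} then (1:ℝ) else 0) with hm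
  have hmc : ∀ P, HasSum (fun B => if B ∈ {Q | E P Q} then ρ'.toFun B else 0) (m P) := by
    intro P
    have := cmass_hasSum ρ' {Q | E P Q}
    rwa [← h P, cmass_eq_ex] at this
  have hmpos : ∀ Z, ρ'.toFun Z ≠ 0 → 0 < m Z := by
    intro Z hZ
    have hle := le_hasSum (hmc Z) Z (by
      intro j _
      split_ifs
      · exact ρ'.nonneg j
      · exact le_refl _)
    rw [if_pos (show Z ∈ {Q | E Z Q} from hE.refl Z)] at hle
    exact lt_of_lt_of_le (lt_of_le_of_ne (ρ'.nonneg Z) hZ.symm) hle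
  have hmpos' : ∀ B, ρ.toFun B ≠ 0 → m B ≠ 0 := by
    intro B hB
    refine (ex_pos_of ?_ hB ?_).ne'
    · intro a
      split_ifs <;> norm_num
    · rw [if_pos (show B ∈ {Q | E B Q} from hE.refl B)]
      norm_num
  have hmE : ∀ A B, E A B → m A = m B := by
    intro A B hAB
    simp only [hm]
    apply ex_congr
    intro C _
    congr 1
    apply propext
    exact ⟨fun h => hE.trans (hE.symm hAB) h, fun h => hE.trans hAB h⟩
  refine ⟨fun Z => if hZ : 0 < m Z then condD ρ {Q | E Z Q} hZ else FinDist.dirac Z, ?_, ?_⟩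
  · intro Z B hZ hB
    simp only [dif_pos (hmpos Z hZ), condD] at hB
    by_cases hBZ : B ∈ {Q | E Z Q}
    · rw [if_pos hBZ] at hB
      exact ⟨fun h0 => by simp [h0] at hB, hE.symm hBZ⟩
    · rw [if_neg hBZ] at hB
      exact absurd rfl hB
  · intro f
    have h1 : ∀ Z, ρ'.toFun Z • ex (if hZ : 0 < m Z then condD ρ {Q | E Z Q} hZ
        else FinDist.dirac Z) f = ∑ B ∈ ρ.finite_support.toFinset,
          (if Z ∈ {Q | E B Q} then ρ'.toFun Z else 0) • ((ρ.toFun B / m B) • f B) := by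
      intro Z
      by_cases hZ : ρ'.toFun Z = 0
      · simp [hZ]
      · rw [dif_pos (hmpos Z hZ), ex_eq_sum _ _ ρ.finite_support.toFinset, Finset.smul_sum]
        · apply Finset.sum_congr rfl
          intro B _
          simp only [condD]
          by_cases hBZ : E Z B
          · rw [if_pos (show B ∈ {Q | E Z Q} from hBZ),
              if_pos (show Z ∈ {Q | E B Q} from hE.symm hBZ), ← hmE Z B hBZ]
          · rw [if_neg (show B ∉ {Q | E Z Q} from hBZ),
              if_neg (show Z ∉ {Q | E B Q} from fun h => hBZ (hE.symm h))]
            simp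
        · intro B hB
          simp only [Set.Finite.mem_toFinset, Function.mem_support]
          intro h0
          simp [condD, h0] at hB
    simp only [h1]
    unfold ex
    apply hasSum_sum
    intro B hB
    have hB' : ρ.toFun B ≠ 0 := by simpa using hB
    have := (hmc B).smul_const ((ρ.toFun B / m B) • f B)
    convert this using 1
    rw [smul_smul, mul_div_cancel₀ _ (hmpos' B hB')]

theorem weak_match [CompleteSpace V] {E : Tm → Tm → Prop} (hE : IsWeakBisim E) {X Y : Tm}
    (hXY : E X Y) {β : Act} {ρ : FinDist Tm} (hs : Step X β ρ) {Φ : Node → V → Prop} (hΦ : Bd Φ)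
    {r' : List Act} (f : Tm → V) (hf : ∀ B, ρ.toFun B ≠ 0 → ‖f B‖ ≤ 1)
    (h : ∀ Z (D : FinDist Tm), (∀ B, D.toFun B ≠ 0 → ρ.toFun B ≠ 0 ∧ E B Z) →
      Φ (Z, r') (ex D f)) :
    Ach Φ (Y, extTrace β ++ r') (ex ρ f) := by
  obtain ⟨ρ', hw, hl⟩ := hE.2 X Y hXY β ρ hs
  obtain ⟨κ, h1, h2⟩ := avg_exists (V := V) hE.1 hl
  set f0 : Tm → V := fun B => if ρ.toFun B ≠ 0 then f B else 0 with hf0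
  have hf1 : ∀ B, ‖f0 B‖ ≤ 1 := by
    intro B
    simp only [hf0]
    split_ifs with hB
    · exact hf B hB
    · simp
  have e1 : ex ρ f = ex ρ f0 := ex_congr fun B hB => by simp only [hf0]; rw [if_pos hB]
  rw [e1, ← (h2 f0).tsum_eq]
  apply weak_ach hw hΦ (fun Z => ex (κ Z) f0) (fun Z => ex_norm_le _ _ fun B _ => hf1 B)
  intro Z hZ
  have : ex (κ Z) f0 = ex (κ Z) f := ex_congr fun B hB => by
    simp only [hf0]; rw [if_pos (h1 Z B hZ hB).1]
  simp only [this]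
  exact h Z (κ Z) (fun B hB => h1 Z B hZ hB)

theorem ach_transfer [CompleteSpace V] {E : Tm → Tm → Prop} (hE : IsWeakBisim E)
    {Φ : Node → V → Prop} (hΦ : Bd Φ)
    (hinv : ∀ X Y r v, E X Y → Φ (X, r) v → Φ (Y, r) v) {X Y : Tm} {r : List Act} {v : V}
    (hXY : E X Y) (h : Ach Φ (X, r) v) : Ach Φ (Y, r) v := by
  set Ψ : Node → V → Prop := fun y v => ∃ X, E X y.1 ∧ Ach Φ (X, y.2) v with hΨ
  have hΨb : Bd Ψ := by
    rintro y v ⟨X, _, h⟩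
    exact Ach.bd Φ _ _ h
  have hΦΨ : ∀ y v, Φ y v → Ψ y v := fun y v h => ⟨y.1, hE.1.refl _, Ach.halt hΦ h⟩
  have hTΨ : ∀ y v p, Tr (Lam Φ (Ach Ψ)) y (v, p) → Ach Ψ y v := by
    intro y v p h
    exact Ach.of_tr hΨb (h.mono fun y x hx => hx.mono hΦΨ fun _ _ h => h)
  have sub : ∀ y x, Tr (Lam Φ (Ach Φ)) y x → ∀ Y, E y.1 Y → ∀ δ : ℝ, 0 < δ →
      ∃ p', x.2 - δ ≤ p' ∧ Tr (Lam Φ (Ach Ψ)) (Y, y.2) (x.1, p') := by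
    intro y x ht
    induction ht with
    | @leaf y x hl =>
      obtain ⟨X, r⟩ := y
      obtain ⟨v, p⟩ := x
      intro Y hY δ hδ
      rcases hl with ⟨h, hp⟩ | ⟨h, hp⟩
      · simp only at h hp hY
        subst hp
        exact ⟨1, by simp; linarith, Tr.leaf (Or.inl ⟨hinv _ _ _ _ hY h, rfl⟩)⟩
      · simp only at h hp hY
        subst hp
        exact ⟨0, by simp; linarith, Tr.leaf (Or.inr ⟨Ach.halt hΨb ⟨X, hY, h⟩, rfl⟩)⟩
    | @mix y ι D f _ ih =>
      intro Y hY δ hδ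
      have : ∀ i, ∃ p', D.toFun i ≠ 0 → (f i).2 - δ ≤ p' ∧
          Tr (Lam Φ (Ach Ψ)) (Y, y.2) ((f i).1, p') := by
        intro i
        by_cases hi : D.toFun i ≠ 0
        · obtain ⟨p', hp⟩ := ih i hi Y hY δ hδ
          exact ⟨p', fun _ => hp⟩
        · exact ⟨0, fun h => absurd h hi⟩
      choose q hq using this
      refine ⟨ex D q, ?_, ?_⟩
      · rw [ex_snd, ← ex_const D δ, ← ex_sub]
        exact ex_mono fun i hi => (hq i hi).1
      · rw [ex_fst, ← ex_mk]
        exact Tr.mix D _ fun i hi => (hq i hi).2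
    | @move X β ρ r r' f hs hr hch ih =>
      subst hr
      intro Y hY δ hδ
      simp only at hY
      set Φ' : Node → V × ℝ → Prop := fun y x => ‖x‖ ≤ 1 ∧ Ach Ψ y x.1 ∧
        ∀ δ : ℝ, 0 < δ → ∃ p', x.2 - δ ≤ p' ∧ Tr (Lam Φ (Ach Ψ)) y (x.1, p') with hΦ'
      have hΦ'b : Bd Φ' := fun y x h => h.1
      have hfb : ∀ B, ρ.toFun B ≠ 0 → ‖f B‖ ≤ 1 := by
        intro B hB
        have := (hch B hB).bounds hΦ (Ach.bd Φ)
        rw [Prod.norm_def]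
        refine max_le this.1 ?_
        rw [Real.norm_of_nonneg this.2.1]
        exact this.2.2
      have hA : Ach Φ' (Y, extTrace β ++ r') (ex ρ f) := by
        refine weak_match hE hY hs hΦ'b f hfb ?_
        intro Z D hD
        have hT : ∀ δ : ℝ, 0 < δ → ∃ p', (ex D f).2 - δ ≤ p' ∧
            Tr (Lam Φ (Ach Ψ)) (Z, r') ((ex D f).1, p') := by
          intro δ hδ
          have : ∀ B, ∃ p', D.toFun B ≠ 0 → (f B).2 - δ ≤ p' ∧
              Tr (Lam Φ (Ach Ψ)) (Z, r') ((f B).1, p') := by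
            intro B
            by_cases hB : D.toFun B ≠ 0
            · obtain ⟨p', hp⟩ := ih B (hD B hB).1 Z (hD B hB).2 δ hδ
              exact ⟨p', fun _ => hp⟩
            · exact ⟨0, fun h => absurd h hB⟩
          choose q hq using this
          refine ⟨ex D q, ?_, ?_⟩
          · rw [ex_snd, ← ex_const D δ, ← ex_sub]
            exact ex_mono fun i hi => (hq i hi).1
          · rw [ex_fst, ← ex_mk]
            exact Tr.mix D _ fun i hi => (hq i hi).2
        refine ⟨ex_norm_le _ _ fun B hB => hfb B (hD B hB).1, ?_, hT⟩
        obtain ⟨p', _, h2⟩ := hT 1 one_pos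
        exact hTΨ _ _ _ h2
      obtain ⟨q, hq, hT⟩ := Ach.high hA (δ/2) (by linarith)
      obtain ⟨p', h1, h2⟩ := Tr.acct (Λ' := Lam Φ (Ach Ψ)) (LinearMap.fst ℝ V ℝ)
        ((LinearMap.snd ℝ V ℝ).comp (LinearMap.fst ℝ (V × ℝ) ℝ) + LinearMap.snd ℝ (V × ℝ) ℝ)
        (-1 - δ/2) (by
        rintro y ⟨v, p⟩ q (⟨h, hp⟩ | ⟨h, hp⟩)
        · simp only at h hp
          subst hp
          obtain ⟨p', h1, h2⟩ := h.2.2 (δ/2) (by linarith)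
          refine ⟨p', ?_, h2⟩
          simp only [LinearMap.add_apply, LinearMap.comp_apply, LinearMap.fst_apply,
            LinearMap.snd_apply] at h1 ⊢
          linarith
        · simp only at h hp
          subst hp
          have hb := Ach.bd Φ' _ _ h
          rw [Prod.norm_def] at hb
          have hb2 := (le_abs_self p).trans ((le_max_right _ _).trans hb)
          refine ⟨0, ?_, Tr.leaf (Or.inr ⟨?_, rfl⟩)⟩
          · simp only [LinearMap.add_apply, LinearMap.comp_apply, LinearMap.fst_apply,
              LinearMap.snd_apply]
            linarith
          · have := Ach.map (Ψ := Ach Ψ) (LinearMap.fst ℝ V ℝ) (fun x => norm_fst_le x)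
              (fun y x hx => hx.2.1) h
            exact Ach.idem (fun _ _ h => h) this) hT
      refine ⟨p', ?_, h2⟩
      simp only [LinearMap.add_apply, LinearMap.comp_apply, LinearMap.fst_apply,
            LinearMap.snd_apply] at h1
      linarith
  refine Ach.of_sub (Ψ := Ψ) ?_ (Ach.halt hΨb ⟨X, hXY, h⟩)
  rintro ⟨Y, r⟩ v ⟨X, hX, hA⟩
  obtain ⟨p, h1, h2⟩ := Ach.high hA (1/8) (by norm_num)
  obtain ⟨p', h3, h4⟩ := sub _ _ h2 Y hX (1/8) (by norm_num)
  exact ⟨p', by simp only at h3; linarith, h4⟩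

end Transfer

/-! ## Convexity in finite dimension -/

theorem ex_mem_convex {V ι : Type} [AddCommGroup V] [Module ℝ V] {C : Set V} (hC : Convex ℝ C)
    (D : FinDist ι) (f : ι → V) (h : ∀ i, D.toFun i ≠ 0 → f i ∈ C) : ex D f ∈ C := by
  rw [ex_eq_sum D f D.finite_support.toFinset (fun a ha => by simpa using ha)]
  refine hC.sum_mem (fun i _ => D.nonneg i) ?_ (fun i hi => h i (by simpa using hi))
  exact sum_toFun D _ (fun a ha => by simpa using ha)

section LemA
variable {V : Type} [NormedAddCommGroup V] [NormedSpace ℝ V] [FiniteDimensional ℝ V]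

theorem bounded_coeff (x : ℕ → V) (N : ℕ) :
    ∃ K : ℝ, 0 ≤ K ∧ ∀ u ∈ Submodule.span ℝ (Set.range fun i : Fin N => x i), ‖u‖ ≤ 1 →
      ∃ c : ℕ → ℝ, (∀ n, |c n| ≤ K) ∧ (∀ n, N ≤ n → c n = 0) ∧
        ∑ n ∈ Finset.range N, c n • x n = u := by
  set L := Fintype.linearCombination ℝ (fun i : Fin N => x i) with hL
  have hr : LinearMap.range L = Submodule.span ℝ (Set.range fun i : Fin N => x i) :=
    Fintype.range_linearCombination ℝ _
  obtain ⟨R, hR⟩ := L.rangeRestrict.exists_rightInverse_of_surjective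
    (LinearMap.range_rangeRestrict L)
  set R' := LinearMap.toContinuousLinearMap R with hR'
  refine ⟨‖R'‖, ContinuousLinearMap.opNorm_nonneg _, fun u hu hu1 => ?_⟩
  rw [← hr] at hu
  refine ⟨fun n => if h : n < N then R ⟨u, hu⟩ ⟨n, h⟩ else 0, ?_, ?_, ?_⟩
  · intro n
    simp only
    split_ifs with h
    · have h1 : ‖R' ⟨u, hu⟩‖ ≤ ‖R'‖ * ‖(⟨u, hu⟩ : LinearMap.range L)‖ := R'.le_opNorm _
      have h2 : ‖(⟨u, hu⟩ : LinearMap.range L)‖ ≤ 1 := hu1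
      have h3 := norm_le_pi_norm (R' ⟨u, hu⟩) ⟨n, h⟩
      calc |R ⟨u, hu⟩ ⟨n, h⟩| ≤ ‖R' ⟨u, hu⟩‖ := h3
        _ ≤ ‖R'‖ * 1 := h1.trans (mul_le_mul_of_nonneg_left h2 (ContinuousLinearMap.opNorm_nonneg _))
        _ = _ := mul_one _
    · rw [abs_zero]
      exact ContinuousLinearMap.opNorm_nonneg _
  · intro n hn
    simp [not_lt.mpr hn]
  · rw [Finset.sum_range]
    have h1 : L.rangeRestrict (R ⟨u, hu⟩) = ⟨u, hu⟩ := LinearMap.congr_fun hR _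
    have h2 : L (R ⟨u, hu⟩) = u := congrArg Subtype.val h1
    refine Eq.trans ?_ h2
    have h3 : ∀ c, L c = ∑ i, c i • x i := fun c => Fintype.linearCombination_apply ℝ _ c
    rw [h3]
    exact Finset.sum_congr rfl fun i _ => by simp only [i.2, dif_pos]

theorem hat_expand {U : Type} [AddCommGroup U] [Module ℝ U] (v x : ℕ → U)
    (h : ∀ n, v (n + 1) = (2:ℝ) • v n - x n) (M : ℕ) :
    v 0 = ∑ n ∈ Finset.range M, (1/2:ℝ)^(n+1) • x n + (1/2:ℝ)^M • v M := by
  induction M with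
  | zero => simp
  | succ M ih =>
    rw [Finset.sum_range_succ, h M]
    conv_lhs => rw [ih]
    rw [smul_sub, smul_smul, pow_succ]
    rw [show (1/2:ℝ)^M * (1/2) * 2 = (1/2)^M by ring]
    abel

theorem gapA (A C : Set V) (hb : ∀ v ∈ A, ‖v‖ ≤ 1) (hC : Convex ℝ C)
    (h : ∀ v ∈ A, ∃ x ∈ C, (2:ℝ) • v - x ∈ A) : A ⊆ C := by
  intro v0 hv0
  choose! g hg1 hg2 using h
  let v : ℕ → V := fun n => Nat.rec v0 (fun _ v => (2:ℝ) • v - g v) n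
  have hvs : ∀ n, v (n+1) = (2:ℝ) • v n - g (v n) := fun n => rfl
  have hvA : ∀ n, v n ∈ A := by
    intro n
    induction n with
    | zero => exact hv0
    | succ n ih => rw [hvs]; exact hg2 _ ih
  let x : ℕ → V := fun n => g (v n)
  have hxC : ∀ n, x n ∈ C := fun n => hg1 _ (hvA n)
  let vh : ℕ → V × ℝ := fun n => (v n, 1)
  let xh : ℕ → V × ℝ := fun n => (x n, 1)
  have hh : ∀ n, vh (n+1) = (2:ℝ) • vh n - xh n := by
    intro n
    apply Prod.ext
    · exact hvs n
    · simp [vh, xh]; norm_num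
  have hvn : ∀ n, ‖vh n‖ ≤ 1 := by
    intro n
    rw [Prod.norm_def]
    exact max_le (hb _ (hvA n)) (by simp [vh])
  have hex := hat_expand vh xh hh
  let S : ℕ →o Submodule ℝ (V × ℝ) :=
    ⟨fun N => Submodule.span ℝ (Set.range fun i : Fin N => xh i), by
      intro a b hab
      apply Submodule.span_mono
      rintro _ ⟨i, rfl⟩
      exact ⟨⟨i, i.2.trans_le hab⟩, rfl⟩⟩
  obtain ⟨N, hN⟩ := monotone_stabilizes_iff_noetherian.mpr (inferInstance : IsNoetherian ℝ (V × ℝ)) S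
  have hxS : ∀ n, xh n ∈ S N := by
    intro n
    have h1 : xh n ∈ S (max N (n+1)) :=
      Submodule.subset_span ⟨⟨n, lt_of_lt_of_le (Nat.lt_succ_self n) (le_max_right _ _)⟩, rfl⟩
    rwa [← hN _ (le_max_left _ _)] at h1
  have hp0 : Filter.Tendsto (fun M : ℕ => (1/2:ℝ)^M) Filter.atTop (nhds 0) :=
    tendsto_pow_atTop_nhds_zero_of_lt_one (by norm_num) (by norm_num)
  have hv0S : vh 0 ∈ S N := by
    have hcl : IsClosed (S N : Set (V × ℝ)) := Submodule.closed_of_finiteDimensional _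
    have ht : Filter.Tendsto (fun M => vh 0 - (1/2:ℝ)^M • vh M) Filter.atTop (nhds (vh 0 - 0)) := by
      refine tendsto_const_nhds.sub ?_
      rw [tendsto_zero_iff_norm_tendsto_zero]
      refine squeeze_zero (fun _ => norm_nonneg _) (fun M => ?_) hp0
      rw [norm_smul, Real.norm_of_nonneg (by positivity)]
      exact mul_le_of_le_one_right (by positivity) (hvn M)
    rw [sub_zero] at ht
    refine hcl.mem_of_tendsto ht (Filter.Eventually.of_forall fun M => ?_)
    rw [hex M, add_sub_cancel_right]
    exact Submodule.sum_mem _ fun n _ => Submodule.smul_mem _ _ (hxS n)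
  have hvS : ∀ n, vh n ∈ S N := by
    intro n
    induction n with
    | zero => exact hv0S
    | succ n ih =>
      rw [hh]
      exact Submodule.sub_mem _ (Submodule.smul_mem _ _ ih) (hxS n)
  obtain ⟨K, hK0, hK⟩ := bounded_coeff xh N
  obtain ⟨M, hMN, hM⟩ : ∃ M, N ≤ M ∧ (1/2:ℝ)^M * K ≤ (1/2:ℝ)^N := by
    have h1 : Filter.Tendsto (fun M : ℕ => (1/2:ℝ)^M * K) Filter.atTop (nhds (0 * K)) :=
      hp0.mul_const K
    rw [zero_mul] at h1
    have h2 := h1.eventually (ge_mem_nhds (show (0:ℝ) < (1/2:ℝ)^N by positivity))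
    obtain ⟨M, h3, h4⟩ := (h2.and (Filter.eventually_ge_atTop N)).exists
    exact ⟨M, h4, h3⟩
  obtain ⟨c, hc1, hc2, hc3⟩ := hK (vh M) (hvS M) (hvn M)
  have hsum : ∑ n ∈ Finset.range M, c n • xh n = vh M := by
    rw [← hc3]
    symm
    apply Finset.sum_subset (Finset.range_mono hMN)
    intro n _ hn
    rw [hc2 n (by simpa using hn), zero_smul]
  have hfin : vh 0 = ∑ n ∈ Finset.range M, ((1/2:ℝ)^(n+1) + (1/2:ℝ)^M * c n) • xh n := by
    conv_lhs => rw [hex M, ← hsum]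
    rw [Finset.smul_sum, ← Finset.sum_add_distrib]
    refine Finset.sum_congr rfl fun n _ => ?_
    rw [add_smul, smul_smul]
  have hf1 := congrArg Prod.fst hfin
  have hf2 := congrArg Prod.snd hfin
  rw [Prod.fst_sum] at hf1
  rw [Prod.snd_sum] at hf2
  simp only [vh, xh, Prod.smul_fst, Prod.smul_snd, smul_eq_mul, mul_one] at hf1 hf2
  have : v 0 = v0 := rfl
  rw [← this, hf1]
  refine hC.sum_mem (fun n _ => ?_) hf2.symm (fun n _ => hxC n)
  by_cases hn : n < N
  · have h1 : (1/2:ℝ)^N ≤ (1/2:ℝ)^(n+1) :=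
      pow_le_pow_of_le_one (by norm_num) (by norm_num) hn
    have h2 : -K ≤ c n := (abs_le.mp (hc1 n)).1
    have h3 : (0:ℝ) ≤ (1/2:ℝ)^M := by positivity
    nlinarith
  · rw [hc2 n (not_lt.mp hn)]
    simp
end LemA

/-! ## Guarded trees -/

section GTSec
variable {V : Type} [NormedAddCommGroup V] [NormedSpace ℝ V]

theorem hull_dist {U : Type} [AddCommGroup U] [Module ℝ U] {s : Set U} {x : U}
    (h : x ∈ convexHull ℝ s) : ∃ D : FinDist U, (∀ u, D.toFun u ≠ 0 → u ∈ s) ∧ ex D id = x := by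
  have hc : Convex ℝ {x : U | ∃ D : FinDist U, (∀ u, D.toFun u ≠ 0 → u ∈ s) ∧ ex D id = x} := by
    rintro x ⟨D, hD, rfl⟩ y ⟨D', hD', rfl⟩ a b ha hb hab
    refine ⟨mixD a ha (by linarith) D D', ?_, ?_⟩
    · intro u hu
      by_contra hus
      apply hu
      have h1 : D.toFun u = 0 := by by_contra h; exact hus (hD u h)
      have h2 : D'.toFun u = 0 := by by_contra h; exact hus (hD' u h)
      simp [mixD, h1, h2]
    · rw [ex_mixD, ← hab, add_sub_cancel_left]
  refine convexHull_min ?_ hc h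
  intro u hu
  refine ⟨FinDist.dirac u, ?_, ex_dirac _ _⟩
  intro w hw
  by_cases h : w = u
  · exact h ▸ hu
  · simp [FinDist.dirac, h] at hw

theorem Ach.convex {Φ : Node → V → Prop} (hΦ : Bd Φ) (y : Node) : Convex ℝ {v | Ach Φ y v} := by
  intro v hv w hw a b ha hb hab
  have := Ach.mix hΦ (y := y) (mixD a ha (by linarith) (FinDist.dirac true) (FinDist.dirac false))
    (fun i => if i then v else w) (by intro i _; cases i; exacts [hw, hv])
  rw [ex_mixD, ex_dirac, ex_dirac] at this
  simp only [if_true, Bool.false_eq_true, if_false] at this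
  rwa [← hab, add_sub_cancel_left] at this

/-- One layer: stop now, or perform a transition. -/
def Base (Φ F : Node → V → Prop) (y : Node) (v : V) : Prop :=
  Φ y v ∨ ∃ (β : Act) (ρ : FinDist Tm) (r' : List Act) (f : Tm → V), Step y.1 β ρ ∧
    y.2 = extTrace β ++ r' ∧ (∀ B, ρ.toFun B ≠ 0 → F (B, r') (f B)) ∧ v = ex ρ f

theorem Base.ach {Φ : Node → V → Prop} (hΦ : Bd Φ) {y : Node} {v : V}
    (h : Base Φ (Ach Φ) y v) : Ach Φ y v := by
  rcases h with h | ⟨β, ρ, r', f, hs, hr, hf, rfl⟩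
  · exact Ach.halt hΦ h
  · obtain ⟨Y, r⟩ := y
    exact Ach.move hΦ f hs hr hf

theorem Tr.guard {Φ : Node → V → Prop} (hΦ : Bd Φ) {y : Node} {x : V × ℝ}
    (h : Tr (Lam Φ (Ach Φ)) y x) : ∃ p, x.2 ≤ p ∧ (x.1, p) ∈ convexHull ℝ
      ((convexHull ℝ {v | Base Φ (Ach Φ) y v}) ×ˢ {(1:ℝ)} ∪ {v | Ach Φ y v} ×ˢ {(0:ℝ)}) := by
  induction h with
  | @leaf y x h =>
    rcases h with ⟨h, hp⟩ | ⟨h, hp⟩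
    · exact ⟨1, hp.le, subset_convexHull _ _ (Or.inl ⟨subset_convexHull _ _ (Or.inl h), rfl⟩)⟩
    · exact ⟨0, hp.le, subset_convexHull _ _ (Or.inr ⟨h, rfl⟩)⟩
  | @move Y β ρ r r' f hs hr hch _ =>
    refine ⟨1, ?_, ?_⟩
    · rw [ex_snd]
      exact ex_le_one fun B hB => ((hch B hB : Tr _ _ ((f B).1, (f B).2)).bounds hΦ (Ach.bd Φ)).2.2
    · rw [ex_fst]
      refine subset_convexHull _ _ (Or.inl ⟨subset_convexHull _ _ (Or.inr
        ⟨β, ρ, r', _, hs, hr, fun B hB => ?_, rfl⟩), rfl⟩)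
      exact Ach.of_tr hΦ (hch B hB : Tr _ _ ((f B).1, (f B).2))
  | @mix y ι D f _ ih =>
    set H := convexHull ℝ
      ((convexHull ℝ {v | Base Φ (Ach Φ) y v}) ×ˢ {(1:ℝ)} ∪ {v | Ach Φ y v} ×ˢ {(0:ℝ)})
    have hc : Convex ℝ {x : V × ℝ | ∃ p, x.2 ≤ p ∧ (x.1, p) ∈ H} := by
      rintro x ⟨p, hp, hx⟩ z ⟨q, hq, hz⟩ a b ha hb hab
      refine ⟨a * p + b * q, ?_, ?_⟩
      · simp only [Prod.snd_add, Prod.smul_snd, smul_eq_mul]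
        gcongr
      · have := (convex_convexHull ℝ _ : Convex ℝ H) hx hz ha hb hab
        simpa using this
    exact ex_mem_convex hc D f ih

theorem Ach.guard [FiniteDimensional ℝ V] {Φ : Node → V → Prop} (hΦ : Bd Φ) {y : Node} {v : V}
    (h : Ach Φ y v) : v ∈ convexHull ℝ {v | Base Φ (Ach Φ) y v} := by
  set C := convexHull ℝ {v | Base Φ (Ach Φ) y v} with hCdef
  have hA : Convex ℝ {v | Ach Φ y v} := Ach.convex hΦ y
  have hCc : Convex ℝ C := convex_convexHull _ _
  have hCA : C ⊆ {v | Ach Φ y v} := convexHull_min (fun v hv => Base.ach hΦ hv) hA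
  refine gapA {v | Ach Φ y v} C (fun v hv => Ach.bd Φ _ _ hv) hCc ?_ h
  intro v hv
  obtain ⟨p, hp, ht⟩ := Ach.prog Φ y v hv
  obtain ⟨p', hp', hm⟩ := ht.guard hΦ
  simp only at hp' hm
  have hA0 : Convex ℝ ({v | Ach Φ y v} ×ˢ {(0:ℝ)}) := hA.prod (convex_singleton _)
  have hC1 : Convex ℝ (C ×ˢ {(1:ℝ)}) := hCc.prod (convex_singleton _)
  rcases C.eq_empty_or_nonempty with hE | hne
  · exfalso
    rw [← hCdef, hE, Set.empty_prod, Set.empty_union, hA0.convexHull_eq] at hm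
    have : p' = 0 := hm.2
    linarith
  · rw [← hCdef, convexHull_union (hne.prod (Set.singleton_nonempty _))
      (Set.Nonempty.prod ⟨v, hv⟩ (Set.singleton_nonempty _)), hA0.convexHull_eq,
      hC1.convexHull_eq, mem_convexJoin] at hm
    obtain ⟨⟨x, x1⟩, ⟨hx, hx1⟩, ⟨w, w0⟩, ⟨hw, hw0⟩, a, b, ha, hb, hab, he⟩ := hm
    simp only [Set.mem_singleton_iff] at hx1 hw0 hx hw
    subst hx1 hw0
    have h1 : a • x + b • w = v := congrArg Prod.fst he
    have h2 : a = p' := by simpa using congrArg Prod.snd he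
    refine ⟨x, hx, ?_⟩
    have h3 : (2:ℝ) • v - x = (2 * a - 1) • x + (2 * b) • w := by
      rw [← h1]; module
    rw [h3]
    exact hA (hCA hx) hw (by linarith) (by linarith) (by linarith)

/-- One layer of an accounted guarded tree. -/
def Base2 (Φ : Node → V → Prop) (F : Node → Set (V × ℝ)) (y : Node) (x : V × ℝ) : Prop :=
  (Φ y x.1 ∧ x.2 ≤ 1) ∨ ∃ (β : Act) (ρ : FinDist Tm) (r' : List Act) (f : Tm → V × ℝ),
    Step y.1 β ρ ∧ y.2 = extTrace β ++ r' ∧ (∀ B, ρ.toFun B ≠ 0 → f B ∈ F (B, r')) ∧ x = ex ρ f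

/-- Guarded accounted trees of height `n`. -/
def GT (Φ : Node → V → Prop) : ℕ → Node → Set (V × ℝ)
  | 0, y => {x | Ach Φ y x.1 ∧ x.2 ≤ 0}
  | n + 1, y => convexHull ℝ {x | Base2 Φ (GT Φ n) y x}

theorem GT.ach {Φ : Node → V → Prop} (hΦ : Bd Φ) (n : ℕ) : ∀ {y : Node} {x : V × ℝ},
    x ∈ GT Φ n y → Ach Φ y x.1 := by
  induction n with
  | zero => exact fun h => h.1
  | succ n ih =>
    intro y x h
    have hc : Convex ℝ {x : V × ℝ | Ach Φ y x.1} :=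
      (Ach.convex hΦ y).linear_preimage (LinearMap.fst ℝ V ℝ)
    refine convexHull_min ?_ hc h
    rintro x (⟨h, _⟩ | ⟨β, ρ, r', f, hs, hr, hf, rfl⟩)
    · exact Ach.halt hΦ h
    · obtain ⟨Y, r⟩ := y
      show Ach Φ (Y, r) (ex ρ f).1
      rw [ex_fst]
      exact Ach.move hΦ _ hs hr fun B hB => ih (hf B hB)

theorem GT.zero_one [FiniteDimensional ℝ V] {Φ : Node → V → Prop} (hΦ : Bd Φ) (y : Node) :
    GT Φ 0 y ⊆ GT Φ 1 y := by
  rintro ⟨v, p⟩ ⟨h, hp⟩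
  have h' := h.guard hΦ
  have hc : Convex ℝ {v : V | (v, p) ∈ GT Φ 1 y} := by
    intro v hv w hw a b ha hb hab
    have := (convex_convexHull ℝ _ : Convex ℝ (GT Φ 1 y)) hv hw ha hb hab
    simp only [Prod.smul_mk, Prod.mk_add_mk, ← add_smul, hab, one_smul] at this
    exact this
  refine convexHull_min ?_ hc h'
  rintro v (h | ⟨β, ρ, r', f, hs, hr, hf, rfl⟩)
  · exact subset_convexHull _ _ (Or.inl ⟨h, by simp only at hp ⊢; linarith⟩)
  · refine subset_convexHull _ _ (Or.inr ⟨β, ρ, r', fun B => (f B, p), hs, hr, ?_, ?_⟩)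
    · exact fun B hB => ⟨hf B hB, hp⟩
    · rw [ex_mk, ex_const]

theorem GT.succ [FiniteDimensional ℝ V] {Φ : Node → V → Prop} (hΦ : Bd Φ) (n : ℕ) :
    ∀ y, GT Φ n y ⊆ GT Φ (n + 1) y := by
  induction n with
  | zero => exact GT.zero_one hΦ
  | succ n ih =>
    intro y
    refine convexHull_mono ?_
    rintro x (h | ⟨β, ρ, r', f, hs, hr, hf, rfl⟩)
    · exact Or.inl h
    · exact Or.inr ⟨β, ρ, r', f, hs, hr, fun B hB => ih _ (hf B hB), rfl⟩

theorem GT.mono [FiniteDimensional ℝ V] {Φ : Node → V → Prop} (hΦ : Bd Φ) (y : Node) :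
    Monotone fun n => GT Φ n y :=
  monotone_nat_of_le_succ fun n => GT.succ hΦ n y

theorem GT.convex {Φ : Node → V → Prop} (n : ℕ) (y : Node) : Convex ℝ (GT Φ (n+1) y) :=
  convex_convexHull _ _

theorem sup_bound {ι : Type} (D : FinDist ι) (P : ℕ → ι → Prop) (hm : ∀ i n m, n ≤ m → P n i → P m i)
    (h : ∀ i, D.toFun i ≠ 0 → ∃ n, P n i) : ∃ N, ∀ i, D.toFun i ≠ 0 → P N i := by
  choose! g hg using h
  refine ⟨D.finite_support.toFinset.sup g, fun i hi => hm i _ _ ?_ (hg i hi)⟩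
  exact Finset.le_sup (f := g) (by simpa using hi)

theorem GT.of_tr [FiniteDimensional ℝ V] {Φ : Node → V → Prop} (hΦ : Bd Φ) {y : Node} {x : V × ℝ}
    (h : Tr (Lam Φ (Ach Φ)) y x) : ∃ n, x ∈ GT Φ n y := by
  induction h with
  | leaf h =>
    rcases h with ⟨h, hp⟩ | ⟨h, hp⟩
    · exact ⟨1, subset_convexHull _ _ (Or.inl ⟨h, hp.le⟩)⟩
    · exact ⟨0, h, hp.le⟩
  | @move Y β ρ r r' f hs hr _ ih =>
    obtain ⟨N, hN⟩ := sup_bound ρ (fun n B => f B ∈ GT Φ n (B, r'))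
      (fun i n m hnm h => GT.mono hΦ _ hnm h) ih
    exact ⟨N + 1, subset_convexHull _ _ (Or.inr ⟨β, ρ, r', f, hs, hr, hN, rfl⟩)⟩
  | @mix y ι D f _ ih =>
    obtain ⟨N, hN⟩ := sup_bound D (fun n B => f B ∈ GT Φ n y)
      (fun i n m hnm h => GT.mono hΦ _ hnm h) ih
    exact ⟨N + 1, ex_mem_convex (GT.convex N y) D f fun i hi => GT.succ hΦ N y (hN i hi)⟩

theorem Ach.gt [FiniteDimensional ℝ V] {Φ : Node → V → Prop} (hΦ : Bd Φ) {y : Node} {v : V}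
    (h : Ach Φ y v) : ∃ n p, 1/2 ≤ p ∧ (v, p) ∈ GT Φ (n+1) y := by
  obtain ⟨p, hp, ht⟩ := Ach.prog Φ y v h
  obtain ⟨n, hn⟩ := GT.of_tr hΦ ht
  exact ⟨n, p, hp, GT.succ hΦ n y hn⟩

end GTSec

/-! ## Assembling schedulers -/

section AsmSec

theorem tower {O U : Type} [AddCommGroup U] [Module ℝ U] (J : FinDist (O × U)) :
    ∃ c : O → U, ex J Prod.snd = ex J (fun x => c x.1) ∧ ∀ o (K : Set U), Convex ℝ K →
      (∃ u, J.toFun (o, u) ≠ 0) → (∀ u, J.toFun (o, u) ≠ 0 → u ∈ K) → c o ∈ K := by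
  set T := J.finite_support.toFinset with hT
  have hmem : ∀ x, x ∈ T ↔ J.toFun x ≠ 0 := fun x => by simp [hT]
  have hpos : ∀ o u, J.toFun (o, u) ≠ 0 →
      0 < ∑ x ∈ T.filter (fun x => x.1 = o), J.toFun x := by
    intro o u hu
    refine Finset.sum_pos' (fun x _ => J.nonneg x) ⟨(o, u), ?_, ?_⟩
    · rw [Finset.mem_filter, hmem]; exact ⟨hu, rfl⟩
    · exact lt_of_le_of_ne (J.nonneg _) (Ne.symm hu)
  refine ⟨fun o => (T.filter (fun x => x.1 = o)).centerMass J.toFun Prod.snd, ?_, ?_⟩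
  · unfold ex
    rw [← hT]
    rw [← Finset.sum_fiberwise_of_maps_to (t := T.image Prod.fst)
      (fun x hx => Finset.mem_image_of_mem _ hx),
      ← Finset.sum_fiberwise_of_maps_to (t := T.image Prod.fst)
      (fun x hx => Finset.mem_image_of_mem _ hx)]
    refine Finset.sum_congr rfl fun o ho => ?_
    obtain ⟨⟨o', u⟩, hx, rfl⟩ := Finset.mem_image.mp ho
    have hp := hpos o' u ((hmem _).mp hx)
    have h1 : ∀ x ∈ T.filter (fun x => x.1 = o'),
        J.toFun x • (T.filter (fun y => y.1 = x.1)).centerMass J.toFun Prod.snd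
        = J.toFun x • (T.filter (fun y => y.1 = o')).centerMass J.toFun Prod.snd := by
      intro x hx
      rw [(Finset.mem_filter.mp hx).2]
    rw [Finset.sum_congr rfl h1, ← Finset.sum_smul, Finset.centerMass, smul_smul,
      mul_inv_cancel₀ hp.ne', one_smul]
  · rintro o K hK ⟨u, hu⟩ h
    refine hK.centerMass_mem (fun x _ => J.nonneg x) (hpos o u hu) ?_
    rintro ⟨o', u'⟩ hx
    obtain ⟨h1, h2⟩ := Finset.mem_filter.mp hx
    simp only at h2
    subst h2
    exact h u' ((hmem _).mp h1)

variable {V : Type} [NormedAddCommGroup V] [NormedSpace ℝ V]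

/-- Stopping is allowed at related states once the trace is exhausted. -/
def PhiE (Rel : Tm → Prop) (e : Tm → V) (y : Node) (v : V) : Prop :=
  y.2 = [] ∧ Rel y.1 ∧ v = e y.1

theorem PhiE.bd {Rel : Tm → Prop} {e : Tm → V} (he : ∀ Z, ‖e Z‖ ≤ 1) : Bd (PhiE Rel e) := by
  rintro y v ⟨_, _, rfl⟩
  exact he _

theorem GT.convex' {Φ : Node → V → Prop} (hΦ : Bd Φ) (n : ℕ) (y : Node) : Convex ℝ (GT Φ n y) := by
  cases n with
  | zero =>
    have h1 : Convex ℝ {x : V × ℝ | Ach Φ y x.1} :=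
      (Ach.convex hΦ y).linear_preimage (LinearMap.fst ℝ V ℝ)
    have h2 : Convex ℝ {x : V × ℝ | x.2 ≤ 0} :=
      (convex_Iic (0:ℝ)).linear_preimage (LinearMap.snd ℝ V ℝ)
    exact h1.inter h2
  | succ n => exact GT.convex n y

theorem dirac_self {α : Type} (a : α) : (FinDist.dirac a).toFun a = 1 := by
  simp [FinDist.dirac]

theorem map_ne {α β : Type} {g : α → β} {μ : FinDist α} {a : α} (h : μ.toFun a ≠ 0) :
    (μ.map g).toFun (g a) ≠ 0 := by
  rw [toFun_eq_ex, ex_map]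
  refine (ex_pos_of (fun b => ?_) h ?_).ne'
  · split_ifs <;> norm_num
  · simp

theorem bindD_ne {α β : Type} {μ : FinDist α} {k : α → FinDist β} {a : α} {b : β}
    (h : μ.toFun a ≠ 0) (h' : (k a).toFun b ≠ 0) : (bindD μ k).toFun b ≠ 0 := by
  rw [bindD_toFun]
  exact (ex_pos_of (fun a => (k a).nonneg b) h (lt_of_le_of_ne ((k a).nonneg b) (Ne.symm h'))).ne'

/-- The decision at one node of a guarded tree. -/
theorem GT.decide {Rel : Tm → Prop} {e : Tm → V} (he : ∀ Z, ‖e Z‖ ≤ 1) {n : ℕ} {Y : Tm}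
    {r : List Act} {x : V × ℝ} (h : x ∈ GT (PhiE Rel e) (n+1) (Y, r)) :
    ∃ (S : FinDist (Option PTrans)) (c : Act → Tm → V × ℝ),
      (∀ tr, S.toFun (some tr) ≠ 0 → tr.val.1 = Y ∧ ∃ r', r = extTrace tr.val.2.1 ++ r' ∧
        ∀ B, tr.val.2.2.toFun B ≠ 0 → c tr.val.2.1 B ∈ GT (PhiE Rel e) n (B, r')) ∧
      (S.toFun none ≠ 0 → r = [] ∧ Rel Y) ∧
      x.1 = ex S (fun o => o.elim (e Y) (fun tr => ex tr.val.2.2 (fun B => (c tr.val.2.1 B).1))) ∧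
      x.2 ≤ ex S (fun o => o.elim 1 (fun tr => ex tr.val.2.2 (fun B => (c tr.val.2.1 B).2))) := by
  set Φ := PhiE Rel e with hΦd
  have hΦ : Bd Φ := PhiE.bd he
  obtain ⟨D, hD, hDx⟩ := hull_dist h
  have hdec : ∀ u : V × ℝ, ∃ d : Option (PTrans × (Tm → V × ℝ)), D.toFun u ≠ 0 →
      (d = none → Φ (Y, r) u.1 ∧ u.2 ≤ 1) ∧
      (∀ tr f, d = some (tr, f) → tr.val.1 = Y ∧ u = ex tr.val.2.2 f ∧
        ∃ r', r = extTrace tr.val.2.1 ++ r' ∧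
        ∀ B, tr.val.2.2.toFun B ≠ 0 → f B ∈ GT Φ n (B, r')) := by
    intro u
    by_cases hu : D.toFun u ≠ 0
    · rcases hD u hu with hs | ⟨β, ρ, r', f, hs, hr, hf, hx⟩
      · exact ⟨none, fun _ => ⟨fun _ => hs, fun tr f h => by cases h⟩⟩
      · refine ⟨some (⟨(Y, β, ρ), hs⟩, f), fun _ => ⟨fun h => absurd h (by simp), fun tr f' h => ?_⟩⟩
        simp only [Option.some.injEq, Prod.mk.injEq] at h
        obtain ⟨rfl, rfl⟩ := h
        exact ⟨rfl, hx, r', hr, hf⟩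
    · exact ⟨none, fun h => absurd h hu⟩
  choose d hd using hdec
  let k : V × ℝ → FinDist (Option (Act × Tm) × (V × ℝ)) := fun u =>
    match d u with
    | none => FinDist.dirac (none, u)
    | some (tr, f) => tr.val.2.2.map (fun B => (some (tr.val.2.1, B), f B))
  have hk0 : ∀ u, d u = none → k u = FinDist.dirac (none, u) := by
    intro u hu; simp only [k, hu]
  have hk1 : ∀ u tr f, d u = some (tr, f) →
      k u = tr.val.2.2.map (fun B => (some (tr.val.2.1, B), f B)) := by
    intro u tr f hu; simp only [k, hu]
  set J := bindD D k with hJ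
  obtain ⟨c, hc1, hc2⟩ := tower J
  -- support of `J`
  have hJs : ∀ o w, J.toFun (o, w) ≠ 0 → ∃ u, D.toFun u ≠ 0 ∧ (k u).toFun (o, w) ≠ 0 := by
    intro o w hw
    rw [hJ, bindD_toFun] at hw
    exact ex_ne_zero hw
  set S : FinDist (Option PTrans) := D.map (fun u => (d u).map Prod.fst) with hS
  have hex : ∀ (a : V × ℝ) (b : Act → Tm → V × ℝ),
      ex J (fun y => (y.1.elim a (fun s => b s.1 s.2) : V × ℝ)) =
      ex S (fun o => o.elim a (fun tr => ex tr.val.2.2 (fun B => b tr.val.2.1 B))) := by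
    intro a b
    rw [hJ, ex_bindD, hS, ex_map]
    refine ex_congr fun u hu => ?_
    rcases hdu : d u with _ | ⟨tr, f⟩
    · rw [hk0 u hdu, ex_dirac]; rfl
    · rw [hk1 u tr f hdu, ex_map]; rfl
  have hJx : ex J Prod.snd = x := by
    rw [hJ, ex_bindD, ← hDx]
    refine ex_congr fun u hu => ?_
    rcases hdu : d u with _ | ⟨tr, f⟩
    · rw [hk0 u hdu, ex_dirac]; rfl
    · rw [hk1 u tr f hdu, ex_map]
      exact ((hd u hu).2 tr f hdu).2.1.symm
  have hxS : x = ex S (fun o => o.elim (c none)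
      (fun tr => ex tr.val.2.2 (fun B => c (some (tr.val.2.1, B))))) := by
    rw [← hex (c none) (fun β B => c (some (β, B))), ← hJx, hc1]
    refine ex_congr fun y _ => ?_
    rcases y with ⟨_ | ⟨β, B⟩, w⟩ <;> rfl
  have hnone : S.toFun none ≠ 0 → (r = [] ∧ Rel Y) ∧ (c none).1 = e Y ∧ (c none).2 ≤ 1 := by
    intro h0
    obtain ⟨u, hu, hdu⟩ := map_toFun_ne h0
    have hdu' : d u = none := by simpa using hdu
    have hst := ((hd u hu).1 hdu').1
    refine ⟨⟨hst.1, hst.2.1⟩, ?_⟩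
    have hK : Convex ℝ ({v : V | v = e Y} ×ˢ Set.Iic (1:ℝ)) := by
      have : {v : V | v = e Y} = {e Y} := rfl
      rw [this]
      exact (convex_singleton _).prod (convex_Iic _)
    have := hc2 none _ hK ⟨u, bindD_ne hu (by rw [hk0 u hdu', dirac_self]; exact one_ne_zero)⟩ (by
      intro w hw
      obtain ⟨u', hu', hw'⟩ := hJs _ _ hw
      rcases hdu2 : d u' with _ | ⟨tr, f⟩
      · rw [hk0 u' hdu2] at hw'
        have := dirac_ne hw'
        simp only [Prod.mk.injEq, true_and] at this
        subst this
        have h3 := (hd w hu').1 hdu2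
        exact ⟨h3.1.2.2, h3.2⟩
      · rw [hk1 u' tr f hdu2] at hw'
        obtain ⟨B, _, hB⟩ := map_toFun_ne hw'
        simp at hB)
    exact this
  refine ⟨S, fun β B => c (some (β, B)), ?_, fun h0 => (hnone h0).1, ?_, ?_⟩
  · intro tr htr
    obtain ⟨u, hu, hdu⟩ := map_toFun_ne htr
    obtain ⟨⟨tr', f⟩, hdu', htr'⟩ := Option.map_eq_some_iff.mp hdu
    simp only at htr'
    subst htr'
    obtain ⟨h1, h2, r', h3, h4⟩ := (hd u hu).2 _ _ hdu'
    refine ⟨h1, r', h3, fun B hB => ?_⟩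
    refine hc2 _ _ (GT.convex' hΦ n (B, r')) ⟨f B, bindD_ne hu ?_⟩ ?_
    · rw [hk1 u _ f hdu']
      exact map_ne (g := fun B => (some (tr'.val.2.1, B), f B)) hB
    · intro w hw
      obtain ⟨u', hu', hw'⟩ := hJs _ _ hw
      rcases hdu2 : d u' with _ | ⟨tr2, f2⟩
      · rw [hk0 u' hdu2] at hw'
        have := dirac_ne hw'
        simp at this
      · rw [hk1 u' tr2 f2 hdu2] at hw'
        obtain ⟨B', hB', heq⟩ := map_toFun_ne hw'
        simp only [Prod.mk.injEq, Option.some.injEq] at heq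
        obtain ⟨⟨e1, rfl⟩, rfl⟩ := heq
        obtain ⟨_, _, r2, h5, h6⟩ := (hd u' hu').2 _ _ hdu2
        rw [e1, h3] at h5
        have : r2 = r' := (List.append_cancel_left h5).symm
        rw [← this]
        exact h6 _ hB'
  · conv_lhs => rw [hxS]
    rw [ex_fst]
    refine ex_congr fun o ho => ?_
    rcases o with _ | tr
    · exact (hnone ho).2.1
    · simp only [Option.elim]
      rw [ex_fst]
  · conv_lhs => rw [hxS]
    rw [ex_snd]
    refine ex_mono fun o ho => ?_
    rcases o with _ | tr
    · exact (hnone ho).2.2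
    · simp only [Option.elim]
      rw [ex_snd]

/-- Scheduler memory. -/
structure Mem (V : Type) where
  r : List Act
  n : ℕ
  v : V
  p : ℝ

/-- The invariant between the current state and the memory. -/
def MInv (Rel : Tm → Prop) (e : Tm → V) (B : Tm) (m : Mem V) : Prop :=
  (m.v, m.p) ∈ GT (PhiE Rel e) (m.n + 1) (B, m.r)

theorem mem_step [FiniteDimensional ℝ V] {Rel : Tm → Prop} {e : Tm → V} (he : ∀ Z, ‖e Z‖ ≤ 1)
    (Y : Tm) (m : Mem V) :
    ∃ (S : FinDist (Option PTrans)) (nx : Act → Tm → Mem V) (q : Act → Tm → ℝ),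
      (∀ tr, S.toFun (some tr) ≠ 0 → tr.val.1 = Y) ∧ (MInv Rel e Y m →
      (S.toFun none ≠ 0 → m.r = [] ∧ Rel Y) ∧
      (∀ tr B, S.toFun (some tr) ≠ 0 → tr.val.2.2.toFun B ≠ 0 →
        MInv Rel e B (nx tr.val.2.1 B) ∧ m.r = extTrace tr.val.2.1 ++ (nx tr.val.2.1 B).r ∧
        ((q tr.val.2.1 B = (nx tr.val.2.1 B).p ∧ (nx tr.val.2.1 B).n < m.n) ∨
          (q tr.val.2.1 B ≤ 0 ∧ 1/2 ≤ (nx tr.val.2.1 B).p))) ∧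
      m.v = ex S (fun o => o.elim (e Y) (fun tr => ex tr.val.2.2 (fun B => (nx tr.val.2.1 B).v))) ∧
      m.p ≤ ex S (fun o => o.elim 1 (fun tr => ex tr.val.2.2 (fun B => q tr.val.2.1 B)))) := by
  by_cases hm : MInv Rel e Y m
  swap
  · exact ⟨FinDist.dirac none, fun _ _ => m, fun _ _ => 0,
      fun tr h => absurd (dirac_ne h) (by simp), fun h => absurd h hm⟩
  have hΦ : Bd (PhiE Rel e) := PhiE.bd he
  obtain ⟨S, c, h1, h2, h3, h4⟩ := GT.decide he hm
  -- the next memory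
  have hnx : ∀ (β : Act) (B : Tm), ∃ m' : Mem V, m'.v = (c β B).1 ∧
      ∀ r', m.r = extTrace β ++ r' → c β B ∈ GT (PhiE Rel e) m.n (B, r') →
        MInv Rel e B m' ∧ m.r = extTrace β ++ m'.r ∧
        (((c β B).2 = m'.p ∧ m'.n < m.n) ∨ ((c β B).2 ≤ 0 ∧ 1/2 ≤ m'.p)) := by
    intro β B
    by_cases hr : ∃ r', m.r = extTrace β ++ r' ∧ c β B ∈ GT (PhiE Rel e) m.n (B, r')
    · obtain ⟨r', hr', hcB⟩ := hr
      rcases hn : m.n with _ | k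
      · rw [hn] at hcB
        obtain ⟨n', p', hp', hg⟩ := Ach.gt hΦ hcB.1
        exact ⟨⟨r', n', (c β B).1, p'⟩, rfl, fun _ _ _ => ⟨hg, hr', Or.inr ⟨hcB.2, hp'⟩⟩⟩
      · rw [hn] at hcB
        exact ⟨⟨r', k, (c β B).1, (c β B).2⟩, rfl, fun _ _ _ => ⟨hcB, hr', Or.inl
          ⟨rfl, Nat.lt_succ_self k⟩⟩⟩
    · exact ⟨⟨m.r, m.n, (c β B).1, m.p⟩, rfl, fun r' h h' => absurd ⟨r', h, h'⟩ hr⟩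
  choose nx hnv hnp using hnx
  refine ⟨S, nx, fun β B => (c β B).2, fun tr h => (h1 tr h).1, fun _ => ⟨h2, ?_, ?_, h4⟩⟩
  · intro tr B htr hB
    obtain ⟨_, r', hr', hc⟩ := h1 tr htr
    exact hnp _ _ r' hr' (hc B hB)
  · simp only [hnv]
    exact h3

end AsmSec

/-! ## The scheduler of a guarded tree -/

section SchedSec

/-- Memory after a fragment (steps in reverse order). -/
def memAux {V : Type} (nx : Tm → Mem V → Act → Tm → Mem V) (m0 : Mem V) (head : Tm) :
    List (Act × Tm) → Mem V
  | [] => m0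
  | s :: rest => nx (Frag.last ⟨head, rest.reverse⟩) (memAux nx m0 head rest) s.1 s.2

/-- Memory after a fragment. -/
def memF {V : Type} (nx : Tm → Mem V → Act → Tm → Mem V) (m0 : Mem V) (ω : Frag) : Mem V :=
  memAux nx m0 ω.head ω.steps.reverse

theorem memF_root {V : Type} (nx : Tm → Mem V → Act → Tm → Mem V) (m0 : Mem V) (A : Tm) :
    memF nx m0 (rootF A) = m0 := rfl

theorem memF_snoc {V : Type} (nx : Tm → Mem V → Act → Tm → Mem V) (m0 : Mem V) (ω : Frag)
    (s : Act × Tm) : memF nx m0 (ω.snoc s) = nx ω.last (memF nx m0 ω) s.1 s.2 := by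
  obtain ⟨A, l⟩ := ω
  simp [memF, Frag.snoc, memAux]

variable {V : Type} [NormedAddCommGroup V] [NormedSpace ℝ V]

theorem assemble [FiniteDimensional ℝ V] {Rel : Tm → Prop} {e : Tm → V} (he : ∀ Z, ‖e Z‖ ≤ 1)
    {Q : Tm} {α : Act} {w : V} (h : Ach (PhiE Rel e) (Q, extTrace α) w) :
    ∃ ρ : CDist Tm, WeakCombined Q α ρ ∧ (∀ B, ρ.toFun B ≠ 0 → Rel B) ∧
      HasSum (fun B => ρ.toFun B • e B) w := by
  have hcs : CompleteSpace V := FiniteDimensional.complete ℝ V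
  have hΦ : Bd (PhiE Rel e) := PhiE.bd he
  obtain ⟨n0, p0, hp0, hg0⟩ := h.gt hΦ
  choose S nx q hval hst using fun Y (m : Mem V) => mem_step (Rel := Rel) he Y m
  set m0 : Mem V := ⟨extTrace α, n0, w, p0⟩ with hm0
  set mm := memF nx m0 with hmm
  set σ : Sched := fun ω => S ω.last (mm ω) with hσ
  have hmsnoc : ∀ ω s, mm (ω.snoc s) = nx ω.last (mm ω) s.1 s.2 := memF_snoc nx m0
  have hvalid : σ.Valid := fun ω tr htr => hval _ _ tr htr
  -- invariant
  have hinv : ∀ ω, Reach Q σ ω → MInv Rel e ω.last (mm ω) ∧ ω.trace ++ (mm ω).r = extTrace α := by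
    intro ω hω
    induction hω with
    | root => exact ⟨hg0, by simp [Frag.trace, rootF, hmm, hm0, memF, memAux]⟩
    | @step ω tr B _ h1 h2 ih =>
      obtain ⟨i1, i2, i3⟩ := (hst _ _ ih.1).2.1 tr B h1 h2
      rw [hmsnoc, Frag.snoc_last, Frag.snoc_trace]
      refine ⟨i1, ?_⟩
      rw [List.append_assoc]
      simp only
      rw [← i2]
      exact ih.2
  -- limit of the halting probabilities
  choose a ha ha1 han using fun ω => an_tendsto σ ω
  have ha0 : ∀ ω, 0 ≤ a ω := fun ω => (an_bounds σ 0 ω).1.trans (han ω 0)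
  have hafix : ∀ ω, a ω = ex (σ ω) (fun o => o.elim (1:ℝ)
      (fun tr => ex tr.val.2.2 (fun B => a (ω.snoc (tr.val.2.1, B))))) :=
    fun ω => Wlim_fix (h := fun _ => (1:ℝ)) (Wl := a) ha ω
  have hcase : ∀ c : ℝ, c ≤ 1 → (∀ ω, Reach Q σ ω → 1/2 ≤ (mm ω).p → c ≤ a ω) →
      ∀ n ω, Reach Q σ ω → (mm ω).n < n → c + (1 - c) * (mm ω).p ≤ a ω := by
    intro c hc hH n
    induction n with
    | zero => intro ω _ hn; exact absurd hn (Nat.not_lt_zero _)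
    | succ n ih =>
      intro ω hω hn
      have hs := hst _ _ (hinv ω hω).1
      rw [hafix ω]
      calc c + (1 - c) * (mm ω).p
          ≤ c + (1 - c) * ex (σ ω) (fun o => o.elim 1 (fun tr => ex tr.val.2.2
              (fun B => q ω.last (mm ω) tr.val.2.1 B))) := by
            have := hs.2.2.2
            have h1 : 0 ≤ 1 - c := by linarith
            have h2 := mul_le_mul_of_nonneg_left this h1
            linarith
        _ = ex (σ ω) (fun o => c + (1 - c) * (o.elim 1 (fun tr => ex tr.val.2.2
              (fun B => q ω.last (mm ω) tr.val.2.1 B)))) := by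
            rw [ex_add, ex_const]
            congr 1
            exact (ex_smul (σ ω) (1 - c) _).symm
        _ ≤ _ := by
            refine ex_mono fun o ho => ?_
            rcases o with _ | tr
            · simp
            · simp only [Option.elim]
              calc c + (1 - c) * ex tr.val.2.2 (fun B => q ω.last (mm ω) tr.val.2.1 B)
                  = ex tr.val.2.2 (fun B => c + (1 - c) * q ω.last (mm ω) tr.val.2.1 B) := by
                    rw [ex_add, ex_const]
                    congr 1
                    exact (ex_smul _ (1 - c) _).symm
                _ ≤ _ := by
                    refine ex_mono fun B hB => ?_
                    have hr' : Reach Q σ (ω.snoc (tr.val.2.1, B)) := Reach.step hω ho hB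
                    obtain ⟨_, _, h3⟩ := hs.2.1 tr B ho hB
                    have hmE := hmsnoc ω (tr.val.2.1, B)
                    simp only at hmE
                    rw [← hmE] at h3
                    rcases h3 with ⟨h4, h5⟩ | ⟨h4, h5⟩
                    · rw [h4]
                      exact ih _ hr' (by omega)
                    · have := hH _ hr' h5
                      have h6 : (1 - c) * q ω.last (mm ω) tr.val.2.1 B ≤ 0 :=
                        mul_nonpos_of_nonneg_of_nonpos (by linarith) h4
                      linarith
  have hH : ∀ k : ℕ, ∀ ω, Reach Q σ ω → 1/2 ≤ (mm ω).p → 1 - (1/2:ℝ)^k ≤ a ω := by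
    intro k
    induction k with
    | zero => intro ω _ _; simpa using ha0 ω
    | succ k ih =>
      intro ω hω hp
      have hk : (0:ℝ) ≤ (1/2:ℝ)^k := by positivity
      have := hcase (1 - (1/2:ℝ)^k) (by linarith) ih ((mm ω).n + 1) ω hω (Nat.lt_succ_self _)
      rw [pow_succ]
      nlinarith
  have hroot : a (rootF Q) = 1 := by
    apply le_antisymm (ha1 _)
    have h1 : Filter.Tendsto (fun k : ℕ => 1 - (1/2:ℝ)^k) Filter.atTop (nhds (1 - 0)) :=
      tendsto_const_nhds.sub (tendsto_pow_atTop_nhds_zero_of_lt_one (by norm_num) (by norm_num))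
    rw [sub_zero] at h1
    exact le_of_tendsto' h1 fun k => hH k _ Reach.root hp0
  have hsum1 : ∑' ω, fragProb Q σ ω • (1:ℝ) = 1 := by
    have h1 := Wn_tendsto_root Q σ (fun _ => (1:ℝ)) (fun _ => by simp)
    exact (tendsto_nhds_unique h1 (ha (rootF Q))).trans hroot
  have hone : HasSum (fun ω => fragProb Q σ ω) 1 := by
    have h1 := (fragProb_summable Q σ).hasSum
    simp only [smul_eq_mul, mul_one] at hsum1
    rwa [hsum1] at h1
  -- values
  have hval : ∀ n ω, Reach Q σ ω → ‖(mm ω).v - Wn σ (fun ω => e ω.last) n ω‖ ≤ 1 - an σ n ω := by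
    intro n
    induction n with
    | zero =>
      intro ω hω
      have h1 : ‖(mm ω).v‖ ≤ 1 := Ach.bd _ _ _ (GT.ach hΦ _ (hinv ω hω).1)
      simpa [Wn, an] using h1
    | succ n ih =>
      intro ω hω
      have hs := hst _ _ (hinv ω hω).1
      rw [an_succ, ← ex_one_sub, hs.2.2.1]
      show ‖ex (σ ω) _ - ex (σ ω) _‖ ≤ _
      rw [← ex_sub]
      refine norm_ex_le' _ _ _ fun o ho => ?_
      rcases o with _ | tr
      · simp
      · simp only [Option.elim]
        rw [← ex_sub, ← ex_one_sub]
        refine norm_ex_le' _ _ _ fun B hB => ?_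
        have := ih _ (Reach.step hω ho hB)
        rw [hmsnoc] at this
        exact this
  have hvsum : ∑' ω, fragProb Q σ ω • e ω.last = w := by
    have h1 := Wn_tendsto_root Q σ (fun ω => e ω.last) (fun _ => he _)
    refine tendsto_nhds_unique h1 ?_
    have h2 : Filter.Tendsto (fun n => 1 - an σ n (rootF Q)) Filter.atTop (nhds (1 - 1)) :=
      tendsto_const_nhds.sub (hroot ▸ ha (rootF Q))
    rw [sub_self] at h2
    rw [tendsto_iff_norm_sub_tendsto_zero]
    refine squeeze_zero (fun _ => norm_nonneg _) (fun n => ?_) h2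
    rw [norm_sub_rev]
    exact hval n _ Reach.root
  -- the final distribution
  have hsB : ∀ B : Tm, Summable (fun ω : Frag => if ω.last = B then fragProb Q σ ω else 0) := by
    intro B
    refine Summable.of_nonneg_of_le (fun ω => ?_) (fun ω => ?_) (fragProb_summable Q σ)
    · split_ifs
      exacts [fragProb_nonneg _ _ _, le_refl _]
    · split_ifs
      exacts [le_refl _, fragProb_nonneg _ _ _]
  set ρ : Tm → ℝ := fun B => ∑' ω : Frag, if ω.last = B then fragProb Q σ ω else 0 with hρ
  have hρs : ∀ B : Tm, HasSum (fun ω : Frag => if ω.last = B then fragProb Q σ ω else 0) (ρ B) :=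
    fun B => (hsB B).hasSum
  have hρ1 : HasSum ρ 1 := by
    have := last_regroup hρs (fun _ => (1:ℝ)) (fun _ => by simp)
    rw [hsum1] at this
    simpa using this
  refine ⟨⟨ρ, fun B => ?_, hρ1.summable.countable_support, hρ1⟩, ⟨σ, hvalid, hone, ?_, hρs⟩, ?_, ?_⟩
  · refine tsum_nonneg fun ω => ?_
    split_ifs
    exacts [fragProb_nonneg _ _ _, le_refl _]
  · intro ω hω
    obtain ⟨h1, h2⟩ := Reach.of_frag hω
    obtain ⟨h3, h4⟩ := hinv ω h1
    rw [((hst _ _ h3).1 h2).1, List.append_nil] at h4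
    exact h4
  · intro B hB
    simp only [hρ] at hB
    obtain ⟨ω, hω⟩ : ∃ ω : Frag, (if ω.last = B then fragProb Q σ ω else 0) ≠ 0 := by
      by_contra hc
      push Not at hc
      apply hB
      simp only [hc, tsum_zero]
    by_cases hl : ω.last = B
    · rw [if_pos hl] at hω
      obtain ⟨h1, h2⟩ := Reach.of_frag hω
      rw [← hl]
      exact ((hst _ _ (hinv ω h1).1).1 h2).2
    · rw [if_neg hl] at hω
      exact absurd rfl hω
  · have := last_regroup hρs e he
    rw [hvsum] at this
    exact this

end SchedSec

/-! ## Weak bisimilarity is the largest weak bisimulation -/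

section TransSec

/-- The equivalence generated by weak bisimilarity. -/
def EE : Tm → Tm → Prop := Relation.EqvGen WeakBisim

theorem EE.equiv : Equivalence EE := Relation.EqvGen.is_equivalence _

theorem EE.bisim : IsWeakBisim EE := by
  refine ⟨EE.equiv, ?_⟩
  intro P Q hPQ α ρ hs
  let ι : Type := {B : Tm // ρ.toFun B ≠ 0}
  haveI : Finite ι := ρ.finite_support
  haveI : Fintype ι := Fintype.ofFinite ι
  let e : Tm → (ι → ℝ) := fun B i => if EE i.1 B then 1 else 0
  let Rel : Tm → Prop := fun B => ∃ A, ρ.toFun A ≠ 0 ∧ EE A B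
  have he : ∀ Z, ‖e Z‖ ≤ 1 := by
    intro Z
    refine (pi_norm_le_iff_of_nonneg zero_le_one).2 fun i => ?_
    simp only [e]
    split_ifs <;> simp
  have hΦ : Bd (PhiE Rel e) := PhiE.bd he
  have hemono : ∀ X Y, EE X Y → e X = e Y := by
    intro X Y h
    funext i
    simp only [e]
    have : EE i.1 X ↔ EE i.1 Y :=
      ⟨fun h' => EE.equiv.trans h' h, fun h' => EE.equiv.trans h' (EE.equiv.symm h)⟩
    simp only [this]
  have hinv : ∀ X Y r v, EE X Y → PhiE Rel e (X, r) v → PhiE Rel e (Y, r) v := by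
    rintro X Y r v h ⟨h1, ⟨A, hA, hAX⟩, h3⟩
    refine ⟨h1, ⟨A, hA, EE.equiv.trans hAX h⟩, ?_⟩
    rw [h3]
    exact hemono _ _ h
  have h0 : Ach (PhiE Rel e) (P, extTrace α) (ex ρ e) := by
    refine Ach.move hΦ (r' := []) e hs (by simp) fun B hB => Ach.halt hΦ ⟨rfl, ⟨B, hB, EE.equiv.refl B⟩, rfl⟩
  have htr : ∀ X Y, EE X Y → ∀ r v, Ach (PhiE Rel e) (X, r) v ↔ Ach (PhiE Rel e) (Y, r) v := by
    intro X Y h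
    induction h with
    | rel X Y h =>
      obtain ⟨E, hE, hXY⟩ := h
      have hi : ∀ X Y r v, E X Y → PhiE Rel e (X, r) v → PhiE Rel e (Y, r) v :=
        fun X Y r v h => hinv X Y r v (Relation.EqvGen.rel _ _ ⟨E, hE, h⟩)
      exact fun r v => ⟨ach_transfer hE hΦ hi hXY, ach_transfer hE hΦ hi (hE.1.symm hXY)⟩
    | refl X => exact fun r v => Iff.rfl
    | symm X Y _ ih => exact fun r v => (ih r v).symm
    | trans X Y Z _ _ ih1 ih2 => exact fun r v => (ih1 r v).trans (ih2 r v)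
  obtain ⟨ρ', hw, hrel, hsum⟩ := assemble he ((htr _ _ hPQ _ _).1 h0)
  refine ⟨ρ', hw, fun Z => ?_⟩
  rw [cmass_eq_ex]
  have hcm := cmass_hasSum ρ' {B | EE Z B}
  by_cases hZ : ∃ A, ρ.toFun A ≠ 0 ∧ EE Z A
  · obtain ⟨A, hA, hZA⟩ := hZ
    have hiff : ∀ B, EE A B ↔ EE Z B := fun B =>
      ⟨fun h => EE.equiv.trans hZA h, fun h => EE.equiv.trans (EE.equiv.symm hZA) h⟩
    have h1 := (Pi.hasSum.1 hsum) ⟨A, hA⟩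
    have h2 : (fun B => (ρ'.toFun B • e B) ⟨A, hA⟩) =
        fun B => if B ∈ {B | EE Z B} then ρ'.toFun B else 0 := by
      funext B
      simp only [Pi.smul_apply, smul_eq_mul, e, hiff B, Set.mem_setOf_eq]
      split_ifs <;> simp
    rw [h2] at h1
    rw [← h1.unique hcm]
    have h3 := ex_linear (LinearMap.proj (R := ℝ) (φ := fun _ : ι => ℝ) ⟨A, hA⟩) ρ e
    simp only [LinearMap.proj_apply] at h3
    rw [h3]
    refine ex_congr fun B _ => ?_
    simp only [e, hiff B, Set.mem_setOf_eq]
  · push Not at hZ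
    have h2 : (fun B => if B ∈ {B | EE Z B} then ρ'.toFun B else 0) = fun _ => (0:ℝ) := by
      funext B
      by_cases hB : B ∈ {B | EE Z B}
      · rw [if_pos hB]
        by_contra hc
        obtain ⟨A, hA, hAB⟩ := hrel B hc
        exact hZ A hA (EE.equiv.trans hB (EE.equiv.symm hAB))
      · rw [if_neg hB]
    rw [h2] at hcm
    rw [hcm.unique hasSum_zero]
    rw [ex_congr (g := fun _ => (0:ℝ)), ex_const]
    intro B hB
    exact if_neg (hZ B hB)

theorem WeakBisim.of_EE {P Q : Tm} (h : EE P Q) : WeakBisim P Q := ⟨EE, EE.bisim, h⟩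

theorem weak_eq : WeakBisim = EE := by
  funext P Q
  exact propext ⟨fun h => Relation.EqvGen.rel _ _ h, fun h => WeakBisim.of_EE h⟩

theorem weak_bisim : IsWeakBisim WeakBisim := by
  rw [weak_eq]
  exact EE.bisim

end TransSec

/-! ## Weak bisimilarity implies box equality -/

section PartOne

/-- Weak bisimilarity, as a relation between processes and distributions. -/
def WG (Y : Tm) (θ : FinDist Tm) : Prop := ∃ Q, WeakBisim Y Q ∧ θ = FinDist.dirac Q

/-- Leaves bounded by `h`, at nodes with nothing left to produce. -/
def PhiH (h : Tm → ℝ) (y : Node) (v : ℝ) : Prop := y.2 = [] ∧ 0 ≤ v ∧ v ≤ 1 ∧ v ≤ h y.1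

theorem PhiH.bd (h : Tm → ℝ) : Bd (PhiH h) := by
  rintro y v ⟨_, h0, h1, _⟩
  rw [Real.norm_eq_abs, abs_of_nonneg h0]
  exact h1

theorem wg_match {Y Q : Tm} {α : Act} {ρ : FinDist Tm} {f h : Tm → ℝ} (hYQ : WeakBisim Y Q)
    (hs : Step Y α ρ) (hf : B01 f) (hc : Compat WG f h) :
    Ach (PhiH h) (Q, extTrace α) (ex ρ f) := by
  have := weak_match weak_bisim hYQ hs (PhiH.bd h) (r' := []) f (fun B _ => by
    rw [Real.norm_eq_abs, abs_of_nonneg (hf B).1]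
    exact (hf B).2) (fun Z D hD => ⟨rfl, ex_nonneg fun B _ => (hf B).1,
      ex_le_one fun B _ => (hf B).2, ?_⟩)
  · rwa [List.append_nil] at this
  · have h1 : ex D f ≤ ex D (fun _ => h Z) := ex_mono fun B hB => by
      have := hc B _ ⟨Z, (hD B hB).2, rfl⟩
      rwa [ex_dirac] at this
    rwa [ex_const] at h1

theorem wg_dg : DG WG where
  diag := fun Y => ⟨Y, weak_bisim.1.refl Y, rfl⟩
  tau := by
    rintro Y θ ρ f g ⟨Q, hYQ, rfl⟩ hs hf hg hc he
    rw [ex_dirac]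
    have h1 := wg_match hYQ hs hf hc
    have h2 : extTrace Act.tau = [] := by simp [extTrace]
    rw [h2] at h1
    have h3 := Ach.le (PhiH.bd g) (G := fun y => if y.2 = [] then g y.1 else 1)
      (fun y => by
        split_ifs
        exacts [(hg _).1, zero_le_one])
      (fun y v hv => by
        rw [if_pos hv.1]
        exact hv.2.2.2)
      (fun X β ρ' r' hs' => by
        simp only
        by_cases hβ : extTrace β ++ r' = []
        · rw [if_pos hβ]
          obtain ⟨hb, hr⟩ := List.append_eq_nil_iff.1 hβ
          have hb' : β = Act.tau := by
            by_contra hne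
            simp [extTrace, hne] at hb
          simp only [hr, if_true]
          exact he X ρ' (hb' ▸ hs')
        · rw [if_neg hβ]
          refine ex_le_one fun B _ => ?_
          split_ifs
          exacts [(hg _).2, le_refl _])
      h1
    simpa using h3
  lab := by
    rintro α Y θ ρ f h g hα ⟨Q, hYQ, rfl⟩ hs hf hh hg hc heh heg hstep
    rw [ex_dirac]
    have h1 := wg_match hYQ hs hf hc
    have h2 : extTrace α = [α] := by simp [extTrace, hα]
    rw [h2] at h1
    have h3 := Ach.le (PhiH.bd h)
      (G := fun y => if y.2 = [] then h y.1 else if y.2 = [α] then g y.1 else 1)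
      (fun y => by
        split_ifs
        exacts [(hh _).1, (hg _).1, zero_le_one])
      (fun y v hv => by
        rw [if_pos hv.1]
        exact hv.2.2.2)
      (fun X β ρ' r' hs' => by
        simp only
        by_cases hb : β = Act.tau
        · subst hb
          have h2 : extTrace Act.tau = [] := by simp [extTrace]
          rw [h2, List.nil_append]
          by_cases hr : r' = []
          · simp only [hr, if_true]
            exact heh X ρ' hs'
          · by_cases hr2 : r' = [α]
            · simp only [hr2, if_true, if_neg (List.cons_ne_nil α [])]
              exact heg X ρ' hs'
            · simp only [if_neg hr, if_neg hr2]
              exact (ex_const _ _).le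
        · have h2 : extTrace β = [β] := by simp [extTrace, hb]
          rw [h2, if_neg (by simp)]
          by_cases hr : [β] ++ r' = [α]
          · rw [if_pos hr]
            simp only [List.singleton_append, List.cons.injEq] at hr
            obtain ⟨rfl, rfl⟩ := hr
            simp only [if_true]
            exact hstep X ρ' hs'
          · rw [if_neg hr]
            refine ex_le_one fun B _ => ?_
            split_ifs
            exacts [(hh _).2, (hg _).2, le_refl _])
      h1
    simpa using h3

theorem wg_good : GoodG WG := by
  left
  rintro Y θ ⟨Q, h, rfl⟩
  exact ⟨Q, rfl, Y, weak_bisim.1.symm h, rfl⟩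

theorem wg_eq {μ1 μ2 : FinDist Tm} (h : WeakBisimD μ1 μ2) : EqG WG μ1 μ2 := by
  intro f hf he
  let s : Setoid Tm := ⟨WeakBisim, weak_bisim.1⟩
  let rep : Tm → Tm := fun B => (Quotient.mk s B).out
  have hrep : ∀ B, WeakBisim (rep B) B := fun B => Quotient.mk_out (s := s) B
  have hfr : ∀ B, f B = f (rep B) := by
    intro B
    have := he B _ ⟨rep B, weak_bisim.1.symm (hrep B), rfl⟩
    rwa [ex_dirac] at this
  have hiff : ∀ B C, rep B = rep C ↔ WeakBisim (rep C) B := by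
    intro B C
    constructor
    · intro hBC
      rw [← hBC]
      exact hrep B
    · intro hBC
      have : Quotient.mk s B = Quotient.mk s C :=
        Quotient.sound (weak_bisim.1.trans (weak_bisim.1.symm hBC) (hrep C))
      simp only [rep, this]
  let T : Finset Tm := (μ1.finite_support.toFinset ∪ μ2.finite_support.toFinset).image rep
  have key : ∀ μ : FinDist Tm, (∀ a, μ.toFun a ≠ 0 → rep a ∈ T) →
      ex μ f = ∑ Z ∈ T, μ.mass {Q | WeakBisim Z Q} * f Z := by
    intro μ hμ
    have h1 : ex μ f = ex (μ.map rep) f := by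
      rw [ex_map]
      exact ex_congr fun a _ => hfr a
    rw [h1, ex_eq_sum _ _ T]
    · refine Finset.sum_congr rfl fun Z hZ => ?_
      obtain ⟨C, _, rfl⟩ := Finset.mem_image.1 hZ
      rw [smul_eq_mul, toFun_eq_ex, ex_map, mass_eq_ex]
      congr 1
      refine ex_congr fun a _ => ?_
      have h2 : (a ∈ {Q | WeakBisim (rep C) Q}) ↔ rep a = rep C := (hiff a C).symm
      simp only [h2]
    · intro a ha
      rw [toFun_eq_ex, ex_map] at ha
      by_contra hc
      apply ha
      rw [ex_congr (g := fun _ => (0:ℝ)), ex_const]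
      intro b hb
      have : rep b ≠ a := by
        rintro rfl
        exact hc (hμ b hb)
      simp [this]
  rw [key μ1, key μ2]
  · exact Finset.sum_congr rfl fun Z _ => by rw [h Z]
  · intro a ha
    exact Finset.mem_image_of_mem _ (Finset.mem_union_right _ (by simpa using ha))
  · intro a ha
    exact Finset.mem_image_of_mem _ (Finset.mem_union_left _ (by simpa using ha))

end PartOne

/-- the spectrum. On `D(P_RCCS)`:
`≈p ⊊ =□^p ⊊ =◇^p`. -/
theorem probabilistic_spectrum :
    (∀ μ1 μ2 : FinDist Tm, μ1.IsProcDist → μ2.IsProcDist →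
      WeakBisimD μ1 μ2 → BoxEq fullCtx μ1 μ2) ∧
    (∃ μ1 μ2 : FinDist Tm, μ1.IsProcDist ∧ μ2.IsProcDist ∧
      BoxEq fullCtx μ1 μ2 ∧ ¬ WeakBisimD μ1 μ2) ∧
    (∀ μ1 μ2 : FinDist Tm, μ1.IsProcDist → μ2.IsProcDist →
      BoxEq fullCtx μ1 μ2 → DiamondEq fullCtx μ1 μ2) ∧
    (∃ μ1 μ2 : FinDist Tm, μ1.IsProcDist ∧ μ2.IsProcDist ∧
      DiamondEq fullCtx μ1 μ2 ∧ ¬ BoxEq fullCtx μ1 μ2) := by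
  refine ⟨fun μ1 μ2 _ _ h => box_of wg_dg wg_good (wg_eq h) _, ?_, ?_, ?_⟩
  · exact ⟨_, _, dirac_proc tmO_proc, thO_proc, box_O, not_weak_O weak_bisim.1.refl⟩
  · exact fun μ1 μ2 _ _ h => box_diamond μ1 μ2 h
  · exact ⟨_, _, dirac_proc tmM_proc, dirac_proc tmA_proc, diamond_MA, not_box_MA⟩
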